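/- arXiv:2110.05918 — 2 statements merged into one kernel-verified Lean document; each statement's English description precedes it below -/
import Mathlib

section
/- Fix λ ∈ (-1/2, ∞), λ ≠ 0. With the Gegenbauer kernel K_n^λ and weight w^λ, define E(λ,n+1) = L1(λ,n) - L2(λ,n), where L1(λ,n) = ∬_{[-1,1]²} K_n^λ(x,x) K_n^λ(y,y) log(1/|x-y|) w^λ(x) w^λ(y) dx dy and L2(λ,n) = ∬_{[-1,1]²} K_n^λ(x,y)² log(1/|x-y|) w^λ(x) w^λ(y) dx dy. Then, as n → ∞, ( E(λ,n+1) - (n+1)²·log 2 + (n+1)·log(n+1) - (1 - γ - 2·log 2)·n ) / n → 0, where γ is the Euler–Mascheroni constant. -/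
open Real MeasureTheory Finset

/-- Gegenbauer polynomials `C_n^λ`, defined by `C_0^λ(x) = 1`, `C_1^λ(x) = 2λx` and the
recurrence `n·C_n^λ(x) = 2(n+λ-1)·x·C_{n-1}^λ(x) - (n+2λ-2)·C_{n-2}^λ(x)`. -/
noncomputable def Geg (lam : ℝ) : ℕ → ℝ → ℝ
  | 0, _ => 1
  | 1, x => 2 * lam * x
  | (n + 2), x =>
      (2 * ((n : ℝ) + 1 + lam) * x * Geg lam (n + 1) x
        - ((n : ℝ) + 2 * lam) * Geg lam n x) / ((n : ℝ) + 2)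

/-- The Gegenbauer weight `w^λ(x) = Γ(λ+1)/(√π·Γ(λ+1/2))·(1-x²)^{λ-1/2}`. -/
noncomputable def wG (lam : ℝ) (x : ℝ) : ℝ :=
  Real.Gamma (lam + 1) / (Real.sqrt Real.pi * Real.Gamma (lam + 1 / 2)) *
    (1 - x ^ 2) ^ (lam - 1 / 2)

/-- Normalization constant `γ_n^λ = √(n!·(n+λ)/(λ·(2λ)_n))`. -/
noncomputable def gamG (lam : ℝ) (n : ℕ) : ℝ :=
  Real.sqrt ((n.factorial : ℝ) * ((n : ℝ) + lam) /
    (lam * (ascPochhammer ℝ n).eval (2 * lam)))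

/-- Normalized Gegenbauer polynomials `Ĉ_n^λ = γ_n^λ·C_n^λ`. -/
noncomputable def GegHat (lam : ℝ) (n : ℕ) (x : ℝ) : ℝ := gamG lam n * Geg lam n x

/-- The Gegenbauer projection kernel `K_n^λ(x,y) = ∑_{j=0}^n Ĉ_j^λ(x)Ĉ_j^λ(y)`. -/
noncomputable def KG (lam : ℝ) (n : ℕ) (x y : ℝ) : ℝ :=
  ∑ j ∈ Finset.range (n + 1), GegHat lam j x * GegHat lam j y

noncomputable def L1 (lam : ℝ) (n : ℕ) : ℝ :=
  ∫ x in Set.Icc (-1 : ℝ) 1, ∫ y in Set.Icc (-1 : ℝ) 1,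
    KG lam n x x * KG lam n y y * Real.log (1 / |x - y|) * wG lam x * wG lam y

noncomputable def L2 (lam : ℝ) (n : ℕ) : ℝ :=
  ∫ x in Set.Icc (-1 : ℝ) 1, ∫ y in Set.Icc (-1 : ℝ) 1,
    KG lam n x y ^ 2 * Real.log (1 / |x - y|) * wG lam x * wG lam y

lemma gg_wG_eq_beta (lam : ℝ) (hlam : -(1 / 2) < lam) {x : ℝ} (h1 : -1 < x) (h2 : x < 1) :
    wG lam x = (1 / 2) * ProbabilityTheory.betaPDFReal (lam + 1 / 2) (lam + 1 / 2) ((x + 1) / 2) := by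
  have ha : 0 < lam + 1 / 2 := by linarith
  have e1 : (0:ℝ) < (x + 1) / 2 := by linarith
  have e2 : (x + 1) / 2 < 1 := by linarith
  rw [wG, ProbabilityTheory.betaPDFReal, if_pos ⟨e1, e2⟩, ProbabilityTheory.beta]
  have hG := Real.Gamma_mul_Gamma_add_half (lam + 1 / 2)
  have g1 := Real.Gamma_pos_of_pos ha
  have g2 : 0 < Real.Gamma (lam + 1) := Real.Gamma_pos_of_pos (by linarith)
  have g3 : 0 < Real.Gamma (lam + 1/2 + (lam + 1/2)) := Real.Gamma_pos_of_pos (by linarith)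
  have hs : 0 < Real.sqrt π := Real.sqrt_pos.2 Real.pi_pos
  have e3 : lam + 1 / 2 + 1 / 2 = lam + 1 := by ring
  have e4 : 2 * (lam + 1 / 2) = lam + 1/2 + (lam + 1/2) := by ring
  rw [e3, e4] at hG
  have e5 : ((x + 1) / 2) ^ (lam + 1 / 2 - 1) * (1 - (x + 1) / 2) ^ (lam + 1 / 2 - 1)
      = (1 - x ^ 2) ^ (lam - 1 / 2) * (2 * (2:ℝ) ^ (1 - (lam + 1 / 2 + (lam + 1 / 2)))) := by
    rw [← Real.mul_rpow e1.le (by linarith)]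
    have : (x + 1) / 2 * (1 - (x + 1) / 2) = (1 - x^2) * ((2:ℝ) ^ (-2:ℝ)) := by
      rw [Real.rpow_neg (by norm_num)]; norm_num; ring
    rw [this, Real.mul_rpow (by nlinarith) (by positivity), ← Real.rpow_mul (by norm_num)]
    have : (2:ℝ) * (2:ℝ) ^ (1 - (lam + 1 / 2 + (lam + 1 / 2))) = 2 ^ (1 + (1 - (lam + 1 / 2 + (lam + 1 / 2)))) := by
      rw [Real.rpow_add (by norm_num) 1, Real.rpow_one]
    rw [this]
    congr 2
    · ring
    · ring
  rw [mul_assoc (1 / _), e5]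
  rw [mul_comm] at hG
  generalize Real.Gamma (lam + 1/2 + (lam + 1/2)) = G3 at *
  generalize Real.Gamma (lam + 1/2) = G1 at *
  generalize Real.Gamma (lam + 1) = G2 at *
  generalize (1 - x ^ 2) ^ (lam - 1 / 2) = W at *
  generalize (2:ℝ) ^ (1 - (lam + 1 / 2 + (lam + 1 / 2))) = Z at *
  field_simp
  linear_combination W * hG

lemma gg_betaPDF_integrable {a : ℝ} (ha : 0 < a) :
    Integrable (ProbabilityTheory.betaPDFReal a a) ∧ ∫ x, ProbabilityTheory.betaPDFReal a a x = 1 := by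
  have h := ProbabilityTheory.lintegral_betaPDF_eq_one ha ha
  have hm : AEStronglyMeasurable (ProbabilityTheory.betaPDFReal a a) volume := by fun_prop
  have hp : ∀ x, 0 ≤ ProbabilityTheory.betaPDFReal a a x := by
    intro x
    by_cases hx : 0 < x ∧ x < 1
    · exact (ProbabilityTheory.betaPDFReal_pos hx.1 hx.2 ha ha).le
    · rw [ProbabilityTheory.betaPDFReal, if_neg hx]
  constructor
  · refine ⟨hm, ?_⟩
    rw [hasFiniteIntegral_iff_ofReal (Filter.Eventually.of_forall hp)]
    have : ∫⁻ x, ENNReal.ofReal (ProbabilityTheory.betaPDFReal a a x) = 1 := h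
    rw [this]; exact ENNReal.one_lt_top
  · rw [integral_eq_lintegral_of_nonneg_ae (Filter.Eventually.of_forall hp) hm]
    have : ∫⁻ x, ENNReal.ofReal (ProbabilityTheory.betaPDFReal a a x) = 1 := h
    rw [this]; rfl

lemma gg_wG_int (lam : ℝ) (hlam : -(1 / 2) < lam) :
    IntegrableOn (wG lam) (Set.Icc (-1) 1) ∧ ∫ x in Set.Icc (-1:ℝ) 1, wG lam x = 1 := by
  have ha : 0 < lam + 1 / 2 := by linarith
  obtain ⟨h1, h2⟩ := gg_betaPDF_integrable ha
  set f := ProbabilityTheory.betaPDFReal (lam + 1 / 2) (lam + 1 / 2) with hf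
  have h3 : Integrable (fun x => (1/2) * f ((x + 1) / 2)) := by
    have := (h1.comp_div (R := 2) (by norm_num)).comp_add_right 1
    exact this.const_mul _
  have h4 : ∫ x, (1/2) * f ((x + 1) / 2) = 1 := by
    rw [integral_const_mul]
    have := integral_add_right_eq_self (μ := volume) (fun x => f (x / 2)) 1
    rw [this, Measure.integral_comp_div, h2]
    norm_num
  have h5 : ∀ x ∈ Set.Ioo (-1:ℝ) 1, wG lam x = (1/2) * f ((x + 1) / 2) := fun x hx =>
    gg_wG_eq_beta lam hlam hx.1 hx.2
  have h6 : ∀ x ∉ Set.Ioo (-1:ℝ) 1, (1/2) * f ((x + 1) / 2) = 0 := by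
    intro x hx
    rw [hf, ProbabilityTheory.betaPDFReal, if_neg]; · simp
    rintro ⟨ha, hb⟩
    exact hx ⟨by linarith, by linarith⟩
  rw [integrableOn_Icc_iff_integrableOn_Ioo, integral_Icc_eq_integral_Ioo]
  constructor
  · exact (h3.integrableOn).congr_fun (fun x hx => (h5 x hx).symm) measurableSet_Ioo
  · rw [setIntegral_congr_fun measurableSet_Ioo h5]
    exact (setIntegral_eq_integral_of_forall_compl_eq_zero h6).trans h4

lemma gg_wG_nonneg (lam : ℝ) (hlam : -(1 / 2) < lam) {x : ℝ} (hx : x ∈ Set.Icc (-1:ℝ) 1) :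
    0 ≤ wG lam x := by
  have g1 := Real.Gamma_pos_of_pos (show 0 < lam + 1 / 2 by linarith)
  have g2 : 0 < Real.Gamma (lam + 1) := Real.Gamma_pos_of_pos (by linarith)
  rw [wG]
  have : 0 ≤ 1 - x ^ 2 := by nlinarith [hx.1, hx.2]
  positivity

lemma gg_int_mul (lam : ℝ) (hlam : -(1 / 2) < lam) {f : ℝ → ℝ} (hf : Continuous f) :
    IntegrableOn (fun x => f x * wG lam x) (Set.Icc (-1) 1) := by
  exact (gg_wG_int lam hlam).1.continuousOn_mul hf.continuousOn isCompact_Icc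

open Polynomial in
/-- integration against the Gegenbauer weight -/
noncomputable def ggJ (lam : ℝ) (hlam : -(1 / 2) < lam) : ℝ[X] →ₗ[ℝ] ℝ where
  toFun p := ∫ x in Set.Icc (-1:ℝ) 1, p.eval x * wG lam x
  map_add' p q := by
    simp only [eval_add, add_mul]
    exact integral_add (gg_int_mul lam hlam p.continuous) (gg_int_mul lam hlam q.continuous)
  map_smul' c p := by
    simp only [eval_smul, smul_eq_mul, mul_assoc, RingHom.id_apply]
    exact integral_const_mul _ _

open Polynomial in
lemma ggJ_ibp (lam : ℝ) (hlam : -(1 / 2) < lam) (p : ℝ[X]) :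
    ggJ lam hlam ((1 - X ^ 2) * derivative p - C (2 * lam + 1) * X * p) = 0 := by
  have ha : 0 < lam + 1 / 2 := by linarith
  set K := Real.Gamma (lam + 1) / (Real.sqrt Real.pi * Real.Gamma (lam + 1 / 2)) with hK
  set q := ((1 - X ^ 2) * derivative p - C (2 * lam + 1) * X * p) with hq
  have hIntg := gg_int_mul lam hlam q.continuous
  change ∫ x in Set.Icc (-1:ℝ) 1, q.eval x * wG lam x = 0
  rw [integral_Icc_eq_integral_Ioc, ← intervalIntegral.integral_of_le (by norm_num)]
  have hii : IntervalIntegrable (fun x => q.eval x * wG lam x) volume (-1) 1 := by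
    rw [intervalIntegrable_iff_integrableOn_Icc_of_le (by norm_num)]; exact hIntg
  rw [intervalIntegral.integral_eq_sub_of_hasDerivAt_of_le (by norm_num)
    (f := fun x => K * (1 - x ^ 2) ^ (lam + 1 / 2) * p.eval x) ?_ ?_ hii]
  · have h0 : (0:ℝ) ^ (lam + 1/2) = 0 := Real.zero_rpow ha.ne'
    have h1 : (1:ℝ) - 1 ^ 2 = 0 := by norm_num
    have h2 : (1:ℝ) - (-1) ^ 2 = 0 := by norm_num
    simp only [h1, h2, h0]; ring
  · apply Continuous.continuousOn
    have : Continuous fun x : ℝ => (1 - x ^ 2) ^ (lam + 1 / 2) :=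
      Continuous.rpow_const (by fun_prop) (fun x => Or.inr ha.le)
    have := p.continuous
    fun_prop
  · intro x hx
    have hpos : 0 < 1 - x ^ 2 := by nlinarith [hx.1, hx.2]
    have d1 : HasDerivAt (fun x : ℝ => 1 - x ^ 2) (-(2 * x)) x := by
      simpa using (hasDerivAt_pow 2 x).const_sub 1
    have d2 := (d1.rpow_const (p := lam + 1/2) (Or.inl hpos.ne')).const_mul K
    have d3 := d2.mul (p.hasDerivAt x)
    refine d3.congr_deriv ?_
    simp only [hq, wG, ← hK, eval_sub, eval_mul, eval_one, eval_pow, eval_X, eval_C]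
    have e : (1 - x ^ 2) ^ (lam + 1 / 2) = (1 - x ^ 2) ^ (lam - 1 / 2) * (1 - x ^ 2) := by
      nth_rewrite 3 [← Real.rpow_one (1 - x ^ 2)]
      rw [← Real.rpow_add hpos]; congr 1; ring
    have e' : lam + 1 / 2 - 1 = lam - 1/2 := by ring
    rw [e, e']; ring

open Polynomial in
lemma ggJ_nonneg (lam : ℝ) (hlam : -(1 / 2) < lam) (p : ℝ[X])
    (hp : ∀ x ∈ Set.Icc (-1:ℝ) 1, 0 ≤ p.eval x) : 0 ≤ ggJ lam hlam p :=
  setIntegral_nonneg measurableSet_Icc fun x hx => mul_nonneg (hp x hx) (gg_wG_nonneg lam hlam hx)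

open Polynomial in
lemma ggJ_one (lam : ℝ) (hlam : -(1 / 2) < lam) : ggJ lam hlam 1 = 1 := by
  change ∫ x in Set.Icc (-1:ℝ) 1, (1:ℝ[X]).eval x * wG lam x = 1
  simpa using (gg_wG_int lam hlam).2

section gegpoly
open Polynomial

noncomputable def ggC (lam : ℝ) : ℕ → ℝ[X]
  | 0 => 1
  | 1 => C (2 * lam) * X
  | (n + 2) => C (((n : ℝ) + 2)⁻¹) * (C (2 * ((n : ℝ) + 1 + lam)) * X * ggC lam (n + 1)
        - C ((n : ℝ) + 2 * lam) * ggC lam n)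

lemma ggC_eval (lam : ℝ) (x : ℝ) : ∀ n, (ggC lam n).eval x = Geg lam n x
  | 0 => by simp [ggC, Geg]
  | 1 => by simp [ggC, Geg]
  | (n + 2) => by
    rw [ggC, Geg]
    simp only [eval_mul, eval_C, eval_sub, eval_X, ggC_eval lam x n, ggC_eval lam x (n+1)]
    rw [div_eq_inv_mul]

lemma ggC_rec (lam : ℝ) (n : ℕ) : ((n:ℝ[X]) + 2) * ggC lam (n + 2) =
    2 * ((n:ℝ[X]) + 1 + C lam) * X * ggC lam (n + 1) - ((n:ℝ[X]) + 2 * C lam) * ggC lam n := by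
  have h : ((n:ℝ[X]) + 2) * C (((n : ℝ) + 2)⁻¹) = 1 := by
    have : ((n:ℝ[X]) + 2) = C ((n:ℝ) + 2) := by simp [C_ofNat]
    rw [this, ← C_mul, mul_inv_cancel₀ (by positivity), C_1]
  rw [ggC]
  simp only [C_mul, C_add, C_ofNat, C_1, map_natCast]
  linear_combination (2 * ((n:ℝ[X]) + 1 + C lam) * X * ggC lam (n + 1) - ((n:ℝ[X]) + 2 * C lam) * ggC lam n) * h

lemma ggC_struct (lam : ℝ) (n : ℕ) :
    (1 - X ^ 2) * derivative (ggC lam (n + 1)) =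
        -((n:ℝ[X]) + 1) * X * ggC lam (n + 1) + ((n:ℝ[X]) + 2 * C lam) * ggC lam n ∧
    (1 - X ^ 2) * derivative (ggC lam n) =
        ((n:ℝ[X]) + 2 * C lam) * X * ggC lam n - ((n:ℝ[X]) + 1) * ggC lam (n + 1) := by
  induction n with
  | zero =>
    constructor
    · simp [ggC, C_ofNat]; ring
    · simp [ggC, C_ofNat]
  | succ n ih =>
    obtain ⟨h1, h2⟩ := ih
    have hr := ggC_rec lam n
    have hd := congrArg derivative hr
    simp only [derivative_mul, derivative_sub, derivative_add, derivative_natCast, derivative_ofNat,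
      derivative_C, derivative_one, derivative_X] at hd
    have hn : ((n:ℝ[X]) + 2) ≠ 0 := by
      have : ((n:ℝ[X]) + 2) = ((n + 2 : ℕ) : ℝ[X]) := by push_cast; ring
      rw [this]; exact Nat.cast_ne_zero.2 (by omega)
    push_cast
    constructor
    · apply mul_left_cancel₀ hn
      linear_combination (1 - X^2) * hd + 2 * ((n:ℝ[X]) + 1 + C lam) * X * h1 - ((n:ℝ[X]) + 2 * C lam) * h2 + ((n:ℝ[X]) + 2) * X * hr
    · linear_combination h1 + hr

lemma ggC_ode (lam : ℝ) (n : ℕ) :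
    (1 - X ^ 2) * derivative (derivative (ggC lam n)) =
      (2 * C lam + 1) * X * derivative (ggC lam n) - (n:ℝ[X]) * ((n:ℝ[X]) + 2 * C lam) * ggC lam n := by
  obtain ⟨h1, h2⟩ := ggC_struct lam n
  have hd := congrArg derivative h2
  simp only [derivative_mul, derivative_sub, derivative_add, derivative_natCast, derivative_ofNat,
      derivative_C, derivative_one, derivative_X, derivative_X_pow] at hd
  have hn : (1 - X ^ 2 : ℝ[X]) ≠ 0 := by
    intro h
    have := congrArg (eval 0) h
    simp at this
  apply mul_left_cancel₀ hn
  simp [C_ofNat] at hd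
  linear_combination (1 - X^2) * hd - ((n:ℝ[X])+1) * h1 + ((n:ℝ[X])+1) * X * h2

end gegpoly

section gegpoly2
open Polynomial

/-- abstract data used in all the estimates. -/
structure GGData (lam : ℝ) where
  J : ℝ[X] →ₗ[ℝ] ℝ
  H : ℕ → ℝ[X]
  hlam : -(1 / 2) < lam
  hlam0 : lam ≠ 0
  one : J 1 = 1
  nonneg : ∀ p : ℝ[X], (∀ x ∈ Set.Icc (-1:ℝ) 1, 0 ≤ p.eval x) → 0 ≤ J p
  ibp : ∀ p : ℝ[X], J ((1 - X ^ 2) * derivative p - (2 * C lam + 1) * X * p) = 0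
  ode : ∀ n : ℕ, (1 - X ^ 2) * derivative (derivative (H n)) =
      (2 * C lam + 1) * X * derivative (H n) - (n:ℝ[X]) * ((n:ℝ[X]) + 2 * C lam) * H n
  orth : ∀ i j, J (H i * H j) = if i = j then 1 else 0
  degree : ∀ n, (H n).degree = n

lemma ggC_deg (lam : ℝ) : ∀ n, (ggC lam n).natDegree ≤ n
  | 0 => by simp [ggC]
  | 1 => by rw [ggC]; exact (natDegree_C_mul_le _ _).trans natDegree_X_le
  | (n + 2) => by
    rw [ggC]
    refine (natDegree_C_mul_le _ _).trans ?_
    refine (natDegree_sub_le _ _).trans (max_le ?_ ?_)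
    · have := ggC_deg lam (n+1)
      rw [mul_assoc]
      refine (natDegree_C_mul_le _ _).trans ?_
      refine natDegree_mul_le.trans ?_
      rw [natDegree_X]; omega
    · have := ggC_deg lam n
      refine (natDegree_C_mul_le _ _).trans ?_
      omega

lemma ggC_coeff (lam : ℝ) (hlam : -(1 / 2) < lam) (hlam0 : lam ≠ 0) : ∀ n, (ggC lam n).coeff n ≠ 0
  | 0 => by simp [ggC]
  | 1 => by simp [ggC, hlam0]
  | (n + 2) => by
    rw [ggC]
    have h1 := ggC_coeff lam hlam hlam0 (n+1)
    have h2 : (ggC lam n).coeff (n+2) = 0 :=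
      coeff_eq_zero_of_natDegree_lt (by have := ggC_deg lam n; omega)
    rw [coeff_C_mul, coeff_sub, coeff_C_mul _ (a := (n:ℝ) + 2 * lam), h2, mul_assoc, coeff_C_mul, coeff_X_mul]
    have : (n:ℝ) + 1 + lam ≠ 0 := by have : (0:ℝ) ≤ n := n.cast_nonneg; linarith
    have h3 : (n:ℝ) + 2 ≠ 0 := by positivity
    simp [this, h1, h3]

lemma ggC_degree (lam : ℝ) (hlam : -(1 / 2) < lam) (hlam0 : lam ≠ 0) (n : ℕ) :
    (ggC lam n).degree = n := by
  apply le_antisymm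
  · exact natDegree_le_iff_degree_le.1 (ggC_deg lam n)
  · exact le_degree_of_ne_zero (ggC_coeff lam hlam hlam0 n)

lemma ggC_orth (lam : ℝ) (hlam : -(1 / 2) < lam) (i j : ℕ) (hij : i ≠ j) :
    ggJ lam hlam (ggC lam i * ggC lam j) = 0 := by
  have h := ggJ_ibp lam hlam (derivative (ggC lam i) * ggC lam j - ggC lam i * derivative (ggC lam j))
  have e : (1 - X ^ 2) * derivative (derivative (ggC lam i) * ggC lam j - ggC lam i * derivative (ggC lam j))
      - C (2 * lam + 1) * X * (derivative (ggC lam i) * ggC lam j - ggC lam i * derivative (ggC lam j))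
      = ((j:ℝ) * (j + 2 * lam) - i * (i + 2 * lam)) • (ggC lam i * ggC lam j) := by
    simp only [derivative_sub, derivative_mul, smul_eq_C_mul, C_mul, C_sub, C_add, C_ofNat, C_1, map_natCast]
    linear_combination ggC_ode lam i * ggC lam j - ggC_ode lam j * ggC lam i
  rw [e, map_smul, smul_eq_mul] at h
  rcases mul_eq_zero.1 h with h | h
  · exfalso
    have h' : ((j:ℝ) - i) * ((j:ℝ) + i + 2 * lam) = 0 := by linear_combination h
    rcases mul_eq_zero.1 h' with h' | h'
    · exact hij (by exact_mod_cast (sub_eq_zero.1 h').symm)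
    · have : (1:ℝ) ≤ (j:ℝ) + i := by
        have : 1 ≤ j + i := by omega
        exact_mod_cast this
      linarith
  · exact h

lemma ggC_norm_rec (lam : ℝ) (hlam : -(1 / 2) < lam) (j : ℕ) :
    ((j:ℝ) + 1) * (j + 1 + lam) * ggJ lam hlam (ggC lam (j+1) * ggC lam (j+1)) =
      (j + lam) * (j + 2 * lam) * ggJ lam hlam (ggC lam j * ggC lam j) := by
  set I := ggJ lam hlam (X * ggC lam j * ggC lam (j+1)) with hI
  have a1 : 2 * ((j:ℝ) + 1 + lam) * I = (j + 2 * lam) * ggJ lam hlam (ggC lam j * ggC lam j) := by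
    have h := congrArg (fun p => ggJ lam hlam (p * ggC lam j)) (ggC_rec lam j)
    have e1 : ((j:ℝ[X]) + 2) * ggC lam (j + 2) * ggC lam j = ((j:ℝ) + 2) • (ggC lam (j+2) * ggC lam j) := by
      simp only [smul_eq_C_mul, C_add, C_ofNat, map_natCast]; ring
    have e2 : (2 * ((j:ℝ[X]) + 1 + C lam) * X * ggC lam (j + 1) - ((j:ℝ[X]) + 2 * C lam) * ggC lam j) * ggC lam j
       = (2 * ((j:ℝ) + 1 + lam)) • (X * ggC lam j * ggC lam (j+1)) - ((j:ℝ) + 2 * lam) • (ggC lam j * ggC lam j) := by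
      simp only [smul_eq_C_mul, C_add, C_ofNat, map_natCast, C_mul, C_1]; ring
    simp only [e1, e2, map_sub, map_smul, smul_eq_mul, ← hI] at h
    rw [ggC_orth lam hlam _ _ (by omega)] at h
    linarith
  have a2 : ((j:ℝ) + 1) * ggJ lam hlam (ggC lam (j+1) * ggC lam (j+1)) = 2 * (j + lam) * I := by
    rcases j with _ | j
    · have : ggC lam (0+1) * ggC lam (0+1) = (2 * lam) • (X * ggC lam 0 * ggC lam (0+1)) := by
        simp only [smul_eq_C_mul, ggC]; ring
      rw [this, map_smul, hI]
      simp
    · have h := congrArg (fun p => ggJ lam hlam (p * ggC lam (j+2))) (ggC_rec lam j)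
      have e1 : ((j:ℝ[X]) + 2) * ggC lam (j + 2) * ggC lam (j+2) = ((j:ℝ) + 2) • (ggC lam (j+2) * ggC lam (j+2)) := by
        simp only [smul_eq_C_mul, C_add, C_ofNat, map_natCast]; ring
      have e2 : (2 * ((j:ℝ[X]) + 1 + C lam) * X * ggC lam (j + 1) - ((j:ℝ[X]) + 2 * C lam) * ggC lam j) * ggC lam (j+2)
         = (2 * ((j:ℝ) + 1 + lam)) • (X * ggC lam (j+1) * ggC lam (j+2)) - ((j:ℝ) + 2 * lam) • (ggC lam j * ggC lam (j+2)) := by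
        simp only [smul_eq_C_mul, C_add, C_ofNat, map_natCast, C_mul, C_1]; ring
      simp only [e1, e2, map_sub, map_smul, smul_eq_mul, ← hI] at h
      rw [ggC_orth lam hlam j (j+2) (by omega)] at h
      push_cast
      rw [show j + 1 + 1 = j + 2 from rfl]
      linarith
  linear_combination ((j:ℝ) + 1 + lam) * a2 + (j + lam) * a1

lemma gg_poch_ne (lam : ℝ) (hlam : -(1 / 2) < lam) (hlam0 : lam ≠ 0) (n : ℕ) :
    (ascPochhammer ℝ n).eval (2 * lam) ≠ 0 := by
  induction n with
  | zero => simp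
  | succ n ih =>
    rw [ascPochhammer_succ_eval]
    refine mul_ne_zero ih ?_
    rcases n with _ | n
    · simpa using hlam0
    · have : (0:ℝ) ≤ n := n.cast_nonneg
      push_cast; linarith

lemma gg_nlam_ne (lam : ℝ) (hlam : -(1 / 2) < lam) (hlam0 : lam ≠ 0) (n : ℕ) :
    (n:ℝ) + lam ≠ 0 := by
  rcases n with _ | n
  · simpa using hlam0
  · have : (0:ℝ) ≤ n := n.cast_nonneg
    push_cast; linarith

lemma ggC_norm (lam : ℝ) (hlam : -(1 / 2) < lam) (hlam0 : lam ≠ 0) (n : ℕ) :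
    ((n.factorial : ℝ) * ((n : ℝ) + lam) / (lam * (ascPochhammer ℝ n).eval (2 * lam))) *
      ggJ lam hlam (ggC lam n * ggC lam n) = 1 := by
  induction n with
  | zero => simp [ggC, ggJ_one, hlam0]
  | succ n ih =>
    have hr := ggC_norm_rec lam hlam n
    have h1 := gg_nlam_ne lam hlam hlam0 n
    have h2 := gg_nlam_ne lam hlam hlam0 (n+1)
    have h3 := gg_poch_ne lam hlam hlam0 n
    have h4 := gg_poch_ne lam hlam hlam0 (n+1)
    rw [ascPochhammer_succ_eval] at h4 ⊢
    have h5 := right_ne_zero_of_mul h4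
    rw [Nat.factorial_succ]
    push_cast at *
    generalize eval (2 * lam) (ascPochhammer ℝ n) = P at *
    have hf : (n.factorial:ℝ) ≠ 0 := by positivity
    rw [div_mul_eq_mul_div, div_eq_iff (mul_ne_zero hlam0 h4)]
    rw [div_mul_eq_mul_div, div_eq_iff (mul_ne_zero hlam0 h3)] at ih
    linear_combination (n.factorial:ℝ) * hr + (2 * lam + n) * ih

noncomputable def ggH (lam : ℝ) (n : ℕ) : ℝ[X] := C (gamG lam n) * ggC lam n

lemma ggH_eval (lam : ℝ) (n : ℕ) (x : ℝ) : (ggH lam n).eval x = GegHat lam n x := by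
  simp [ggH, GegHat, ggC_eval]

lemma gg_gam_sq (lam : ℝ) (hlam : -(1 / 2) < lam) (hlam0 : lam ≠ 0) (n : ℕ) :
    gamG lam n * gamG lam n * ggJ lam hlam (ggC lam n * ggC lam n) = 1 := by
  have h := ggC_norm lam hlam hlam0 n
  have hp : 0 ≤ ggJ lam hlam (ggC lam n * ggC lam n) := by
    apply ggJ_nonneg; intro x _; rw [eval_mul]; exact mul_self_nonneg _
  rw [gamG, Real.mul_self_sqrt, h]
  by_contra hc
  push Not at hc
  nlinarith

noncomputable def ggD (lam : ℝ) (hlam : -(1 / 2) < lam) (hlam0 : lam ≠ 0) : GGData lam where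
  J := ggJ lam hlam
  H := ggH lam
  hlam := hlam
  hlam0 := hlam0
  one := ggJ_one lam hlam
  nonneg := ggJ_nonneg lam hlam
  ibp p := by
    have := ggJ_ibp lam hlam p
    simpa [C_ofNat] using this
  ode n := by
    simp only [ggH, derivative_C_mul]
    linear_combination C (gamG lam n) * ggC_ode lam n
  orth i j := by
    have : ggH lam i * ggH lam j = (gamG lam i * gamG lam j) • (ggC lam i * ggC lam j) := by
      simp only [ggH, smul_eq_C_mul, C_mul]; ring
    rw [this, map_smul, smul_eq_mul]
    split_ifs with h
    · subst h; exact gg_gam_sq lam hlam hlam0 i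
    · rw [ggC_orth lam hlam i j h, mul_zero]
  degree n := by
    have := gg_gam_sq lam hlam hlam0 n
    have h0 : gamG lam n ≠ 0 := by
      intro h; rw [h] at this; simp at this
    rw [ggH, degree_C_mul h0, ggC_degree lam hlam hlam0]

end gegpoly2

section ggcheb
open Polynomial

/-- Chebyshev polynomial with natural index -/
noncomputable def ggT (k : ℕ) : ℝ[X] := Chebyshev.T ℝ (k:ℤ)

lemma ggT_ode (k : ℕ) : (1 - X ^ 2) * derivative (derivative (ggT k)) =
    X * derivative (ggT k) - (k:ℝ[X]) ^ 2 * ggT k := by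
  have := Chebyshev.one_sub_X_sq_mul_derivative_derivative_T_eq_poly_in_T (R := ℝ) (k:ℤ)
  simpa [ggT] using this

lemma ggT_ode' (k : ℕ) : (1 - X ^ 2) * derivative (derivative (derivative (ggT k))) =
    3 * X * derivative (derivative (ggT k)) + (1 - (k:ℝ[X]) ^ 2) * derivative (ggT k) := by
  have h := congrArg derivative (ggT_ode k)
  simp [derivative_pow, C_ofNat] at h
  linear_combination h

lemma ggT_abs (k : ℕ) {x : ℝ} (hx : x ∈ Set.Icc (-1:ℝ) 1) : |(ggT k).eval x| ≤ 1 :=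
  Chebyshev.abs_eval_T_real_le_one _ (abs_le.2 hx)

lemma ggT_one (k : ℕ) : (ggT k).eval 1 = 1 := by simp [ggT]

lemma ggT_d1_one (k : ℕ) : (derivative (ggT k)).eval 1 = (k:ℝ)^2 := by
  have := congrArg (eval 1) (ggT_ode k)
  simp [ggT_one] at this
  linarith

lemma ggT_d2_one (k : ℕ) : (derivative (derivative (ggT k))).eval 1 = ((k:ℝ)^2 - 1) * k^2 / 3 := by
  have := congrArg (eval 1) (ggT_ode' k)
  simp [ggT_d1_one] at this
  linarith

lemma ggT_d1_abs (k : ℕ) {x : ℝ} (hx : x ∈ Set.Icc (-1:ℝ) 1) :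
    |(derivative (ggT k)).eval x| ≤ (k:ℝ)^2 := by
  have := Chebyshev.abs_iterate_derivative_T_real_le (k:ℤ) 1 (abs_le.2 hx)
  rw [← ggT_d1_one k]; exact this

lemma ggT_d2_abs (k : ℕ) {x : ℝ} (hx : x ∈ Set.Icc (-1:ℝ) 1) :
    |(derivative (derivative (ggT k))).eval x| ≤ (k:ℝ)^4 := by
  have := Chebyshev.abs_iterate_derivative_T_real_le (k:ℤ) 2 (abs_le.2 hx)
  refine (show _ ≤ (derivative (derivative (ggT k))).eval 1 from this).trans ?_
  rw [ggT_d2_one]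
  have : (0:ℝ) ≤ (k:ℝ)^2 := by positivity
  nlinarith

lemma ggT_d2_sig (k : ℕ) {x : ℝ} (hx : x ∈ Set.Icc (-1:ℝ) 1) :
    (1 - x^2) * |(derivative (derivative (ggT k))).eval x| ≤ 2 * (k:ℝ)^2 := by
  have h := congrArg (eval x) (ggT_ode k)
  simp only [eval_mul, eval_sub, eval_one, eval_pow, eval_X, eval_natCast] at h
  have hs : 0 ≤ 1 - x^2 := by nlinarith [hx.1, hx.2]
  rw [← abs_of_nonneg hs, ← abs_mul, h]
  have h1 := ggT_d1_abs k hx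
  have h2 := ggT_abs k hx
  have hxx : |x| ≤ 1 := abs_le.2 hx
  calc _ ≤ |x * (derivative (ggT k)).eval x| + |(k:ℝ)^2 * (ggT k).eval x| := abs_sub _ _
    _ ≤ 1 * (k:ℝ)^2 + (k:ℝ)^2 * 1 := by
      rw [abs_mul, abs_mul, abs_of_nonneg (by positivity : (0:ℝ) ≤ (k:ℝ)^2)]
      gcongr
    _ = _ := by ring

lemma ggT_pell (k : ℕ) : (1 - X ^ 2) * derivative (ggT k) ^ 2 = (k:ℝ[X]) ^ 2 * (1 - ggT k ^ 2) := by
  have h := ggT_ode k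
  have hd : derivative ((1 - X ^ 2) * derivative (ggT k) ^ 2 + (k:ℝ[X]) ^ 2 * ggT k ^ 2) = 0 := by
    simp [C_ofNat, derivative_pow]
    linear_combination 2 * derivative (ggT k) * h
  have h0 := derivative_eq_zero.1 hd
  obtain ⟨c, hc⟩ := natDegree_eq_zero.1 h0
  have h1 := congrArg (eval 1) hc
  simp [ggT_one] at h1
  rw [h1] at hc
  simp at hc
  linear_combination -hc

lemma ggT_sq (k : ℕ) : 2 * ggT k ^ 2 = 1 + ggT (2 * k) := by
  have := Chebyshev.T_mul_T ℝ (k:ℤ) (k:ℤ)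
  simp only [sub_self, Chebyshev.T_zero] at this
  rw [← two_mul] at this
  unfold ggT; push_cast
  linear_combination this

lemma ggT_X_mul (k : ℕ) : 2 * (X * ggT (k + 1)) = ggT (k + 2) + ggT k := by
  have := Chebyshev.T_add_two ℝ (k:ℤ)
  unfold ggT; push_cast
  linear_combination -this

lemma ggT_zero : ggT 0 = 1 := by simp [ggT]
lemma ggT_oneX : ggT 1 = X := by simp [ggT]

lemma ggT_degree (k : ℕ) : (ggT k).degree ≤ k := by
  rw [← natDegree_le_iff_degree_le]
  have := Chebyshev.natDegree_T ℝ (k:ℤ)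
  unfold ggT; rw [this]; simp

end ggcheb

namespace GGData
open Polynomial
variable {lam : ℝ} (D : GGData lam)

lemma mono {p q : ℝ[X]} (h : ∀ x ∈ Set.Icc (-1:ℝ) 1, p.eval x ≤ q.eval x) : D.J p ≤ D.J q := by
  have := D.nonneg (q - p) (fun x hx => by rw [eval_sub]; linarith [h x hx])
  rw [map_sub] at this; linarith

lemma abs_le' {p q : ℝ[X]} (h : ∀ x ∈ Set.Icc (-1:ℝ) 1, |p.eval x| ≤ q.eval x) : |D.J p| ≤ D.J q := by
  rw [abs_le]
  constructor
  · rw [← map_neg]; apply D.mono; intro x hx; rw [eval_neg]; linarith [neg_abs_le (p.eval x), h x hx]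
  · apply D.mono; intro x hx; linarith [le_abs_self (p.eval x), h x hx]

lemma J_C_mul (c : ℝ) (p : ℝ[X]) : D.J (C c * p) = c * D.J p := by
  rw [← smul_eq_C_mul, map_smul, smul_eq_mul]

lemma expand (R : ℕ) : ∀ p : ℝ[X], p.degree < R → p = ∑ j ∈ range R, C (D.J (p * D.H j)) * D.H j := by
  have key : ∀ p : ℝ[X], p.degree < R → ∃ a : ℕ → ℝ, p = ∑ j ∈ range R, C (a j) * D.H j := by
    induction R with
    | zero =>
      intro p hp
      refine ⟨0, ?_⟩
      simpa using hp
    | succ R ih =>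
      intro p hp
      have hl : (D.H R).coeff R ≠ 0 := by
        have : (D.H R).natDegree = R := natDegree_eq_of_degree_eq_some (D.degree R)
        have h2 : (D.H R).leadingCoeff ≠ 0 := by
          rw [Ne, leadingCoeff_eq_zero]; intro h; have := D.degree R; rw [h] at this; simp at this
        rwa [leadingCoeff, this] at h2
      set q := p - C (p.coeff R / (D.H R).coeff R) * D.H R with hq
      have hqd : q.degree < R := by
        rw [degree_lt_iff_coeff_zero] at hp ⊢
        intro m hm
        rcases hm.eq_or_lt with h | h
        · subst h; rw [hq, coeff_sub, coeff_C_mul]; field_simp; ring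
        · rw [hq, coeff_sub, coeff_C_mul, hp m (by omega), coeff_eq_zero_of_degree_lt (p := D.H R) (n := m) (by rw [D.degree]; exact_mod_cast h), mul_zero, sub_zero]
      obtain ⟨a, ha⟩ := ih q hqd
      refine ⟨fun j => if j = R then p.coeff R / (D.H R).coeff R else a j, ?_⟩
      simp only [sum_range_succ, if_true]
      have : ∑ x ∈ range R, C (if x = R then p.coeff R / (D.H R).coeff R else a x) * D.H x = q := by
        rw [ha]; apply sum_congr rfl; intro x hx; rw [if_neg (by simp at hx; omega)]
      rw [this, hq]; ring
  intro p hp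
  obtain ⟨a, ha⟩ := key p hp
  have : ∀ j ∈ range R, D.J (p * D.H j) = a j := by
    intro j hj
    rw [ha, sum_mul, map_sum]
    simp only [mul_assoc, J_C_mul, D.orth]
    simp [mem_range.1 hj]
  conv_lhs => rw [ha]
  apply sum_congr rfl
  intro j hj
  rw [this j hj]

lemma parseval {R : ℕ} {p : ℝ[X]} (hp : p.degree < R) (q : ℝ[X]) :
    D.J (p * q) = ∑ j ∈ range R, D.J (p * D.H j) * D.J (q * D.H j) := by
  conv_lhs => rw [D.expand R p hp]
  rw [sum_mul, map_sum]
  apply sum_congr rfl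
  intro j _
  rw [mul_assoc, J_C_mul, mul_comm (D.H j)]

lemma bessel (n : ℕ) (p : ℝ[X]) : ∑ j ∈ range n, D.J (p * D.H j) ^ 2 ≤ D.J (p ^ 2) := by
  set R := max n (p.natDegree + 1)
  have hp : p.degree < R := by
    refine degree_le_natDegree.trans_lt ?_
    exact_mod_cast (Nat.lt_of_succ_le (le_max_right n (p.natDegree + 1)))
  rw [pow_two, D.parseval hp p]
  simp only [← pow_two]
  exact sum_le_sum_of_subset_of_nonneg (range_mono (le_max_left _ _)) (fun _ _ _ => sq_nonneg _)

/-- the matrix elements -/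
noncomputable def t (k i j : ℕ) : ℝ := D.J (ggT k * D.H i * D.H j)

noncomputable def om (_ : GGData lam) (j : ℕ) : ℝ := j + lam

/-- matrix elements of the second derivative -/
noncomputable def t2 (k i j : ℕ) : ℝ := D.J (derivative (derivative (ggT k)) * D.H i * D.H j)

lemma identI (k i j : ℕ) :
    ((k:ℝ)^4 - 2 * k^2 * (D.om i ^ 2 + D.om j ^ 2) + (D.om i ^ 2 - D.om j ^ 2) ^ 2) * D.t k i j
      = -(4 * (lam * (1 - lam))) * D.t2 k i j := by
  have hu := D.ode i
  have hv := D.ode j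
  have hf := ggT_ode k
  have hf' := ggT_ode' k
  simp only [t, t2, om]
  set u := D.H i
  set v := D.H j
  set f := ggT k
  set l := C lam with hl
  set a : ℝ[X] := (i:ℝ[X]) * (i + 2 * l) with ha
  set b : ℝ[X] := (j:ℝ[X]) * (j + 2 * l) with hb
  set g := (k:ℝ[X])^2 * f - 2 * l * X * derivative f with hg
  have h := D.ibp (-(a - b) * f * (derivative u * v - u * derivative v)
    + 2 * derivative f * (1 - X^2) * derivative u * derivative v + (a + b) * derivative f * u * v
    + g * derivative (u * v) - derivative g * (u * v))
  have hda : derivative a = 0 := by simp [ha, hl]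
  have hdb : derivative b = 0 := by simp [hb, hl]
  have hdl : derivative l = 0 := by simp [hl]
  rw [← sub_eq_zero, neg_mul, sub_neg_eq_add, ← J_C_mul, ← J_C_mul, ← map_add, ← h]
  congr 1
  simp only [hg, derivative_add, derivative_sub, derivative_mul, derivative_neg, hda, hdb, hdl, derivative_natCast,
    derivative_ofNat, derivative_one, derivative_X, derivative_pow, derivative_zero, C_add, C_sub, C_mul, C_pow, C_ofNat,
    map_natCast, C_1, ← hl]
  push_cast
  linear_combination (exp := 1) -hu * (-(a - b) * f * v + 2 * derivative f * (1-X^2) * derivative v + ((k:ℝ[X])^2 * f - 2 * l * X * derivative f) * v)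
    - hv * ((a - b) * f * u + 2 * derivative f * (1-X^2) * derivative u + ((k:ℝ[X])^2 * f - 2 * l * X * derivative f) * u)
    - hf' * (2 * l * X * u * v)
    - hf * ((a + b - (k:ℝ[X])^2 + 4 * l - 4 * l * (1 - l)) * u * v + 2 * (1-X^2) * derivative u * derivative v)

end GGData

/-- arcsine averages of `x^m T_l` -/
noncomputable def ggE : ℕ → ℕ → ℝ
  | 0, 0 => 1
  | 0, _ + 1 => 0
  | m + 1, 0 => ggE m 1
  | m + 1, l + 1 => (ggE m (l + 2) + ggE m l) / 2

lemma ggE_zero : ∀ m l, m < l → ggE m l = 0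
  | 0, 0, h => by omega
  | 0, l + 1, _ => by rw [ggE]
  | m + 1, 0, h => by omega
  | m + 1, l + 1, h => by rw [ggE, ggE_zero m _ (by omega), ggE_zero m _ (by omega)]; simp

lemma ggE_eq : ∀ m l r, m = l + 2 * r → ggE m l = (m.choose r : ℝ) / 2 ^ m
  | 0, l, r, h => by
    obtain rfl : l = 0 := by omega
    obtain rfl : r = 0 := by omega
    simp [ggE]
  | m + 1, 0, r, h => by
    obtain ⟨s, rfl⟩ : ∃ s, r = s + 1 := ⟨r - 1, by omega⟩
    rw [ggE, ggE_eq m 1 s (by omega), Nat.choose_succ_succ]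
    have : m.choose (s + 1) = m.choose s := by
      rw [← Nat.choose_symm (by omega)]; congr 1; omega
    rw [this]; push_cast; rw [pow_succ]; field_simp; ring
  | m + 1, l + 1, r, h => by
    rw [ggE, ggE_eq m l r (by omega)]
    rcases r with _ | s
    · rw [ggE_zero m _ (by omega)]; simp; rw [pow_succ]; field_simp
    · rw [ggE_eq m (l + 2) s (by omega), Nat.choose_succ_succ]; push_cast; rw [pow_succ]; field_simp

lemma gg_cb (m : ℕ) : (2 * (m:ℝ) + 1) * (m.centralBinom : ℝ) ^ 2 ≤ 16 ^ m := by
  induction m with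
  | zero => simp
  | succ m ih =>
    have h : ((m:ℝ) + 1) * ((m+1).centralBinom : ℝ) = 2 * (2 * m + 1) * m.centralBinom := by
      exact_mod_cast Nat.succ_mul_centralBinom_succ m
    have h2 : ((m+1).centralBinom : ℝ) = 2 * (2 * m + 1) * m.centralBinom / (m + 1) := by
      field_simp; linarith
    rw [h2]; push_cast
    set c := (m.centralBinom : ℝ)
    have e : (2 * ((m:ℝ) + 1) + 1) * (2 * (2 * m + 1) * c / (m + 1)) ^ 2
       = (4 * (2 * m + 3) * (2 * m + 1) / (m+1)^2) * ((2 * m + 1) * c ^ 2) := by field_simp; ring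
    rw [e, pow_succ (16:ℝ) m, mul_comm ((16:ℝ)^m)]
    gcongr
    rw [div_le_iff₀ (by positivity)]; nlinarith

lemma ggE_le (m : ℕ) (hm : 1 ≤ m) : ggE (2 * m) 0 ≤ (m:ℝ) ^ (-(1/2) : ℝ) := by
  rw [ggE_eq (2 * m) 0 m (by omega)]
  have h := gg_cb m
  have hm' : (0:ℝ) < m := by exact_mod_cast hm
  have hc : (((2 * m).choose m : ℕ) : ℝ) = m.centralBinom := rfl
  rw [hc]
  have h1 : (m:ℝ) ^ (-(1/2) : ℝ) = 1 / Real.sqrt m := by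
    rw [Real.rpow_neg hm'.le, ← Real.sqrt_eq_rpow, one_div]
  rw [h1, div_le_div_iff₀ (by positivity) (by positivity), one_mul]
  apply le_of_sq_le_sq _ (by positivity)
  rw [mul_pow, Real.sq_sqrt hm'.le, ← pow_mul, show 2 * m * 2 = 4 * m by ring, pow_mul]
  norm_num
  nlinarith [sq_nonneg (m.centralBinom : ℝ)]

namespace GGData
open Polynomial
variable {lam : ℝ} (D : GGData lam)

lemma norm_one (j : ℕ) : D.J (D.H j * D.H j) = 1 := by rw [D.orth, if_pos rfl]

lemma t_abs (k i j : ℕ) : |D.t k i j| ≤ 1 := by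
  have h : |D.t k i j| ≤ D.J (C (1/2) * (D.H i * D.H i) + C (1/2) * (D.H j * D.H j)) := by
    apply D.abs_le'
    intro x hx
    have := ggT_abs k hx
    simp only [eval_mul, eval_add, eval_C, abs_mul]
    set a := eval x (D.H i); set b := eval x (D.H j)
    have h1 : |eval x (ggT k)| * |a| * |b| ≤ 1 * |a| * |b| := by gcongr
    nlinarith [sq_nonneg (|a| - |b|), abs_mul_abs_self a, abs_mul_abs_self b]
  rw [map_add, J_C_mul, J_C_mul, norm_one, norm_one] at h
  linarith

lemma sq_bound {p : ℝ[X]} {B : ℝ[X]} (j : ℕ) (h : ∀ x ∈ Set.Icc (-1:ℝ) 1, |p.eval x| ≤ B.eval x) :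
    |D.J (p * D.H j * D.H j)| ≤ D.J (B * (D.H j * D.H j)) := by
  apply D.abs_le'
  intro x hx
  simp only [eval_mul, abs_mul]
  rw [mul_assoc, abs_mul_abs_self]
  exact mul_le_mul_of_nonneg_right (h x hx) (mul_self_nonneg _)

lemma t2_diag_abs (k j : ℕ) : |D.t2 k j j| ≤ (k:ℝ)^4 := by
  have := D.sq_bound (p := derivative (derivative (ggT k))) (B := C ((k:ℝ)^4)) j
    (fun x hx => by rw [eval_C]; exact ggT_d2_abs k hx)
  rwa [J_C_mul, norm_one, mul_one] at this

lemma identDiag (k j : ℕ) : ((k:ℝ)^2 - 4 * D.om j ^ 2) * k ^ 2 * D.t k j j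
      = -(4 * (lam * (1 - lam))) * D.t2 k j j := by
  rw [← identI]; ring

noncomputable def K0 (_ : GGData lam) : ℝ := 4 * |lam * (1 - lam)| + 1
lemma K0_pos : 1 ≤ D.K0 := by unfold K0; have := abs_nonneg (lam * (1 - lam)); linarith

end GGData
namespace GGData
open Polynomial
variable {lam : ℝ} (D : GGData lam)

lemma edge0 (l j : ℕ) (hl : 1 ≤ l) : |D.t l j j| * D.om j ^ 2 ≤ D.K0 * l ^ 2 := by
  have h := congrArg abs (D.identDiag l j)
  have h2 := D.t2_diag_abs l j
  have h3 := D.t_abs l j j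
  have hk := D.K0_pos
  rw [abs_mul, abs_mul, abs_mul, abs_neg, abs_mul, abs_of_pos (by norm_num : (0:ℝ) < 4)] at h
  have hl' : (1:ℝ) ≤ l := by exact_mod_cast hl
  rw [abs_of_pos (by positivity : (0:ℝ) < (l:ℝ)^2)] at h
  by_cases hc : (l:ℝ)^2 ≤ D.om j ^ 2
  · rw [abs_of_nonpos (by nlinarith)] at h
    have h4 : (4 * D.om j ^ 2 - (l:ℝ)^2) * |D.t l j j| * l ^ 2 ≤ (4 * |lam * (1 - lam)| * l ^ 2) * l ^ 2 := by
      calc _ = 4 * |lam * (1 - lam)| * |D.t2 l j j| := by rw [← h]; ring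
        _ ≤ 4 * |lam * (1 - lam)| * (l:ℝ)^4 := by gcongr
        _ = _ := by ring
    have h5 := le_of_mul_le_mul_right h4 (by positivity)
    unfold K0
    have h6 : D.om j ^ 2 * |D.t l j j| ≤ (4 * D.om j ^ 2 - (l:ℝ)^2) * |D.t l j j| :=
      mul_le_mul_of_nonneg_right (by nlinarith [sq_nonneg (D.om j)]) (abs_nonneg _)
    nlinarith [abs_nonneg (lam * (1 - lam))]
  · push Not at hc
    calc |D.t l j j| * D.om j ^ 2 ≤ 1 * (l:ℝ)^2 := by gcongr
      _ ≤ _ := by gcongr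

lemma edge1 (j : ℕ) : ∀ m l : ℕ, |D.J (X ^ m * ggT l * D.H j * D.H j) - ggE m l| * D.om j ^ 2 ≤ D.K0 * (l ^ 2 + m)
  | 0, 0 => by
    have : (X:ℝ[X]) ^ 0 * ggT 0 * D.H j * D.H j = D.H j * D.H j := by rw [ggT_zero]; ring
    rw [this, norm_one]; simp [ggE]
  | 0, l + 1 => by
    have : (X:ℝ[X]) ^ 0 * ggT (l+1) * D.H j * D.H j = ggT (l+1) * D.H j * D.H j := by ring
    rw [this]
    have := D.edge0 (l+1) j (by omega)
    simpa [ggE, t] using this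
  | m + 1, 0 => by
    have : (X:ℝ[X]) ^ (m+1) * ggT 0 * D.H j * D.H j = X ^ m * ggT 1 * D.H j * D.H j := by
      rw [ggT_zero, ggT_oneX]; ring
    rw [this, ggE]
    refine (edge1 j m 1).trans (le_of_eq ?_)
    push_cast; ring
  | m + 1, l + 1 => by
    have : (X:ℝ[X]) ^ (m+1) * ggT (l+1) * D.H j * D.H j = C (1/2) * (X ^ m * ggT (l+2) * D.H j * D.H j
        + X ^ m * ggT l * D.H j * D.H j) := by
      have h := ggT_X_mul l
      have h2 : C (1/2:ℝ) * 2 = 1 := by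
        rw [show (2:ℝ[X]) = C 2 from rfl, ← C_mul]; norm_num
      linear_combination (C (1/2)) * X^m * D.H j * D.H j * h - X^(m+1) * ggT (l+1) * D.H j * D.H j * h2
    rw [this, ggE, J_C_mul, map_add]
    have h1 := edge1 j m (l+2)
    have h2 := edge1 j m l
    set a := D.J (X ^ m * ggT (l+2) * D.H j * D.H j)
    set b := D.J (X ^ m * ggT l * D.H j * D.H j)
    have h3 : |1/2 * (a + b) - (ggE m (l+2) + ggE m l) / 2| ≤ 1/2 * |a - ggE m (l+2)| + 1/2 * |b - ggE m l| := by
      calc _ = |1/2 * (a - ggE m (l+2)) + 1/2 * (b - ggE m l)| := by congr 1; ring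
        _ ≤ _ := by
          refine (abs_add_le _ _).trans ?_
          rw [abs_mul, abs_mul]; norm_num
    calc _ ≤ (1/2 * |a - ggE m (l+2)| + 1/2 * |b - ggE m l|) * D.om j ^ 2 := by gcongr
      _ ≤ 1/2 * (D.K0 * (((l+2:ℕ):ℝ)^2 + m)) + 1/2 * (D.K0 * ((l:ℝ)^2 + m)) := by nlinarith
      _ = _ := by push_cast; ring

lemma edge2 (j m : ℕ) (hm : 1 ≤ m) : D.J (X ^ (2 * m) * (D.H j * D.H j)) * D.om j ^ 2 ≤
    (m:ℝ) ^ (-(1/2):ℝ) * D.om j ^ 2 + 2 * m * D.K0 := by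
  have h := D.edge1 j (2 * m) 0
  rw [ggT_zero, mul_one, mul_assoc] at h
  have h1 := ggE_le m hm
  push_cast at h
  nlinarith [le_abs_self (D.J (X ^ (2 * m) * (D.H j * D.H j)) - ggE (2 * m) 0), sq_nonneg (D.om j)]

/-- majorant of the second derivative of T_k -/
noncomputable def maj (k m : ℕ) : ℝ[X] := C (2 * (k:ℝ)^4) * X ^ (2 * m) + C (4 * m * (k:ℝ)^2)

lemma maj_bound (k m : ℕ) {x : ℝ} (hx : x ∈ Set.Icc (-1:ℝ) 1) :
    |(derivative (derivative (ggT k))).eval x| ≤ (maj k m).eval x := by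
  simp only [maj, eval_add, eval_mul, eval_C, eval_pow, eval_X]
  have h1 := ggT_d2_abs k hx
  have h2 := ggT_d2_sig k hx
  set A := |(derivative (derivative (ggT k))).eval x|
  have hx2 : 0 ≤ x ^ 2 := sq_nonneg x
  have hs : x ^ 2 ≤ 1 := by nlinarith [hx.1, hx.2]
  have hp : (0:ℝ) ≤ x ^ (2 * m) := by rw [pow_mul]; positivity
  by_cases hc : 1 / 2 ≤ x ^ (2 * m)
  · have : 0 ≤ 4 * (m:ℝ) * (k:ℝ)^2 := by positivity
    have : (k:ℝ)^4 * (1/2) ≤ (k:ℝ)^4 * x ^ (2 * m) := by gcongr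
    linarith
  · push Not at hc
    have hb := one_add_mul_le_pow (a := x^2 - 1) (by linarith) m
    rw [show 1 + (x^2 - 1) = x^2 by ring, ← pow_mul] at hb
    have hm : 1/2 ≤ m * (1 - x^2) := by linarith
    have : 0 ≤ 2 * (k:ℝ)^4 * x ^ (2*m) := by positivity
    have hA : 0 ≤ A := abs_nonneg _
    have h3 : m * ((1 - x^2) * A) ≤ m * (2 * (k:ℝ)^2) := by gcongr
    have h4 : 1/2 * A ≤ m * (1 - x^2) * A := by gcongr
    linarith

lemma om_ge (j : ℕ) (hj : 1 ≤ j) : ((j:ℝ) + 1) / 4 ≤ D.om j := by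
  have := D.hlam
  have : (1:ℝ) ≤ j := by exact_mod_cast hj
  unfold om; linarith

noncomputable def K1 (D : GGData lam) : ℝ := 130 * D.K0 + 10

/-- edge lemma: there is a nonneg majorant with small integral -/
lemma edge (j k : ℕ) (hk : 1 ≤ k) : ∃ B : ℝ[X],
    (∀ x ∈ Set.Icc (-1:ℝ) 1, |(derivative (derivative (ggT k))).eval x| ≤ B.eval x) ∧
    D.J (B * (D.H j * D.H j)) ≤ D.K1 * (k:ℝ)^4 * ((min (j+1) k : ℕ) : ℝ) ^ (-(2/3):ℝ) := by
  have hK := D.K0_pos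
  rcases Nat.eq_zero_or_pos j with rfl | hj
  · refine ⟨C ((k:ℝ)^4), fun x hx => by rw [eval_C]; exact ggT_d2_abs k hx, ?_⟩
    rw [J_C_mul, norm_one]
    have : min (0+1) k = 1 := by omega
    rw [this]; simp
    have : 0 ≤ (k:ℝ)^4 := by positivity
    have : 1 ≤ D.K1 := by unfold K1; linarith
    nlinarith
  · set q := min (j+1) k with hq
    have hq1 : 1 ≤ q := by omega
    have hq1' : (1:ℝ) ≤ q := by exact_mod_cast hq1
    have hqj : (q:ℝ) ≤ j + 1 := by exact_mod_cast (min_le_left (j+1) k)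
    have hqk : (q:ℝ) ≤ k := by exact_mod_cast (min_le_right (j+1) k)
    set m := ⌈(q:ℝ) ^ (4/3:ℝ)⌉₊ with hm
    have hp1 : (1:ℝ) ≤ (q:ℝ) ^ (4/3:ℝ) := Real.one_le_rpow hq1' (by norm_num)
    have hm1 : (q:ℝ) ^ (4/3:ℝ) ≤ m := Nat.le_ceil _
    have hm2 : (m:ℝ) ≤ 2 * (q:ℝ) ^ (4/3:ℝ) := by
      have := Nat.ceil_lt_add_one (a := (q:ℝ) ^ (4/3:ℝ)) (by linarith)
      linarith
    have hm0 : 1 ≤ m := by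
      have : (1:ℝ) ≤ m := hp1.trans hm1
      exact_mod_cast this
    refine ⟨maj k m, fun x hx => maj_bound k m hx, ?_⟩
    have e1 : D.J (maj k m * (D.H j * D.H j)) = 2 * (k:ℝ)^4 * D.J (X ^ (2*m) * (D.H j * D.H j)) + 4 * m * (k:ℝ)^2 := by
      rw [maj, add_mul, map_add, mul_assoc, J_C_mul, J_C_mul, norm_one, mul_one]
    rw [e1]
    have h2 := D.edge2 j m hm0
    have hom := D.om_ge j hj
    set I := D.J (X ^ (2*m) * (D.H j * D.H j))
    set z := (q:ℝ) ^ (-(2/3):ℝ) with hz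
    have hq0 : (0:ℝ) < q := by linarith
    have hz0 : 0 < z := Real.rpow_pos_of_pos hq0 _
    have hz2 : (q:ℝ) ^ (4/3:ℝ) = z * q ^ 2 := by
      rw [hz, ← Real.rpow_natCast, ← Real.rpow_add hq0]; norm_num
    have h3 : (m:ℝ) ^ (-(1/2):ℝ) ≤ z := by
      calc (m:ℝ) ^ (-(1/2):ℝ) ≤ ((q:ℝ) ^ (4/3:ℝ)) ^ (-(1/2):ℝ) :=
            Real.rpow_le_rpow_of_nonpos (by linarith) hm1 (by norm_num)
        _ = z := by rw [← Real.rpow_mul hq0.le]; norm_num; rw [hz]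
    have hom2 : ((q:ℝ))^2 / 16 ≤ D.om j ^ 2 := by
      have : (q:ℝ) / 4 ≤ D.om j := by linarith
      nlinarith
    have hm3 : (m:ℝ) ≤ 2 * z * q^2 := by rw [hz2] at hm2; linarith
    have ho : 0 < D.om j ^ 2 := by nlinarith
    have h4 : I ≤ (1 + 64 * D.K0) * z := by
      apply le_of_mul_le_mul_right _ ho
      calc I * D.om j ^ 2 ≤ (m:ℝ) ^ (-(1/2):ℝ) * D.om j ^ 2 + 2 * m * D.K0 := h2
        _ ≤ z * D.om j ^ 2 + 2 * (2 * z * (16 * D.om j ^ 2)) * D.K0 := by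
            gcongr
            refine hm3.trans ?_
            gcongr; linarith
        _ = _ := by ring
    have h5 : (m:ℝ) * (k:ℝ)^2 ≤ 2 * z * k^4 := by
      calc (m:ℝ) * (k:ℝ)^2 ≤ 2 * z * (k:ℝ)^2 * (k:ℝ)^2 := by
            gcongr
            refine hm3.trans ?_
            gcongr
        _ = _ := by ring
    have hk4 : 0 ≤ (k:ℝ)^4 := by positivity
    have h6 := mul_le_mul_of_nonneg_left h4 hk4
    unfold K1
    have : 0 ≤ (k:ℝ)^4 * z := by positivity
    nlinarith

lemma t2_diag (j k : ℕ) (hk : 1 ≤ k) :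
    |D.t2 k j j| ≤ D.K1 * (k:ℝ)^4 * ((min (j+1) k : ℕ) : ℝ) ^ (-(2/3):ℝ) := by
  obtain ⟨B, hB, hJ⟩ := D.edge j k hk
  exact (D.sq_bound j hB).trans hJ

lemma t2_row (i k : ℕ) (hk : 1 ≤ k) (R : ℕ) :
    ∑ j ∈ range R, D.t2 k i j ^ 2 ≤ D.K1 * (k:ℝ)^8 * ((min (i+1) k : ℕ) : ℝ) ^ (-(2/3):ℝ) := by
  obtain ⟨B, hB, hJ⟩ := D.edge i k hk
  have h := D.bessel R (derivative (derivative (ggT k)) * D.H i)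
  refine (show _ ≤ _ from h).trans ?_
  have h2 : D.J ((derivative (derivative (ggT k)) * D.H i) ^ 2) ≤ D.J (C ((k:ℝ)^4) * (B * (D.H i * D.H i))) := by
    apply D.mono
    intro x hx
    simp only [eval_pow, eval_mul, eval_C]
    rw [← mul_assoc, mul_pow, ← pow_two (eval x (D.H i))]
    gcongr
    rw [← sq_abs, pow_two]
    have := hB x hx
    have h3 := ggT_d2_abs k hx
    gcongr
  rw [J_C_mul] at h2
  refine h2.trans ?_
  have : (k:ℝ)^4 * D.J (B * (D.H i * D.H i)) ≤ (k:ℝ)^4 * (D.K1 * (k:ℝ)^4 * ((min (i+1) k : ℕ) : ℝ) ^ (-(2/3):ℝ)) := by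
    gcongr
  refine this.trans (le_of_eq (by ring))

end GGData

lemma gg_dist_sum (N : ℕ) : ∀ a : ℕ, ∑ j ∈ range N, 1 / (1 + |(a:ℝ) - j|) ≤ 2 * (harmonic N : ℝ) := by
  induction N with
  | zero => intro a; simp
  | succ N ih =>
    intro a
    rw [harmonic_succ]
    push_cast
    by_cases h : N ≤ 2 * a
    · rw [sum_range_succ']
      have e : (1:ℝ) / (1 + |(a:ℝ) - ((0:ℕ):ℝ)|) ≤ 2 * ((N:ℝ) + 1)⁻¹ := by
        rw [Nat.cast_zero, sub_zero, abs_of_nonneg (Nat.cast_nonneg a), ← one_div, mul_one_div,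
          div_le_div_iff₀ (by positivity) (by positivity)]
        have : (N:ℝ) ≤ 2 * a := by exact_mod_cast h
        linarith
      rcases a with _ | a
      · obtain rfl : N = 0 := by omega
        simp
      · have := ih a
        have e2 : ∑ k ∈ range N, 1 / (1 + |((a + 1 : ℕ):ℝ) - ((k + 1 : ℕ):ℝ)|) = ∑ j ∈ range N, 1 / (1 + |(a:ℝ) - j|) := by
          apply sum_congr rfl; intro j _; congr 3; push_cast; ring
        rw [e2]; linarith
    · push Not at h
      rw [sum_range_succ]
      have h' : 2 * (a:ℝ) + 1 ≤ N := by exact_mod_cast h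
      have e : (1:ℝ) / (1 + |(a:ℝ) - N|) ≤ 2 * ((N:ℝ) + 1)⁻¹ := by
        have ha : (0:ℝ) ≤ a := Nat.cast_nonneg a
        rw [abs_of_nonpos (by linarith), ← one_div, mul_one_div,
          div_le_div_iff₀ (by linarith) (by positivity)]
        linarith
      linarith [ih a]

lemma gg_harm_le (N : ℕ) (hN : 1 ≤ N) (e : ℝ) (he : 0 < e) : (harmonic N : ℝ) ≤ (1 + 1 / e) * (N:ℝ) ^ e := by
  have h := harmonic_le_one_add_log N
  have hN' : (1:ℝ) ≤ N := by exact_mod_cast hN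
  have h1 := Real.log_le_rpow_div (by linarith : (0:ℝ) ≤ N) he
  have h2 : 1 ≤ (N:ℝ) ^ e := Real.one_le_rpow hN' he.le
  calc _ ≤ _ := h
    _ ≤ (N:ℝ)^e + (N:ℝ)^e / e := by linarith
    _ = _ := by ring

lemma gg_sum_23 (N : ℕ) : ∑ j ∈ range N, ((j:ℝ) + 1) ^ (-(2/3):ℝ) ≤ 3 * (N:ℝ) ^ (1/3:ℝ) := by
  induction N with
  | zero => simp
  | succ N ih =>
    rw [sum_range_succ]
    push_cast
    set y := ((N:ℝ) + 1) ^ (1/3:ℝ) with hy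
    set x := (N:ℝ) ^ (1/3:ℝ) with hx
    have hN : (0:ℝ) ≤ N := Nat.cast_nonneg N
    have hy0 : 0 < y := by positivity
    have hx0 : 0 ≤ x := by positivity
    have hy3 : y ^ 3 = N + 1 := by rw [hy, ← Real.rpow_natCast, ← Real.rpow_mul (by positivity)]; norm_num
    have hx3 : x ^ 3 = N := by rw [hx, ← Real.rpow_natCast, ← Real.rpow_mul (by positivity)]; norm_num
    have e : ((N:ℝ) + 1) ^ (-(2/3):ℝ) = 1 / y ^ 2 := by
      rw [hy, ← Real.rpow_natCast, ← Real.rpow_mul (by positivity), one_div, ← Real.rpow_neg (by positivity)]; norm_num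
    have hxy : x ≤ y := Real.rpow_le_rpow hN (by linarith) (by norm_num)
    have : 1 / y ^ 2 ≤ 3 * (y - x) := by
      rw [div_le_iff₀ (by positivity)]
      have : (y - x) * (y^2 + x*y + x^2) = 1 := by linear_combination hy3 - hx3
      nlinarith [mul_nonneg (sub_nonneg.2 hxy) (sub_nonneg.2 hxy), mul_nonneg hx0 (sub_nonneg.2 hxy), mul_nonneg hx0 hx0, mul_nonneg (mul_nonneg hx0 (sub_nonneg.2 hxy)) hy0.le]
    rw [e]; linarith

namespace GGData
open Polynomial
variable {lam : ℝ} (D : GGData lam)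

noncomputable def K2 (D : GGData lam) : ℝ := 4 * |lam * (1 - lam)| * D.K1
lemma K1_pos : 1 ≤ D.K1 := by unfold K1; have := D.K0_pos; linarith
lemma K2_nonneg : 0 ≤ D.K2 := by unfold K2; have := D.K1_pos; positivity

lemma diag_ineq (k j : ℕ) (hk : 1 ≤ k) : |(k:ℝ)^2 - 4 * D.om j ^ 2| * |D.t k j j| ≤
    D.K2 * (k:ℝ)^2 * ((min (j+1) k : ℕ) : ℝ) ^ (-(2/3):ℝ) := by
  have h := congrArg abs (D.identDiag k j)
  have hk' : (0:ℝ) < k := by exact_mod_cast hk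
  rw [abs_mul, abs_mul, abs_mul, abs_neg, abs_mul, abs_of_pos (by norm_num : (0:ℝ) < 4),
    abs_of_pos (by positivity : (0:ℝ) < (k:ℝ)^2)] at h
  have h2 := D.t2_diag j k hk
  have hk2 : (0:ℝ) < (k:ℝ)^2 := by positivity
  apply le_of_mul_le_mul_right _ hk2
  calc _ = 4 * |lam * (1 - lam)| * |D.t2 k j j| := by rw [← h]; ring
    _ ≤ 4 * |lam * (1 - lam)| * (D.K1 * (k:ℝ)^4 * ((min (j+1) k : ℕ) : ℝ) ^ (-(2/3):ℝ)) := by gcongr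
    _ = _ := by unfold K2; ring

lemma diag_pt (k j N : ℕ) (hk : 1 ≤ k) (hj : j < N) : |D.t k j j| ≤
    (8 * D.K2 + 4 * |lam| + 3) * (((j:ℝ) + 1) ^ (-(2/3):ℝ) + (N:ℝ)^(1/3:ℝ) / (1 + |(k:ℝ) - 2 * j|)) := by
  have hK := D.K2_nonneg
  have ht := D.t_abs k j j
  have hl := abs_nonneg lam
  have hN1 : (1:ℝ) ≤ N := by exact_mod_cast (by omega : 1 ≤ N)
  have hN : 1 ≤ (N:ℝ)^(1/3:ℝ) := Real.one_le_rpow hN1 (by norm_num)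
  set d := |(k:ℝ) - 2 * j| with hd
  have hd0 : 0 ≤ d := abs_nonneg _
  set z := ((j:ℝ) + 1) ^ (-(2/3):ℝ) with hz
  have hz0 : 0 < z := by positivity
  have hP : 0 ≤ (N:ℝ)^(1/3:ℝ) / (1 + d) := by positivity
  rcases Nat.eq_zero_or_pos j with rfl | hj0
  · have : z = 1 := by rw [hz]; simp
    rw [this]; nlinarith
  by_cases hc : d < 4 * |lam| + 1
  · have : 1 ≤ (4 * |lam| + 2) * ((N:ℝ)^(1/3:ℝ) / (1 + d)) := by
      rw [← mul_div_assoc, le_div_iff₀ (by positivity)]; nlinarith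
    nlinarith
  push Not at hc
  have hin := D.diag_ineq k j hk
  have hom := D.om_ge j hj0
  have hk' : (1:ℝ) ≤ k := by exact_mod_cast hk
  have hj' : (1:ℝ) ≤ j := by exact_mod_cast hj0
  have hjN : (j:ℝ) + 1 ≤ N := by exact_mod_cast hj
  have h1 : (1 + d) / 4 ≤ |(k:ℝ) - 2 * D.om j| := by
    have : d ≤ |(k:ℝ) - 2 * D.om j| + 2 * |lam| := by
      have e : (k:ℝ) - 2 * j = ((k:ℝ) - 2 * D.om j) + 2 * lam := by unfold om; ring
      rw [hd, e]
      refine (abs_add_le _ _).trans ?_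
      rw [abs_mul]; norm_num
    linarith
  have h2 : (1 + d) / 4 * k ≤ |(k:ℝ)^2 - 4 * D.om j ^ 2| := by
    have : (k:ℝ)^2 - 4 * D.om j ^ 2 = ((k:ℝ) - 2 * D.om j) * (k + 2 * D.om j) := by ring
    rw [this, abs_mul]
    have : (k:ℝ) ≤ |(k:ℝ) + 2 * D.om j| := by
      refine le_trans ?_ (le_abs_self _); linarith
    gcongr
  set w := ((min (j+1) k : ℕ) : ℝ) ^ (-(2/3):ℝ) with hw
  have h3 : (1 + d) / 4 * |D.t k j j| ≤ D.K2 * (k * w) := by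
    have : ((1 + d) / 4 * |D.t k j j|) * k ≤ (D.K2 * (k * w)) * k := by
      calc _ = (1 + d) / 4 * k * |D.t k j j| := by ring
        _ ≤ |(k:ℝ)^2 - 4 * D.om j ^ 2| * |D.t k j j| := by gcongr
        _ ≤ _ := hin
        _ = _ := by ring
    exact le_of_mul_le_mul_right this (by linarith)
  have hj1 : (0:ℝ) < (j:ℝ) + 1 := by linarith
  have hzj : ((j:ℝ)+1) * z ≤ (N:ℝ)^(1/3:ℝ) := by
    have : ((j:ℝ)+1) * z = ((j:ℝ)+1) ^ (1/3:ℝ) := by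
      rw [hz]; nth_rewrite 1 [← Real.rpow_one ((j:ℝ)+1)]
      rw [← Real.rpow_add hj1]; norm_num
    rw [this]; exact Real.rpow_le_rpow hj1.le hjN (by norm_num)
  have h4 : k * w ≤ (1 + d) * z + 2 * (N:ℝ)^(1/3:ℝ) := by
    by_cases hq : k ≤ j + 1
    · rw [hw, min_eq_right hq]
      have : (k:ℝ) * (k:ℝ) ^ (-(2/3):ℝ) = (k:ℝ) ^ (1/3:ℝ) := by
        nth_rewrite 1 [← Real.rpow_one (k:ℝ)]
        rw [← Real.rpow_add (by linarith)]; norm_num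
      rw [this]
      have : (k:ℝ) ^ (1/3:ℝ) ≤ (N:ℝ)^(1/3:ℝ) := by
        apply Real.rpow_le_rpow (by linarith) _ (by norm_num)
        exact_mod_cast hq.trans hj
      have : 0 ≤ (1 + d) * z := by positivity
      linarith
    · push Not at hq
      rw [hw, min_eq_left hq.le]
      push_cast
      rw [← hz]
      have : (k:ℝ) ≤ d + 2 * j := by have := le_abs_self ((k:ℝ) - 2 * j); linarith
      nlinarith
  have h5 : (1 + d) * |D.t k j j| ≤ (1 + d) * ((8 * D.K2) * (z + (N:ℝ)^(1/3:ℝ) / (1 + d))) := by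
    have e : (1 + d) * ((8 * D.K2) * (z + (N:ℝ)^(1/3:ℝ) / (1 + d))) = 8 * D.K2 * ((1 + d) * z + (N:ℝ)^(1/3:ℝ)) := by
      field_simp
    rw [e]
    have h6 := mul_le_mul_of_nonneg_left h4 hK
    have : 0 ≤ D.K2 * ((1 + d) * z) := by positivity
    nlinarith
  have h6 := le_of_mul_le_mul_left h5 (by positivity)
  refine h6.trans ?_
  have : 0 ≤ z + (N:ℝ)^(1/3:ℝ) / (1 + d) := by positivity
  nlinarith

lemma diag_sum : ∃ B : ℝ, 0 < B ∧ ∀ N k : ℕ, 1 ≤ k → ∑ j ∈ range N, |D.t k j j| ≤ B * (N:ℝ)^(2/5:ℝ) := by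
  have hK := D.K2_nonneg
  have hl := abs_nonneg lam
  set K := 8 * D.K2 + 4 * |lam| + 3 with hKd
  have hK0 : 0 < K := by positivity
  refine ⟨K * 35, by positivity, fun N k hk => ?_⟩
  rcases Nat.eq_zero_or_pos N with rfl | hN
  · simp
  have hN1 : (1:ℝ) ≤ N := by exact_mod_cast hN
  have h1 : ∑ j ∈ range N, |D.t k j j| ≤ ∑ j ∈ range N, K * (((j:ℝ) + 1) ^ (-(2/3):ℝ) +
      (N:ℝ)^(1/3:ℝ) * (1 / (1 + |((k/2 : ℕ):ℝ) - j|))) := by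
    apply sum_le_sum
    intro j hj
    refine (D.diag_pt k j N hk (mem_range.1 hj)).trans ?_
    rw [mul_one_div]
    suffices hab : |((k/2 : ℕ):ℝ) - j| ≤ |(k:ℝ) - 2 * j| by
      have h0 := abs_nonneg (((k/2 : ℕ):ℝ) - j)
      apply mul_le_mul_of_nonneg_left _ hK0.le
      apply add_le_add le_rfl
      apply div_le_div_of_nonneg_left (by positivity) (by linarith) (by linarith)
    have hkk : k = 2 * (k/2) ∨ k = 2 * (k/2) + 1 := by omega
    generalize k / 2 = a at *
    rcases le_or_gt j a with h | h
    · have h' : (j:ℝ) ≤ a := by exact_mod_cast h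
      rw [abs_of_nonneg (by linarith)]
      refine le_trans ?_ (le_abs_self _)
      rcases hkk with h | h <;> rw [h] <;> push_cast <;> linarith
    · have h' : (a:ℝ) + 1 ≤ j := by exact_mod_cast h
      rw [abs_of_nonpos (by linarith)]
      refine le_trans ?_ (neg_le_abs _)
      rcases hkk with h | h <;> rw [h] <;> push_cast <;> linarith
  refine h1.trans ?_
  rw [← mul_sum, sum_add_distrib, ← mul_sum, mul_assoc]
  gcongr
  have h2 := gg_sum_23 N
  have h3 := gg_dist_sum N (k/2)
  have h4 := gg_harm_le N hN (1/15) (by norm_num)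
  have h5 : (N:ℝ)^(1/3:ℝ) ≤ (N:ℝ)^(2/5:ℝ) := Real.rpow_le_rpow_of_exponent_le hN1 (by norm_num)
  have h6 : (N:ℝ)^(1/3:ℝ) * (N:ℝ)^(1/15:ℝ) = (N:ℝ)^(2/5:ℝ) := by
    rw [← Real.rpow_add (by linarith)]; norm_num
  have h7 : (N:ℝ)^(1/3:ℝ) * ∑ i ∈ range N, 1 / (1 + |((k/2 : ℕ):ℝ) - i|) ≤ (N:ℝ)^(1/3:ℝ) * (32 * (N:ℝ)^(1/15:ℝ)) := by
    gcongr
    norm_num at h4 ⊢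
    norm_num at h3
    linarith
  have h8 : (N:ℝ)^(1/3:ℝ) * (32 * (N:ℝ)^(1/15:ℝ)) = 32 * (N:ℝ)^(2/5:ℝ) := by rw [← h6]; ring
  linarith

end GGData

/-- interpolation of a step function by a linear function at two points. -/
lemma gg_interp (R : ℕ) (ν Xv h : ℕ → ℝ) (α β d Xn ha hb V : ℝ) (hν : ∀ j, 0 ≤ ν j) (hab : α < β) (hd : 0 < d)
    (hh : ∀ j, (h j = 1 ∧ Xv j ≤ Xn) ∨ (h j = 0 ∧ Xn ≤ Xv j))
    (h_a : (ha = 1 ∧ α + d ≤ Xn) ∨ (ha = 0 ∧ Xn + d ≤ α))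
    (h_b : (hb = 1 ∧ β + d ≤ Xn) ∨ (hb = 0 ∧ Xn + d ≤ β))
    (hm : ∑ j ∈ range R, ν j ≤ 1)
    (hV : ∑ j ∈ range R, ((Xv j - α) * (Xv j - β)) ^ 2 * ν j ≤ V ^ 2) (hV0 : 0 ≤ V) :
    |∑ j ∈ range R, h j * ν j - (ha * (β * ∑ j ∈ range R, ν j - ∑ j ∈ range R, Xv j * ν j) / (β - α)
      + hb * (∑ j ∈ range R, Xv j * ν j - α * ∑ j ∈ range R, ν j) / (β - α))| ≤ V / (d * (β - α)) := by
  have hba : 0 < β - α := by linarith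
  have e1 : ∑ j ∈ range R, h j * ν j - (ha * (β * ∑ j ∈ range R, ν j - ∑ j ∈ range R, Xv j * ν j) / (β - α)
      + hb * (∑ j ∈ range R, Xv j * ν j - α * ∑ j ∈ range R, ν j) / (β - α)) =
      ∑ j ∈ range R, (h j - (ha * (β - Xv j) + hb * (Xv j - α)) / (β - α)) * ν j := by
    have : ∀ j, (h j - (ha * (β - Xv j) + hb * (Xv j - α)) / (β - α)) * ν j =
        h j * ν j - (ha * β / (β - α) * ν j - ha / (β - α) * (Xv j * ν j) + (hb / (β - α) * (Xv j * ν j)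
          - hb * α / (β - α) * ν j)) := by intro j; field_simp
    simp_rw [this]
    rw [sum_sub_distrib, sum_add_distrib, sum_sub_distrib, sum_sub_distrib]
    simp_rw [← mul_sum]
    ring
  have hpt : ∀ j, |h j - (ha * (β - Xv j) + hb * (Xv j - α)) / (β - α)| ≤ |(Xv j - α) * (Xv j - β)| / (d * (β - α)) := by
    intro j
    rw [le_div_iff₀ (by positivity)]
    have : |h j - (ha * (β - Xv j) + hb * (Xv j - α)) / (β - α)| * (d * (β - α)) =
        |h j * (β - α) - (ha * (β - Xv j) + hb * (Xv j - α))| * d := by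
      have : h j * (β - α) - (ha * (β - Xv j) + hb * (Xv j - α)) =
        (h j - (ha * (β - Xv j) + hb * (Xv j - α)) / (β - α)) * (β - α) := by field_simp
      rw [this, abs_mul, abs_of_pos hba]; ring
    rw [this]
    rcases h_a with ⟨rfl, h1⟩ | ⟨rfl, h1⟩ <;> rcases h_b with ⟨rfl, h2⟩ | ⟨rfl, h2⟩ <;>
      rcases hh j with ⟨h3, h4⟩ | ⟨h3, h4⟩ <;> rw [h3]
    · have : (1:ℝ) * (β - α) - (1 * (β - Xv j) + 1 * (Xv j - α)) = 0 := by ring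
      rw [this, abs_zero, zero_mul]; positivity
    · have : (0:ℝ) * (β - α) - (1 * (β - Xv j) + 1 * (Xv j - α)) = -(β - α) := by ring
      rw [this, abs_neg, abs_of_pos hba, abs_mul, abs_of_nonneg (by linarith : 0 ≤ Xv j - α),
        abs_of_nonneg (by linarith : 0 ≤ Xv j - β)]
      apply mul_le_mul <;> linarith
    · have : (1:ℝ) * (β - α) - (1 * (β - Xv j) + 0 * (Xv j - α)) = Xv j - α := by ring
      rw [this, abs_mul]
      refine mul_le_mul_of_nonneg_left ?_ (abs_nonneg _)
      refine le_trans ?_ (neg_le_abs _); linarith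
    · have : (0:ℝ) * (β - α) - (1 * (β - Xv j) + 0 * (Xv j - α)) = Xv j - β := by ring
      rw [this, abs_mul, mul_comm]
      refine mul_le_mul_of_nonneg_right ?_ (abs_nonneg _)
      refine le_trans ?_ (le_abs_self _); linarith
    · exfalso; linarith
    · exfalso; linarith
    · have : (1:ℝ) * (β - α) - (0 * (β - Xv j) + 0 * (Xv j - α)) = (β - α) := by ring
      rw [this, abs_of_pos hba, abs_mul, abs_of_nonpos (by linarith : Xv j - α ≤ 0),
        abs_of_nonpos (by linarith : Xv j - β ≤ 0), mul_comm]
      apply mul_le_mul <;> linarith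
    · have : (0:ℝ) * (β - α) - (0 * (β - Xv j) + 0 * (Xv j - α)) = 0 := by ring
      rw [this, abs_zero, zero_mul]; positivity
  rw [e1]
  have h5 : |∑ j ∈ range R, (h j - (ha * (β - Xv j) + hb * (Xv j - α)) / (β - α)) * ν j| ≤
      (∑ j ∈ range R, |(Xv j - α) * (Xv j - β)| * ν j) / (d * (β - α)) := by
    refine (abs_sum_le_sum_abs _ _).trans ?_
    rw [sum_div]
    apply sum_le_sum
    intro j _
    rw [abs_mul, abs_of_nonneg (hν j), mul_div_right_comm]
    exact mul_le_mul_of_nonneg_right (hpt j) (hν j)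
  refine h5.trans ?_
  gcongr
  apply abs_le_of_sq_le_sq' _ hV0 |>.2
  have hcs := sum_mul_sq_le_sq_mul_sq (range R) (fun j => |(Xv j - α) * (Xv j - β)| * √(ν j)) (fun j => √(ν j))
  have e2 : ∀ j, |(Xv j - α) * (Xv j - β)| * √(ν j) * √(ν j) = |(Xv j - α) * (Xv j - β)| * ν j := by
    intro j; rw [mul_assoc, Real.mul_self_sqrt (hν j)]
  have e3 : ∀ j, (|(Xv j - α) * (Xv j - β)| * √(ν j)) ^ 2 = ((Xv j - α) * (Xv j - β)) ^ 2 * ν j := by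
    intro j; rw [mul_pow, sq_abs, Real.sq_sqrt (hν j)]
  simp only [e2, e3, Real.sq_sqrt (hν _)] at hcs
  refine hcs.trans ?_
  have h6 : 0 ≤ ∑ j ∈ range R, ν j := sum_nonneg (fun j _ => hν j)
  calc _ ≤ V ^ 2 * 1 := by gcongr
    _ = _ := by ring

namespace GGData
open Polynomial
variable {lam : ℝ} (D : GGData lam)

lemma row_deg (k i R : ℕ) (hR : i + k < R) : (ggT k * D.H i).degree < R := by
  rw [degree_mul, D.degree]
  have := ggT_degree k
  calc (ggT k).degree + (i : WithBot ℕ) ≤ (k : WithBot ℕ) + (i : WithBot ℕ) := by gcongr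
    _ = ((i + k : ℕ) : WithBot ℕ) := by push_cast; rw [add_comm]
    _ < R := by exact_mod_cast hR

lemma row_mass (k i R : ℕ) (hR : i + k < R) :
    ∑ j ∈ range R, D.t k i j ^ 2 = (1 + D.t (2 * k) i i) / 2 := by
  have h := D.parseval (D.row_deg k i R hR) (ggT k * D.H i)
  have e : ggT k * D.H i * (ggT k * D.H i) = C (1/2) * (D.H i * D.H i + ggT (2 * k) * D.H i * D.H i) := by
    have hs := ggT_sq k
    have hc : (C (1/2:ℝ) : ℝ[X]) * 2 = 1 := by
      rw [show (2:ℝ[X]) = C 2 from rfl, ← C_mul]; norm_num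
    linear_combination (C (1/2:ℝ) * D.H i ^ 2) * hs - (ggT k ^ 2 * D.H i ^ 2) * hc
  rw [e, J_C_mul, map_add, D.norm_one] at h
  simp only [t]
  rw [show (1 + D.J (ggT (2*k) * D.H i * D.H i)) / 2 = 1/2 * (1 + D.J (ggT (2*k) * D.H i * D.H i)) by ring, h]
  apply sum_congr rfl; intro j _; ring

lemma row_energy (k i R : ℕ) (hR : i + k < R) :
    ∑ j ∈ range R, D.om j ^ 2 * D.t k i j ^ 2 = D.om i ^ 2 * ((1 + D.t (2 * k) i i) / 2)
      + k ^ 2 * (1 - (1 + D.t (2 * k) i i) / 2) := by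
  set p := ggT k * D.H i with hp
  set q := (2 * C lam + 1) * X * derivative p - (1 - X ^ 2) * derivative (derivative p) with hq
  have h := D.parseval (D.row_deg k i R hR) q
  have h1 : ∀ j, D.J (q * D.H j) = (j * (j + 2 * lam)) * D.J (p * D.H j) := by
    intro j
    have hb := D.ibp (p * derivative (D.H j) - derivative p * D.H j)
    have ho := D.ode j
    have : q * D.H j = C (j * (j + 2 * lam)) * (p * D.H j) + ((1 - X ^ 2) * derivative (p * derivative (D.H j) - derivative p * D.H j) - (2 * C lam + 1) * X * (p * derivative (D.H j) - derivative p * D.H j)) := by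
      simp only [derivative_mul, map_sub, C_mul, C_add, map_natCast, map_ofNat]
      linear_combination (D.H j) * hq - p * ho
    rw [this, map_add, hb, J_C_mul, add_zero]
  have h2 : D.J (p * q) = (i * (i + 2 * lam)) * D.J (p * p) + k ^ 2 * (1 - D.J (p * p)) := by
    have hb := D.ibp (ggT k * derivative (ggT k) * D.H i ^ 2)
    have ho := D.ode i
    have hpl := ggT_pell k
    have e : p * q = C (i * (i + 2 * lam)) * (p * p) + C ((k:ℝ)^2) * (D.H i * D.H i - p * p) -
      ((1 - X ^ 2) * derivative (ggT k * derivative (ggT k) * D.H i ^ 2) - (2 * C lam + 1) * X * (ggT k * derivative (ggT k) * D.H i ^ 2)) := by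
      rw [hq, hp]
      simp only [derivative_mul, derivative_pow, map_sub, map_add, C_mul, C_add, C_pow, map_natCast, map_ofNat, pow_one, Nat.add_one_sub_one, Nat.cast_ofNat]
      linear_combination (-(ggT k ^ 2 * D.H i)) * ho + (D.H i ^ 2) * hpl
    rw [e, map_sub, hb, sub_zero, map_add, J_C_mul, J_C_mul, map_sub, D.norm_one]
  have h3 : D.J (p * p) = (1 + D.t (2 * k) i i) / 2 := by
    rw [← D.row_mass k i R hR]
    rw [D.parseval (D.row_deg k i R hR) p]
    apply sum_congr rfl; intro j _; simp only [t]; ring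
  rw [← hp] at h
  rw [h2, h3] at h
  have h4 : ∑ j ∈ range R, D.om j ^ 2 * D.t k i j ^ 2 = ∑ j ∈ range R, D.J (p * D.H j) * D.J (q * D.H j) + lam ^ 2 * ∑ j ∈ range R, D.t k i j ^ 2 := by
    rw [mul_sum, ← sum_add_distrib]
    apply sum_congr rfl
    intro j _
    rw [h1]
    simp only [om, t]
    ring
  rw [h4, ← h, D.row_mass k i R hR]
  simp only [om]
  ring

lemma row_Q (k i R : ℕ) (hk : 1 ≤ k) :
    ∑ j ∈ range R, ((D.om j ^ 2 - (D.om i - k) ^ 2) * (D.om j ^ 2 - (D.om i + k) ^ 2)) ^ 2 * D.t k i j ^ 2 ≤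
      (D.K0 * D.K1 * k ^ 4 * ((min (i+1) k : ℕ) : ℝ) ^ (-(1/3):ℝ)) ^ 2 := by
  have h := D.t2_row i k hk R
  have e : ∀ j, ((D.om j ^ 2 - (D.om i - k) ^ 2) * (D.om j ^ 2 - (D.om i + k) ^ 2)) ^ 2 * D.t k i j ^ 2
      = (4 * (lam * (1 - lam))) ^ 2 * D.t2 k i j ^ 2 := by
    intro j
    rw [← mul_pow, ← mul_pow]
    have := D.identI k i j
    have h2 : (D.om j ^ 2 - (D.om i - k) ^ 2) * (D.om j ^ 2 - (D.om i + k) ^ 2) * D.t k i j = -((4 * (lam * (1 - lam))) * D.t2 k i j) := by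
      linear_combination this
    rw [h2]; ring
  simp_rw [e]
  rw [← mul_sum]
  have h1 : (4 * (lam * (1 - lam))) ^ 2 ≤ D.K0 ^ 2 := by
    apply sq_le_sq'
    · unfold K0; have := neg_abs_le (lam * (1 - lam)); linarith
    · unfold K0; have := le_abs_self (lam * (1 - lam)); linarith
  have hK1 := D.K1_pos
  have hq : (0:ℝ) ≤ ((min (i+1) k : ℕ) : ℝ) := by positivity
  set q := ((min (i+1) k : ℕ) : ℝ)
  have e2 : q ^ (-(2/3):ℝ) = (q ^ (-(1/3):ℝ)) ^ 2 := by
    rw [← Real.rpow_natCast, ← Real.rpow_mul hq]; norm_num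
  rw [e2] at h
  have h3 : (0:ℝ) ≤ ∑ j ∈ range R, D.t2 k i j ^ 2 := sum_nonneg (fun _ _ => sq_nonneg _)
  calc _ ≤ D.K0 ^ 2 * (D.K1 * (k:ℝ)^8 * (q ^ (-(1/3):ℝ)) ^ 2) := by gcongr
    _ ≤ D.K0 ^ 2 * (D.K1 ^ 2 * (k:ℝ)^8 * (q ^ (-(1/3):ℝ)) ^ 2) := by
      gcongr; nlinarith
    _ = _ := by ring

lemma om_sq_mono {i j : ℕ} (h : i ≤ j) : D.om i ^ 2 ≤ D.om j ^ 2 := by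
  rcases h.eq_or_lt with rfl | h
  · rfl
  have h' : (i:ℝ) + 1 ≤ j := by exact_mod_cast h
  have hl := D.hlam
  have : (0:ℝ) ≤ i := by positivity
  simp only [om]
  nlinarith

/-- the partial row sum for a row with a gap. -/
lemma row_good (k i n : ℕ) (hk : 1 ≤ k) (hi : 1 ≤ i) (d ha hb : ℝ) (hd : 0 < d)
    (h_a : (ha = 1 ∧ (D.om i - k) ^ 2 + d ≤ D.om n ^ 2) ∨ (ha = 0 ∧ D.om n ^ 2 + d ≤ (D.om i - k) ^ 2))
    (h_b : (hb = 1 ∧ (D.om i + k) ^ 2 + d ≤ D.om n ^ 2) ∨ (hb = 0 ∧ D.om n ^ 2 + d ≤ (D.om i + k) ^ 2)) :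
    |∑ j ∈ range (n + 1), D.t k i j ^ 2 - (ha + hb) / 4| ≤ |D.t (2 * k) i i| * (1 + k / D.om i)
      + D.K0 * D.K1 * k ^ 4 * ((min (i+1) k : ℕ) : ℝ) ^ (-(1/3):ℝ) / (d * (4 * D.om i * k)) := by
  set R := i + k + n + 1 with hR
  have ho : 0 < D.om i := by
    have := D.om_ge i hi
    have : (0:ℝ) ≤ i := by positivity
    linarith
  have hk0 : (0:ℝ) < k := by exact_mod_cast hk
  have hm := D.row_mass k i R (by omega)
  have he := D.row_energy k i R (by omega)
  have hK0 := D.K0_pos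
  have hK1 := D.K1_pos
  have hba : (D.om i + k) ^ 2 - (D.om i - k) ^ 2 = 4 * D.om i * k := by ring
  have hba0 : 0 < 4 * D.om i * k := by positivity
  have ht := abs_le.1 (D.t_abs (2 * k) i i)
  have key := gg_interp R (fun j => D.t k i j ^ 2) (fun j => D.om j ^ 2) (fun j => if j < n + 1 then 1 else 0)
    ((D.om i - k) ^ 2) ((D.om i + k) ^ 2) d (D.om n ^ 2) ha hb
    (D.K0 * D.K1 * k ^ 4 * ((min (i+1) k : ℕ) : ℝ) ^ (-(1/3):ℝ)) (fun j => sq_nonneg _) (by linarith) hd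
    (by
      intro j
      by_cases hj : j < n + 1
      · left; exact ⟨if_pos hj, D.om_sq_mono (by omega)⟩
      · right; exact ⟨if_neg hj, D.om_sq_mono (by omega)⟩) h_a h_b
    (by rw [hm]; linarith) (D.row_Q k i R hk) (by positivity)
  rw [hm, he, hba] at key
  have e1 : ∑ j ∈ range R, (if j < n + 1 then (1:ℝ) else 0) * D.t k i j ^ 2 = ∑ j ∈ range (n + 1), D.t k i j ^ 2 := by
    simp only [ite_mul, one_mul, zero_mul]
    rw [← sum_filter]
    apply sum_congr _ (fun _ _ => rfl)
    ext j; simp only [mem_filter, mem_range]; omega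
  rw [e1] at key
  set t := D.t (2 * k) i i
  set w := D.om i
  set S := ∑ j ∈ range (n + 1), D.t k i j ^ 2
  have e2 : ha * ((w + k) ^ 2 * ((1 + t) / 2) - (w ^ 2 * ((1 + t) / 2) + k ^ 2 * (1 - (1 + t) / 2))) / (4 * w * k) +
      hb * (w ^ 2 * ((1 + t) / 2) + k ^ 2 * (1 - (1 + t) / 2) - (w - k) ^ 2 * ((1 + t) / 2)) / (4 * w * k) =
      (ha + hb) / 4 + t * ((ha + hb) / 4 + (ha - hb) / 4 * (k / w)) := by
    field_simp; ring
  rw [e2] at key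
  have hx : 0 < k / w := by positivity
  have h3 : |t * ((ha + hb) / 4 + (ha - hb) / 4 * (k / w))| ≤ |t| * (1 + k / w) := by
    rw [abs_mul]
    apply mul_le_mul_of_nonneg_left _ (abs_nonneg _)
    rw [abs_le]
    rcases h_a with ⟨rfl, _⟩ | ⟨rfl, _⟩ <;> rcases h_b with ⟨rfl, _⟩ | ⟨rfl, _⟩ <;> constructor <;> linarith
  have h4 : S - (ha + hb) / 4 = (S - ((ha + hb) / 4 + t * ((ha + hb) / 4 + (ha - hb) / 4 * (k / w)))) +
    t * ((ha + hb) / 4 + (ha - hb) / 4 * (k / w)) := by ring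
  rw [h4]
  refine (abs_add_le _ _).trans ?_
  linarith

end GGData

lemma gg_count (N : ℕ) (a G : ℝ) (hG : 1 ≤ G) :
    ∑ i ∈ range N, (if |(i:ℝ) - a| < G then (1:ℝ) else 0) ≤ 3 * G := by
  rw [← sum_filter, sum_const, nsmul_eq_mul, mul_one]
  have h1 : ((range N).filter (fun i : ℕ => |(i:ℝ) - a| < G)).card ≤ (Finset.Icc ⌈a - G⌉ ⌊a + G⌋).card := by
    apply card_le_card_of_injOn (fun i : ℕ => (i:ℤ))
    · intro i hi
      simp only [coe_filter, mem_range, Set.mem_setOf_eq, abs_lt] at hi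
      simp only [coe_Icc, Set.mem_Icc, Int.ceil_le, Int.le_floor]
      push_cast
      constructor <;> linarith [hi.2.1, hi.2.2]
    · intro i _ j _ h; simpa using h
  rw [Int.card_Icc] at h1
  have h2 : ((⌊a + G⌋ + 1 - ⌈a - G⌉).toNat : ℝ) ≤ 2 * G + 1 := by
    rcases le_total 0 (⌊a + G⌋ + 1 - ⌈a - G⌉) with h | h
    · have : (((⌊a + G⌋ + 1 - ⌈a - G⌉).toNat : ℤ) : ℝ) = ((⌊a + G⌋ + 1 - ⌈a - G⌉ : ℤ) : ℝ) := by
        rw [Int.toNat_of_nonneg h]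
      rw [Int.cast_natCast] at this
      rw [this]; push_cast
      have := Int.floor_le (a + G)
      have := Int.le_ceil (a - G)
      linarith
    · rw [Int.toNat_of_nonpos h]; norm_num; linarith
  have h3 : (((range N).filter (fun i : ℕ => |(i:ℝ) - a| < G)).card : ℝ) ≤ ((⌊a + G⌋ + 1 - ⌈a - G⌉).toNat : ℝ) := by
    exact_mod_cast h1
  linarith

lemma gg_main_count (n k : ℕ) :
    |∑ i ∈ range (n + 1), ((if k ≤ i + n then (1:ℝ) else 0) + (if i + k ≤ n then (1:ℝ) else 0)) / 4
      - max (2 * ((n:ℝ) + 1) - k) 0 / 4| ≤ 1 := by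
  rw [← sum_div, sum_add_distrib, ← sum_filter, ← sum_filter, sum_const, sum_const, nsmul_eq_mul, nsmul_eq_mul,
    mul_one, mul_one]
  have e1 : (range (n + 1)).filter (fun i => k ≤ i + n) = Finset.Ico (k - n) (n + 1) := by
    ext i; simp only [mem_filter, mem_range, mem_Ico]; omega
  have e2 : (range (n + 1)).filter (fun i => i + k ≤ n) = range (n + 1 - k) := by
    ext i; simp only [mem_filter, mem_range]; omega
  rw [e1, e2, Nat.card_Ico, card_range]
  rcases le_or_gt k n with h | h
  · rw [show k - n = 0 by omega, Nat.sub_zero, Nat.cast_sub (by omega)]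
    push_cast
    have : (k:ℝ) ≤ n := by exact_mod_cast h
    rw [max_eq_left (by linarith)]
    rw [abs_le]; constructor <;> linarith
  · rw [show n + 1 - k = 0 by omega]
    rcases le_or_gt k (2 * n + 1) with h2 | h2
    · rw [show n + 1 - (k - n) = 2 * n + 1 - k by omega, Nat.cast_sub h2]
      push_cast
      have : (k:ℝ) ≤ 2 * n + 1 := by exact_mod_cast h2
      rw [max_eq_left (by linarith)]
      rw [abs_le]; constructor <;> linarith
    · rw [show n + 1 - (k - n) = 0 by omega]
      have : 2 * (n:ℝ) + 2 ≤ k := by exact_mod_cast h2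
      rw [max_eq_right (by linarith)]
      norm_num

namespace GGData
open Polynomial
variable {lam : ℝ} (D : GGData lam)

noncomputable def A (n k : ℕ) : ℝ := ∑ i ∈ range (n + 1), ∑ j ∈ range (n + 1), D.t k i j ^ 2

lemma row_le_one (k i n : ℕ) : ∑ j ∈ range (n + 1), D.t k i j ^ 2 ≤ 1 := by
  have ht := abs_le.1 (D.t_abs (2 * k) i i)
  have hm := D.row_mass k i (i + k + n + 1) (by omega)
  calc _ ≤ ∑ j ∈ range (i + k + n + 1), D.t k i j ^ 2 := by
        apply sum_le_sum_of_subset_of_nonneg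
        · intro j; simp only [mem_range]; omega
        · intros; positivity
    _ ≤ 1 := by rw [hm]; linarith

lemma gap_b (n i k : ℕ) (G : ℝ) (hn : 1 ≤ n) (hi : 1 ≤ i) (hG : 1 ≤ G)
    (h2 : G ≤ |(i:ℝ) - ((n:ℝ) - k)|) :
    ((if i + k ≤ n then (1:ℝ) else 0) = 1 ∧ (D.om i + k) ^ 2 + G * ((n:ℝ) + 1) / 8 ≤ D.om n ^ 2) ∨
    ((if i + k ≤ n then (1:ℝ) else 0) = 0 ∧ D.om n ^ 2 + G * ((n:ℝ) + 1) / 8 ≤ (D.om i + k) ^ 2) := by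
  have h3 := D.om_ge n hn
  have h4 := D.om_ge i hi
  have hi0 : (0:ℝ) ≤ i := by positivity
  have hk0 : (0:ℝ) ≤ k := by positivity
  have hs : ((n:ℝ) + 1) / 4 ≤ D.om n + D.om i + k := by linarith
  have hn0 : (0:ℝ) < n := by exact_mod_cast hn
  by_cases h : i + k ≤ n
  · left
    refine ⟨if_pos h, ?_⟩
    have h' : (i:ℝ) + k ≤ n := by exact_mod_cast h
    rw [abs_of_nonpos (by linarith)] at h2
    have e : D.om n ^ 2 - (D.om i + k) ^ 2 = ((n:ℝ) - i - k) * (D.om n + D.om i + k) := by simp only [om]; ring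
    have : G * (((n:ℝ) + 1) / 4) ≤ ((n:ℝ) - i - k) * (D.om n + D.om i + k) := by
      apply mul_le_mul <;> linarith
    have : 0 ≤ G * ((n:ℝ) + 1) := by positivity
    linarith
  · right
    refine ⟨if_neg h, ?_⟩
    have h' : (n:ℝ) + 1 ≤ i + k := by exact_mod_cast (by omega : n + 1 ≤ i + k)
    rw [abs_of_nonneg (by linarith)] at h2
    have e : (D.om i + k) ^ 2 - D.om n ^ 2 = ((i:ℝ) + k - n) * (D.om n + D.om i + k) := by simp only [om]; ring
    have : G * (((n:ℝ) + 1) / 4) ≤ ((i:ℝ) + k - n) * (D.om n + D.om i + k) := by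
      apply mul_le_mul <;> linarith
    have : 0 ≤ G * ((n:ℝ) + 1) := by positivity
    linarith

lemma gap_a (n i k : ℕ) (G : ℝ) (hn : 1 ≤ n) (hin : i ≤ n) (hG : 1 ≤ G) (hGl : 4 * |lam| ≤ G)
    (h2 : G ≤ |(i:ℝ) - ((n:ℝ) - k)|) (h3 : G ≤ |(i:ℝ) - ((k:ℝ) - n)|) :
    ((if k ≤ i + n then (1:ℝ) else 0) = 1 ∧ (D.om i - k) ^ 2 + G * ((n:ℝ) + 1) / 8 ≤ D.om n ^ 2) ∨
    ((if k ≤ i + n then (1:ℝ) else 0) = 0 ∧ D.om n ^ 2 + G * ((n:ℝ) + 1) / 8 ≤ (D.om i - k) ^ 2) := by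
  have h4 := D.om_ge n hn
  have hi0 : (0:ℝ) ≤ i := by positivity
  have hk0 : (0:ℝ) ≤ k := by positivity
  have hn0 : (1:ℝ) ≤ n := by exact_mod_cast hn
  have hin' : (i:ℝ) ≤ n := by exact_mod_cast hin
  have hl1 := neg_abs_le lam
  have hl2 := le_abs_self lam
  have hA : G ≤ (n:ℝ) - i + k := by
    rcases le_abs.1 h2 with h | h <;> linarith
  have hom : D.om n = n + lam := rfl
  have hG0 : 0 ≤ G := by linarith
  have e : D.om n ^ 2 - (D.om i - k) ^ 2 = ((n:ℝ) - i + k) * (n + i - k + 2 * lam) := by simp only [om]; ring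
  by_cases h : k ≤ i + n
  · left
    refine ⟨if_pos h, ?_⟩
    have h' : (k:ℝ) ≤ i + n := by exact_mod_cast h
    rw [abs_of_nonneg (by linarith)] at h3
    have hB : G / 2 ≤ (n:ℝ) + i - k + 2 * lam := by linarith
    rcases le_total (((n:ℝ) + 1) / 4) ((n:ℝ) - i + k) with h5 | h5
    · have : ((n:ℝ) + 1) / 4 * (G / 2) ≤ ((n:ℝ) - i + k) * (n + i - k + 2 * lam) := by
        apply mul_le_mul <;> linarith
      linarith
    · have : G * (((n:ℝ) + 1) / 4) ≤ ((n:ℝ) - i + k) * (n + i - k + 2 * lam) := by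
        apply mul_le_mul <;> linarith
      have : 0 ≤ G * ((n:ℝ) + 1) := by positivity
      linarith
  · right
    refine ⟨if_neg h, ?_⟩
    have h' : (i:ℝ) + n + 1 ≤ k := by exact_mod_cast (by omega : i + n + 1 ≤ k)
    rw [abs_of_nonpos (by linarith)] at h3
    have : (((n:ℝ) + 1) / 4) * (G / 2) ≤ ((n:ℝ) - i + k) * (-(n + i - k + 2 * lam)) := by
      apply mul_le_mul <;> linarith
    linarith

lemma row_E (n i k : ℕ) (G : ℝ) (hk : 1 ≤ k) (hkn : (k:ℝ) ≤ 5 * ((n:ℝ) + 1)) (hi : 1 ≤ i) (hin : i ≤ n)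
    (hG : 1 ≤ G) (hiG : G ≤ i) (hGN : ((n:ℝ) + 1) ^ (9/10:ℝ) ≤ G) :
    D.K0 * D.K1 * k ^ 4 * ((min (i+1) k : ℕ) : ℝ) ^ (-(1/3):ℝ) / (G * ((n:ℝ) + 1) / 8 * (4 * D.om i * k)) ≤
      1000 * D.K0 * D.K1 * ((n:ℝ) + 1) ^ (-(1/10):ℝ) := by
  have hK0 := D.K0_pos
  have hK1 := D.K1_pos
  have ho := D.om_ge i hi
  have hk0 : (1:ℝ) ≤ k := by exact_mod_cast hk
  have hin' : (i:ℝ) ≤ n := by exact_mod_cast hin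
  set q := ((min (i+1) k : ℕ) : ℝ) with hq
  have hq1 : 1 ≤ q := by rw [hq]; exact_mod_cast (by omega : 1 ≤ min (i+1) k)
  have hqi : q ≤ i + 1 := by rw [hq]; exact_mod_cast min_le_left _ _
  have hqk : q ≤ k := by rw [hq]; exact_mod_cast min_le_right _ _
  have hq0 : 0 < q := by linarith
  set N := (n:ℝ) + 1 with hN
  have hN0 : 1 ≤ N := by linarith
  have hNpos : 0 < N := by linarith
  have hG0 : 0 < G := by linarith
  have hqom : q ≤ 4 * D.om i := by linarith
  have hom : 0 < D.om i := by linarith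
  have s1 : (k:ℝ) ^ 3 * q ^ (-(4/3):ℝ) ≤ 125 * N ^ 3 * G ^ (-(4/3):ℝ) := by
    rcases le_total G q with h | h
    · have : q ^ (-(4/3):ℝ) ≤ G ^ (-(4/3):ℝ) := Real.rpow_le_rpow_of_nonpos hG0 h (by norm_num)
      calc (k:ℝ) ^ 3 * q ^ (-(4/3):ℝ) ≤ (5 * N) ^ 3 * G ^ (-(4/3):ℝ) := by gcongr
        _ = _ := by ring
    · have hkq : q = k := by
        rw [hq]; congr 1
        apply min_eq_right
        by_contra hc
        push Not at hc
        rw [hq, min_eq_left hc.le] at h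
        push_cast at h; linarith
      rw [hkq] at h ⊢
      have e1 : ∀ z : ℝ, 0 < z → z ^ 3 * z ^ (-(4/3):ℝ) = z ^ (5/3:ℝ) := by
        intro z hz
        rw [← Real.rpow_natCast, ← Real.rpow_add hz]; norm_num
      rw [e1 _ (by linarith)]
      calc (k:ℝ) ^ (5/3:ℝ) ≤ G ^ (5/3:ℝ) := Real.rpow_le_rpow (by linarith) h (by norm_num)
        _ = G ^ 3 * G ^ (-(4/3):ℝ) := (e1 G hG0).symm
        _ ≤ N ^ 3 * G ^ (-(4/3):ℝ) := by gcongr; linarith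
        _ ≤ _ := by
          have : 0 ≤ N ^ 3 * G ^ (-(4/3):ℝ) := by positivity
          linarith
  have s2 : D.K0 * D.K1 * k ^ 4 * q ^ (-(1/3):ℝ) / (G * N / 8 * (4 * D.om i * k)) ≤
      8 * D.K0 * D.K1 * ((k:ℝ) ^ 3 * q ^ (-(4/3):ℝ)) / (G * N) := by
    have e2 : q ^ (-(1/3):ℝ) = q ^ (-(4/3):ℝ) * q := by
      nth_rewrite 3 [← Real.rpow_one q]
      rw [← Real.rpow_add hq0]; norm_num
    rw [e2, div_le_div_iff₀ (by positivity) (by positivity)]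
    have : 0 ≤ D.K0 * D.K1 * (k:ℝ)^4 * q ^ (-(4/3):ℝ) * (G * N) := by positivity
    nlinarith
  refine s2.trans ?_
  have s3 : G ^ (-(4/3):ℝ) / G ≤ N ^ (-(21/10) : ℝ) := by
    have e3 : G ^ (-(4/3):ℝ) / G = G ^ (-(7/3):ℝ) := by
      rw [div_eq_mul_inv, ← Real.rpow_neg_one, ← Real.rpow_add hG0]; norm_num
    rw [e3]
    calc G ^ (-(7/3):ℝ) ≤ (N ^ (9/10:ℝ)) ^ (-(7/3):ℝ) := Real.rpow_le_rpow_of_nonpos (by positivity) hGN (by norm_num)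
      _ = _ := by rw [← Real.rpow_mul (by linarith)]; norm_num
  have e4 : N ^ (-(1/10):ℝ) = N ^ 3 / N * N ^ (-(21/10) : ℝ) := by
    have : N ^ 3 / N = N ^ (2:ℝ) := by rw [Real.rpow_two]; field_simp
    rw [this, ← Real.rpow_add hNpos]; norm_num
  calc 8 * D.K0 * D.K1 * ((k:ℝ) ^ 3 * q ^ (-(4/3):ℝ)) / (G * N) ≤
      8 * D.K0 * D.K1 * (125 * N ^ 3 * G ^ (-(4/3):ℝ)) / (G * N) := by gcongr
    _ = 1000 * D.K0 * D.K1 * (N ^ 3 / N * (G ^ (-(4/3):ℝ) / G)) := by field_simp; ring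
    _ ≤ 1000 * D.K0 * D.K1 * (N ^ 3 / N * N ^ (-(21/10) : ℝ)) := by gcongr
    _ = _ := by rw [e4]

lemma row_pt (n i k : ℕ) (G : ℝ) (hn : 1 ≤ n) (hk : 1 ≤ k) (hkn : (k:ℝ) ≤ 5 * ((n:ℝ) + 1)) (hin : i ≤ n)
    (hG : 1 ≤ G) (hGl : 4 * |lam| ≤ G) (hGN : ((n:ℝ) + 1) ^ (9/10:ℝ) ≤ G) :
    |∑ j ∈ range (n + 1), D.t k i j ^ 2 - ((if k ≤ i + n then (1:ℝ) else 0) + (if i + k ≤ n then (1:ℝ) else 0)) / 4|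
      ≤ |D.t (2 * k) i i| * (21 * ((n:ℝ) + 1) ^ (1/10:ℝ)) + 1000 * D.K0 * D.K1 * ((n:ℝ) + 1) ^ (-(1/10):ℝ)
      + ((if |(i:ℝ) - 0| < G then (1:ℝ) else 0) + (if |(i:ℝ) - ((n:ℝ) - k)| < G then (1:ℝ) else 0)
      + (if |(i:ℝ) - ((k:ℝ) - n)| < G then (1:ℝ) else 0)) := by
  have hK0 := D.K0_pos
  have hK1 := D.K1_pos
  have hN0 : 0 < (n:ℝ) + 1 := by positivity
  have p1 : 0 ≤ |D.t (2 * k) i i| * (21 * ((n:ℝ) + 1) ^ (1/10:ℝ)) := by positivity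
  have p2 : 0 ≤ 1000 * D.K0 * D.K1 * ((n:ℝ) + 1) ^ (-(1/10):ℝ) := by positivity
  have b1 : |∑ j ∈ range (n + 1), D.t k i j ^ 2 - ((if k ≤ i + n then (1:ℝ) else 0) + (if i + k ≤ n then (1:ℝ) else 0)) / 4| ≤ 1 := by
    have := D.row_le_one k i n
    have h0 : 0 ≤ ∑ j ∈ range (n + 1), D.t k i j ^ 2 := sum_nonneg (fun _ _ => sq_nonneg _)
    rw [abs_le]; split_ifs <;> constructor <;> linarith
  by_cases c1 : |(i:ℝ) - 0| < G
  · rw [if_pos c1]; split_ifs at b1 ⊢ <;> linarith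
  by_cases c2 : |(i:ℝ) - ((n:ℝ) - k)| < G
  · rw [if_pos c2]; split_ifs at b1 ⊢ <;> linarith
  by_cases c3 : |(i:ℝ) - ((k:ℝ) - n)| < G
  · rw [if_pos c3]; split_ifs at b1 ⊢ <;> linarith
  rw [if_neg c1, if_neg c2, if_neg c3]
  push Not at c1 c2 c3
  have hiG : G ≤ i := by
    rw [sub_zero, abs_of_nonneg (by positivity)] at c1; exact c1
  have hi : 1 ≤ i := by exact_mod_cast hG.trans hiG
  have key := D.row_good k i n hk hi (G * ((n:ℝ) + 1) / 8) _ _ (by positivity)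
    (D.gap_a n i k G hn hin hG hGl c2 c3) (D.gap_b n i k G hn hi hG c2)
  refine key.trans ?_
  have hE := D.row_E n i k G hk hkn hi hin hG hiG hGN
  have ho := D.om_ge i hi
  have hkw : 1 + k / D.om i ≤ 21 * ((n:ℝ) + 1) ^ (1/10:ℝ) := by
    have h1 : 1 ≤ ((n:ℝ) + 1) ^ (1/10:ℝ) := Real.one_le_rpow (by linarith) (by norm_num)
    have h2 : k / D.om i ≤ 20 * ((n:ℝ) + 1) ^ (1/10:ℝ) := by
      rw [div_le_iff₀ (by linarith)]
      have e : ((n:ℝ) + 1) = ((n:ℝ) + 1) ^ (1/10:ℝ) * ((n:ℝ) + 1) ^ (9/10:ℝ) := by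
        rw [← Real.rpow_add hN0]; norm_num
      calc (k:ℝ) ≤ 5 * ((n:ℝ) + 1) := hkn
        _ = 5 * (((n:ℝ) + 1) ^ (1/10:ℝ) * ((n:ℝ) + 1) ^ (9/10:ℝ)) := by rw [← e]
        _ ≤ 5 * (((n:ℝ) + 1) ^ (1/10:ℝ) * (4 * D.om i)) := by gcongr; linarith
        _ = _ := by ring
    linarith
  have : |D.t (2 * k) i i| * (1 + k / D.om i) ≤ |D.t (2 * k) i i| * (21 * ((n:ℝ) + 1) ^ (1/10:ℝ)) := by gcongr
  linarith

lemma A_main : ∃ B : ℝ, 0 < B ∧ ∀ n k : ℕ, 1 ≤ n → 1 ≤ k → (k:ℝ) ≤ 5 * ((n:ℝ) + 1) →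
    |D.A n k - max (2 * ((n:ℝ) + 1) - k) 0 / 4| ≤ B * ((n:ℝ) + 1) ^ (9/10:ℝ) := by
  obtain ⟨B, hB, hd⟩ := D.diag_sum
  have hK0 := D.K0_pos
  have hK1 := D.K1_pos
  have hl := abs_nonneg lam
  refine ⟨21 * B + 1000 * D.K0 * D.K1 + 9 * (4 * |lam| + 1) + 1, by positivity, fun n k hn hk hkn => ?_⟩
  have hN0 : 0 < (n:ℝ) + 1 := by positivity
  set N := (n:ℝ) + 1 with hN
  have hN1 : 1 ≤ N := by rw [hN]; have : (0:ℝ) ≤ n := by positivity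
                         linarith
  have hP : 1 ≤ N ^ (9/10:ℝ) := Real.one_le_rpow hN1 (by norm_num)
  set G := (4 * |lam| + 1) * N ^ (9/10:ℝ) with hG
  have hG1 : N ^ (9/10:ℝ) ≤ G := by rw [hG]; nlinarith
  have hGl : 4 * |lam| ≤ G := by rw [hG]; nlinarith
  have h1 := gg_main_count n k
  rw [← hN] at h1
  have h2 : |D.A n k - ∑ i ∈ range (n + 1), ((if k ≤ i + n then (1:ℝ) else 0) + (if i + k ≤ n then (1:ℝ) else 0)) / 4| ≤
     (21 * B + 1000 * D.K0 * D.K1 + 9 * (4 * |lam| + 1)) * N ^ (9/10:ℝ) := by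
    rw [A, ← sum_sub_distrib]
    refine (abs_sum_le_sum_abs _ _).trans ?_
    refine (sum_le_sum (fun i hi => D.row_pt n i k G hn hk hkn (by have := mem_range.1 hi; omega) (hP.trans hG1) hGl hG1)).trans ?_
    rw [sum_add_distrib, sum_add_distrib, sum_add_distrib, sum_add_distrib, ← sum_mul, sum_const, card_range, nsmul_eq_mul]
    have c1 := gg_count (n+1) 0 G (hP.trans hG1)
    have c2 := gg_count (n+1) ((n:ℝ) - k) G (hP.trans hG1)
    have c3 := gg_count (n+1) ((k:ℝ) - n) G (hP.trans hG1)
    have c4 := hd (n+1) (2 * k) (by omega)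
    rw [← hN]
    push_cast at c4 ⊢
    rw [← hN] at c4 ⊢
    have c5 : (∑ i ∈ range (n+1), |D.t (2 * k) i i|) * (21 * N ^ (1/10:ℝ)) ≤ 21 * B * N ^ (9/10:ℝ) := by
      calc _ ≤ (B * N ^ (2/5:ℝ)) * (21 * N ^ (1/10:ℝ)) := by gcongr
        _ = 21 * B * (N ^ (2/5:ℝ) * N ^ (1/10:ℝ)) := by ring
        _ = 21 * B * N ^ (1/2:ℝ) := by rw [← Real.rpow_add hN0]; norm_num
        _ ≤ _ := mul_le_mul_of_nonneg_left (Real.rpow_le_rpow_of_exponent_le hN1 (by norm_num)) (by positivity)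
    have c6 : N * (1000 * D.K0 * D.K1 * N ^ (-(1/10):ℝ)) = 1000 * D.K0 * D.K1 * N ^ (9/10:ℝ) := by
      have : N ^ (9/10:ℝ) = N * N ^ (-(1/10):ℝ) := by
        nth_rewrite 2 [← Real.rpow_one N]
        rw [← Real.rpow_add hN0]; norm_num
      rw [this]; ring
    rw [c6]
    linarith
  have h3 := abs_sub_le (D.A n k) (∑ i ∈ range (n + 1), ((if k ≤ i + n then (1:ℝ) else 0) + (if i + k ≤ n then (1:ℝ) else 0)) / 4) (max (2 * N - k) 0 / 4)
  linarith

end GGData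

lemma gg_bern (m : ℕ) (y : ℝ) (h0 : 0 ≤ y) (h1 : y ≤ 1) : ((m:ℝ) + 1) * ((1 - y) * y ^ m) ≤ 1 := by
  have h : ∑ l ∈ range (m + 1), y ^ m ≤ ∑ l ∈ range (m + 1), y ^ l := by
    apply sum_le_sum; intro l hl
    exact pow_le_pow_of_le_one h0 h1 (by have := mem_range.1 hl; omega)
  rw [sum_const, card_range, nsmul_eq_mul] at h
  have h2 := geom_sum_mul_neg y (m + 1)
  have h3 : 0 ≤ y ^ (m + 1) := by positivity
  push_cast at h
  nlinarith

namespace GGData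
open Polynomial
variable {lam : ℝ} (D : GGData lam)

noncomputable def mu (_ : GGData lam) (j : ℕ) : ℝ := j * (j + 2 * lam)

lemma dir_energy (j : ℕ) : D.J ((1 - X ^ 2) * (derivative (D.H j)) ^ 2) = D.mu j := by
  have hb := D.ibp (D.H j * derivative (D.H j))
  have ho := D.ode j
  have e : (1 - X ^ 2) * (derivative (D.H j)) ^ 2 = C (j * (j + 2 * lam)) * (D.H j * D.H j) +
     ((1 - X ^ 2) * derivative (D.H j * derivative (D.H j)) - (2 * C lam + 1) * X * (D.H j * derivative (D.H j))) := by
    simp only [derivative_mul, C_mul, C_add, map_natCast, map_ofNat]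
    linear_combination (-(D.H j)) * ho
  rw [e, map_add, hb, J_C_mul, D.norm_one, mu]; ring

lemma mu_nonneg (j : ℕ) : 0 ≤ D.mu j := by
  rw [← D.dir_energy]
  apply D.nonneg
  intro x hx
  simp only [eval_mul, eval_sub, eval_one, eval_pow, eval_X]
  have : x ^ 2 ≤ 1 := by nlinarith [hx.1, hx.2]
  have := sq_nonneg (eval x (derivative (D.H j)))
  apply mul_nonneg <;> linarith

noncomputable def Mm (m j : ℕ) : ℝ := D.J (X ^ (2 * m) * (D.H j * D.H j))

lemma Mm_rec (m j : ℕ) : (2 * (m:ℝ) + 1 + (2 * lam + 1) / 2) * D.Mm (m + 1) j ≤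
    (2 * m + 1) * D.Mm m j + 2 / (2 * lam + 1) * (D.mu j / (m + 1)) := by
  have hl := D.hlam
  set τ := 2 * lam + 1 with hτ
  have hτ0 : 0 < τ := by rw [hτ]; linarith
  have hb := D.ibp (X ^ (2 * m + 1) * (D.H j * D.H j))
  have e : ((1 - X ^ 2) * derivative (X ^ (2 * m + 1) * (D.H j * D.H j)) - (2 * C lam + 1) * X * (X ^ (2 * m + 1) * (D.H j * D.H j)))
     = C (2 * (m:ℝ) + 1) * (X ^ (2 * m) * (D.H j * D.H j)) - C (2 * (m:ℝ) + 1 + τ) * (X ^ (2 * (m+1)) * (D.H j * D.H j))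
      + 2 * ((1 - X ^ 2) * X ^ (2 * m + 1) * D.H j * derivative (D.H j)) := by
    simp only [hτ, derivative_mul, derivative_X_pow, C_mul, C_add, map_natCast, map_ofNat, map_one]
    push_cast
    ring
  rw [e, map_add, map_sub, J_C_mul, J_C_mul] at hb
  have h1 : D.J (2 * ((1 - X ^ 2) * X ^ (2 * m + 1) * D.H j * derivative (D.H j))) ≤
     D.J (C (τ / 2) * (X ^ (2 * (m+1)) * (D.H j * D.H j)) + C (2 / τ / (m + 1)) * ((1 - X ^ 2) * (derivative (D.H j)) ^ 2)) := by
    apply D.mono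
    intro x hx
    have hx2 : x ^ 2 ≤ 1 := by nlinarith [hx.1, hx.2]
    have hbn := gg_bern m (x ^ 2) (sq_nonneg x) hx2
    simp only [eval_mul, eval_sub, eval_one, eval_pow, eval_X, eval_add, eval_C, eval_ofNat]
    set u := eval x (D.H j)
    set v := eval x (derivative (D.H j))
    have e1 : (x ^ (2 * (m + 1)) * (u * u)) = (x ^ (m + 1) * u) ^ 2 := by ring
    have e2 : 2 * ((1 - x ^ 2) * x ^ (2 * m + 1) * u * v) = 2 * ((x ^ (m + 1) * u) * ((1 - x^2) * x ^ m * v)) := by ring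
    rw [e1, e2]
    set P := x ^ (m + 1) * u
    have hm : (0:ℝ) < m + 1 := by positivity
    have h3 : ((1 - x^2) * x ^ m * v) ^ 2 ≤ 1 / (m + 1) * ((1 - x ^ 2) * v ^ 2) := by
      have : ((1 - x^2) * x ^ m * v) ^ 2 = ((1 - x^2) * (x ^ 2) ^ m) * ((1 - x ^ 2) * v ^ 2) := by ring
      rw [this]
      apply mul_le_mul_of_nonneg_right
      · rw [le_div_iff₀ hm]; linarith
      · apply mul_nonneg (by linarith) (sq_nonneg _)
    set Q := (1 - x^2) * x ^ m * v
    have h4 : 2 * (P * Q) ≤ τ / 2 * P ^ 2 + 2 / τ * Q ^ 2 := by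
      have : 0 ≤ (τ * P - 2 * Q) ^ 2 / (2 * τ) := by positivity
      have e3 : (τ * P - 2 * Q) ^ 2 / (2 * τ) = τ / 2 * P ^ 2 + 2 / τ * Q ^ 2 - 2 * (P * Q) := by field_simp; ring
      linarith
    have h5 : 2 / τ * Q ^ 2 ≤ 2 / τ * (1 / (m + 1) * ((1 - x ^ 2) * v ^ 2)) := by gcongr
    have e4 : 2 / τ * (1 / (m + 1) * ((1 - x ^ 2) * v ^ 2)) = 2 / τ / (m + 1) * ((1 - x ^ 2) * v ^ 2) := by
      field_simp
    linarith
  rw [map_add, J_C_mul, J_C_mul, D.dir_energy] at h1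
  have e5 : 2 / τ / (m + 1) * D.mu j = 2 / τ * (D.mu j / (m + 1)) := by field_simp
  rw [e5] at h1
  simp only [Mm]
  linarith

noncomputable def sx (_ : GGData lam) : ℝ := (2 * lam + 1) / (8 * (1 + (2 * lam + 1)))
lemma sx_pos : 0 < D.sx := by
  have hl := D.hlam
  unfold sx; apply div_pos <;> linarith
lemma sx_le : D.sx ≤ 1 := by
  have hl := D.hlam
  unfold sx; rw [div_le_one (by linarith)]; linarith
lemma sx_le2 : D.sx ≤ (2 * lam + 1) / 8 := by
  have hl := D.hlam
  unfold sx; rw [div_le_div_iff₀ (by linarith) (by norm_num)]; nlinarith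

noncomputable def K4 (_ : GGData lam) : ℝ := 1 + 16 / (2 * lam + 1) ^ 2
lemma K4_pos : 1 ≤ D.K4 := by
  unfold K4; have : 0 ≤ 16 / (2 * lam + 1) ^ 2 := by positivity
  linarith

lemma Mm_le (j : ℕ) : ∀ m : ℕ, D.Mm m j ≤ D.K4 * (1 + D.mu j) * ((m:ℝ) + 1) ^ (-D.sx) := by
  have hl := D.hlam
  have hK := D.K4_pos
  have hmu := D.mu_nonneg j
  have hs := D.sx_pos
  have hs1 := D.sx_le
  have hs2 := D.sx_le2
  intro m
  induction m with
  | zero =>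
    simp only [Mm, Nat.cast_zero, zero_add, Real.one_rpow, mul_one, mul_zero, pow_zero, one_mul, D.norm_one]
    nlinarith
  | succ m ih =>
    have hr := D.Mm_rec m j
    set τ := 2 * lam + 1 with hτ
    have hτ0 : 0 < τ := by rw [hτ]; linarith
    set W := D.K4 * (1 + D.mu j) with hW
    have hm : (0:ℝ) ≤ m := by positivity
    have hm1 : (0:ℝ) < (m:ℝ) + 1 := by positivity
    have hm2 : (0:ℝ) < (m:ℝ) + 2 := by positivity
    push_cast
    rw [show (m:ℝ) + 1 + 1 = m + 2 by ring]
    set Y := ((m:ℝ) + 2) ^ (-D.sx) with hY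
    have hY0 : 0 < Y := by positivity
    have a1 : ((m:ℝ) + 1) ^ (-D.sx) ≤ Y * (1 + D.sx / (m + 1)) := by
      have e1 : ((m:ℝ) + 1) ^ (-D.sx) = Y * (1 + 1 / ((m:ℝ) + 1)) ^ D.sx := by
        have : 1 + 1 / ((m:ℝ) + 1) = (m + 2) / (m + 1) := by field_simp; ring
        rw [this, Real.div_rpow hm2.le hm1.le, hY, Real.rpow_neg hm1.le, Real.rpow_neg hm2.le]
        field_simp
      rw [e1]
      apply mul_le_mul_of_nonneg_left _ hY0.le
      have hp : 0 < 1 / ((m:ℝ) + 1) := by positivity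
      have := rpow_one_add_le_one_add_mul_self (s := 1 / ((m:ℝ) + 1)) (by linarith) hs.le hs1
      calc _ ≤ _ := this
        _ = _ := by ring
    have a2 : 1 / ((m:ℝ) + 1) ≤ 2 * Y := by
      have : ((m:ℝ) + 2) ^ (-1:ℝ) ≤ Y := Real.rpow_le_rpow_of_exponent_le (by linarith) (by linarith)
      rw [Real.rpow_neg_one] at this
      have h3 : 1 / ((m:ℝ) + 1) ≤ 2 * ((m:ℝ) + 2)⁻¹ := by
        rw [← div_eq_mul_inv, div_le_div_iff₀ hm1 hm2]; linarith
      linarith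
    have hW1 : 4 / τ * D.mu j ≤ τ / 4 * W := by
      have : 16 / τ ^ 2 * D.mu j ≤ W := by
        rw [hW]; unfold K4; rw [← hτ]
        have : 0 ≤ 16 / τ ^ 2 := by positivity
        nlinarith
      calc 4 / τ * D.mu j = τ / 4 * (16 / τ ^ 2 * D.mu j) := by field_simp; ring
        _ ≤ _ := by gcongr
    have hW0 : 0 ≤ W := by positivity
    have hc : 0 < 2 * (m:ℝ) + 1 + τ / 2 := by positivity
    apply le_of_mul_le_mul_left _ hc
    refine hr.trans ?_
    have b1 : (2 * (m:ℝ) + 1) * D.Mm m j ≤ (2 * m + 1) * (W * (Y * (1 + D.sx / (m + 1)))) := by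
      have : W * ((m:ℝ) + 1) ^ (-D.sx) ≤ W * (Y * (1 + D.sx / (m + 1))) := by gcongr
      gcongr
      exact ih.trans this
    have b2 : (2 * (m:ℝ) + 1) * (W * (Y * (1 + D.sx / (m + 1)))) ≤ (2 * m + 1 + τ / 4) * (W * Y) := by
      have : (2 * (m:ℝ) + 1) * (D.sx / (m + 1)) ≤ τ / 4 := by
        rw [mul_div_assoc', div_le_iff₀ hm1]; nlinarith
      have h3 := mul_le_mul_of_nonneg_right this (mul_nonneg hW0 hY0.le)
      linarith
    have b3 : 2 / τ * (D.mu j / (m + 1)) ≤ τ / 4 * W * Y := by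
      calc 2 / τ * (D.mu j / (m + 1)) = 2 / τ * D.mu j * (1 / (m + 1)) := by ring
        _ ≤ 2 / τ * D.mu j * (2 * Y) := by gcongr
        _ = 4 / τ * D.mu j * Y := by ring
        _ ≤ _ := by gcongr
    linarith

/-- the factor of `identI` is large for `k` beyond the spectrum. -/
lemma tail_t (n k i j : ℕ) (hl : |lam| ≤ (n:ℝ) + 1) (hk : 5 * ((n:ℝ) + 1) < k) (hi : i ≤ n) (hj : j ≤ n) :
    (k:ℝ) ^ 4 * |D.t k i j| ≤ 10 * D.K0 * |D.t2 k i j| := by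
  have hid := congrArg abs (D.identI k i j)
  rw [abs_mul, abs_mul] at hid
  have hK : |-(4 * (lam * (1 - lam)))| ≤ D.K0 := by
    rw [abs_neg, abs_mul, abs_of_pos (by norm_num : (0:ℝ) < 4)]; unfold K0; linarith
  have hi' : (i:ℝ) ≤ n := by exact_mod_cast hi
  have hj' : (j:ℝ) ≤ n := by exact_mod_cast hj
  have hi0 : (0:ℝ) ≤ i := by positivity
  have hj0 : (0:ℝ) ≤ j := by positivity
  have l1 := neg_abs_le lam
  have l2 := le_abs_self lam
  have hk0 : (0:ℝ) < k := by have : (0:ℝ) ≤ n := by positivity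
                             linarith
  have p1 : (D.om i + D.om j) ^ 2 ≤ 16 / 25 * (k:ℝ) ^ 2 := by
    have : |D.om i + D.om j| ≤ 4 / 5 * k := by
      rw [abs_le]; simp only [om]; constructor <;> linarith
    calc (D.om i + D.om j) ^ 2 = |D.om i + D.om j| ^ 2 := (sq_abs _).symm
      _ ≤ (4 / 5 * k) ^ 2 := by gcongr
      _ = _ := by ring
  have p2 : (D.om i - D.om j) ^ 2 ≤ 16 / 25 * (k:ℝ) ^ 2 := by
    have : |D.om i - D.om j| ≤ 4 / 5 * k := by
      rw [abs_le]; simp only [om]; constructor <;> linarith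
    calc (D.om i - D.om j) ^ 2 = |D.om i - D.om j| ^ 2 := (sq_abs _).symm
      _ ≤ (4 / 5 * k) ^ 2 := by gcongr
      _ = _ := by ring
  have p3 : (k:ℝ) ^ 4 / 10 ≤ |(k:ℝ)^4 - 2 * k^2 * (D.om i ^ 2 + D.om j ^ 2) + (D.om i ^ 2 - D.om j ^ 2) ^ 2| := by
    refine le_trans ?_ (le_abs_self _)
    have e : (k:ℝ)^4 - 2 * k^2 * (D.om i ^ 2 + D.om j ^ 2) + (D.om i ^ 2 - D.om j ^ 2) ^ 2 =
      ((k:ℝ) ^ 2 - (D.om i + D.om j) ^ 2) * ((k:ℝ) ^ 2 - (D.om i - D.om j) ^ 2) := by ring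
    rw [e]
    have hk2 : 0 < (k:ℝ)^2 := by positivity
    have : (9 / 25 * (k:ℝ)^2) * (9 / 25 * (k:ℝ)^2) ≤ ((k:ℝ) ^ 2 - (D.om i + D.om j) ^ 2) * ((k:ℝ) ^ 2 - (D.om i - D.om j) ^ 2) := by
      apply mul_le_mul <;> linarith
    nlinarith
  have p4 : (k:ℝ) ^ 4 / 10 * |D.t k i j| ≤ D.K0 * |D.t2 k i j| := by
    calc _ ≤ _ := mul_le_mul_of_nonneg_right p3 (abs_nonneg _)
      _ = _ := hid
      _ ≤ _ := mul_le_mul_of_nonneg_right hK (abs_nonneg _)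
  linarith

lemma A_nonneg (n k : ℕ) : 0 ≤ D.A n k := sum_nonneg (fun _ _ => sum_nonneg (fun _ _ => sq_nonneg _))

lemma A_tail (n k : ℕ) (hl : |lam| ≤ (n:ℝ) + 1) (hk : 5 * ((n:ℝ) + 1) < k) :
    D.A n k ≤ 300 * D.K0 ^ 2 * D.K1 * ((n:ℝ) + 1) ^ (4/5:ℝ) := by
  have hK0 := D.K0_pos
  have hK1 := D.K1_pos
  have hn0 : (0:ℝ) ≤ n := by positivity
  have hk0 : (0:ℝ) < k := by linarith
  have hk1 : n + 1 ≤ k := by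
    have : ((n + 1 : ℕ):ℝ) ≤ k := by push_cast; linarith
    exact_mod_cast this
  have hrow : ∀ i ∈ range (n + 1), ∑ j ∈ range (n + 1), D.t k i j ^ 2 ≤ 100 * D.K0 ^ 2 * D.K1 * ((i:ℝ) + 1) ^ (-(2/3):ℝ) := by
    intro i hi
    have hi' := mem_range.1 hi
    have h := D.t2_row i k (by omega) (n + 1)
    rw [min_eq_left (by omega)] at h
    push_cast at h
    have h8 : 0 < (k:ℝ) ^ 8 := by positivity
    apply le_of_mul_le_mul_left _ h8
    rw [mul_sum]
    calc ∑ j ∈ range (n + 1), (k:ℝ) ^ 8 * D.t k i j ^ 2 ≤ ∑ j ∈ range (n + 1), 100 * D.K0 ^ 2 * D.t2 k i j ^ 2 := by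
          apply sum_le_sum
          intro j hj
          have := D.tail_t n k i j hl hk (by omega) (by have := mem_range.1 hj; omega)
          calc (k:ℝ) ^ 8 * D.t k i j ^ 2 = ((k:ℝ) ^ 4 * |D.t k i j|) ^ 2 := by rw [mul_pow, sq_abs]; ring
            _ ≤ (10 * D.K0 * |D.t2 k i j|) ^ 2 := by gcongr
            _ = _ := by rw [mul_pow, sq_abs]; ring
      _ ≤ 100 * D.K0 ^ 2 * (D.K1 * (k:ℝ) ^ 8 * ((i:ℝ) + 1) ^ (-(2/3):ℝ)) := by
          rw [← mul_sum]; gcongr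
      _ = _ := by ring
  have h2 := gg_sum_23 (n + 1)
  push_cast at h2
  calc D.A n k ≤ ∑ i ∈ range (n + 1), 100 * D.K0 ^ 2 * D.K1 * ((i:ℝ) + 1) ^ (-(2/3):ℝ) := sum_le_sum hrow
    _ ≤ 100 * D.K0 ^ 2 * D.K1 * (3 * ((n:ℝ) + 1) ^ (1/3:ℝ)) := by rw [← mul_sum]; gcongr
    _ = 300 * D.K0 ^ 2 * D.K1 * ((n:ℝ) + 1) ^ (1/3:ℝ) := by ring
    _ ≤ _ := mul_le_mul_of_nonneg_left (Real.rpow_le_rpow_of_exponent_le (by linarith) (by norm_num)) (by positivity)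

lemma t2_decay (k i j : ℕ) (hk : 1 ≤ k) :
    |D.t2 k i j| ≤ k ^ 4 * ((D.Mm k i + D.Mm k j) + 4 / k) := by
  have hk0 : (0:ℝ) < k := by exact_mod_cast hk
  have h : |D.t2 k i j| ≤ D.J (C (1/2) * (maj k k * (D.H i * D.H i)) + C (1/2) * (maj k k * (D.H j * D.H j))) := by
    apply D.abs_le'
    intro x hx
    have := maj_bound k k hx
    simp only [eval_mul, eval_add, eval_C, abs_mul]
    set a := eval x (D.H i); set b := eval x (D.H j)
    set m := eval x (maj k k)
    have hm : 0 ≤ m := (abs_nonneg _).trans this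
    have h1 : |eval x (derivative (derivative (ggT k)))| * |a| * |b| ≤ m * |a| * |b| := by gcongr
    refine h1.trans ?_
    have : |a| * |b| ≤ 1/2 * (a * a) + 1/2 * (b * b) := by
      nlinarith [sq_nonneg (|a| - |b|), abs_mul_abs_self a, abs_mul_abs_self b]
    nlinarith
  have e : ∀ l, D.J (maj k k * (D.H l * D.H l)) = 2 * k ^ 4 * D.Mm k l + 4 * k * k ^ 2 := by
    intro l
    rw [maj, add_mul, map_add, mul_assoc, J_C_mul, J_C_mul, D.norm_one, Mm]; ring
  rw [map_add, J_C_mul, J_C_mul, e, e] at h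
  refine h.trans (le_of_eq ?_)
  field_simp
  ring

lemma t_decay : ∃ B : ℝ, 0 < B ∧ ∀ n k i j : ℕ, |lam| ≤ (n:ℝ) + 1 → 1 ≤ k → i ≤ n → j ≤ n →
    |D.t k i j| ≤ B * ((n:ℝ) + 1) ^ 2 * (k:ℝ) ^ (-D.sx) := by
  have hK0 := D.K0_pos
  have hK4 := D.K4_pos
  have hs := D.sx_pos
  have hs1 := D.sx_le
  refine ⟨80 * D.K0 * D.K4 + 40 * D.K0 + 5, by positivity, fun n k i j hl hk hi hj => ?_⟩
  have hk0 : (1:ℝ) ≤ k := by exact_mod_cast hk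
  have hn0 : (0:ℝ) ≤ n := by positivity
  have hkp : (0:ℝ) < k := by linarith
  set N := (n:ℝ) + 1 with hN
  have hN1 : 1 ≤ N := by linarith
  set Y := (k:ℝ) ^ (-D.sx) with hY
  have hY0 : 0 < Y := by positivity
  have hYk : 1 / (k:ℝ) ≤ Y := by
    rw [one_div, ← Real.rpow_neg_one]
    exact Real.rpow_le_rpow_of_exponent_le hk0 (by linarith)
  rcases le_or_gt (k:ℝ) (5 * N) with hc | hc
  · have h1 := D.t_abs k i j
    have h2 : 1 ≤ 5 * N * Y := by
      rw [div_le_iff₀ hkp] at hYk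
      calc 1 ≤ Y * k := hYk
        _ ≤ Y * (5 * N) := by gcongr
        _ = _ := by ring
    have h3 : 5 * N * Y ≤ 5 * N ^ 2 * Y := by gcongr; nlinarith
    have h4 : 5 * N ^ 2 * Y ≤ (80 * D.K0 * D.K4 + 40 * D.K0 + 5) * N ^ 2 * Y := by
      gcongr
      have : 0 ≤ D.K0 * D.K4 := by positivity
      linarith
    linarith
  · have h1 := D.tail_t n k i j hl hc hi hj
    have h2 := D.t2_decay k i j hk
    have hM : ∀ l, l ≤ n → D.Mm k l ≤ 4 * D.K4 * N ^ 2 * Y := by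
      intro l hln
      have hln' : (l:ℝ) ≤ n := by exact_mod_cast hln
      have hl0 : (0:ℝ) ≤ l := by positivity
      have hmu : 1 + D.mu l ≤ 4 * N ^ 2 := by
        unfold mu
        have l2 := le_abs_self lam
        have : (l:ℝ) * (l + 2 * lam) ≤ N * (N + 2 * N) := by
          rcases le_total 0 ((l:ℝ) + 2 * lam) with h | h
          · apply mul_le_mul <;> linarith
          · have : (l:ℝ) * (l + 2 * lam) ≤ 0 := mul_nonpos_of_nonneg_of_nonpos hl0 h
            have : 0 ≤ N * (N + 2 * N) := by positivity
            linarith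
        nlinarith
      refine (D.Mm_le l k).trans ?_
      have : ((k:ℝ) + 1) ^ (-D.sx) ≤ Y := Real.rpow_le_rpow_of_nonpos hkp (by linarith) (by linarith)
      calc D.K4 * (1 + D.mu l) * ((k:ℝ) + 1) ^ (-D.sx) ≤ D.K4 * (4 * N ^ 2) * Y := by gcongr
        _ = _ := by ring
    have h3 : (D.Mm k i + D.Mm k j) + 4 / k ≤ (8 * D.K4 + 4) * N ^ 2 * Y := by
      have := hM i hi
      have := hM j hj
      have h5 : 4 / (k:ℝ) ≤ 4 * N ^ 2 * Y := by
        have : 1 * Y ≤ N ^ 2 * Y := by gcongr; nlinarith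
        calc 4 / (k:ℝ) = 4 * (1 / k) := by ring
          _ ≤ 4 * Y := by gcongr
          _ ≤ _ := by linarith
      linarith
    have hk4 : (0:ℝ) < (k:ℝ) ^ 4 := by positivity
    apply le_of_mul_le_mul_left _ hk4
    calc (k:ℝ) ^ 4 * |D.t k i j| ≤ 10 * D.K0 * |D.t2 k i j| := h1
      _ ≤ 10 * D.K0 * (k ^ 4 * ((8 * D.K4 + 4) * N ^ 2 * Y)) := by
        have : (k:ℝ) ^ 4 * ((D.Mm k i + D.Mm k j) + 4 / k) ≤ k ^ 4 * ((8 * D.K4 + 4) * N ^ 2 * Y) := by gcongr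
        gcongr
        exact h2.trans this
      _ = k ^ 4 * ((80 * D.K0 * D.K4 + 40 * D.K0) * N ^ 2 * Y) := by ring
      _ ≤ _ := by
        have : 0 ≤ (k:ℝ) ^ 4 * (5 * N ^ 2 * Y) := by positivity
        linarith

noncomputable def cc (n k : ℕ) : ℝ := ∑ j ∈ range (n + 1), D.t k j j

/-- both decay estimates -/
lemma decay : ∃ B s : ℝ, 0 < B ∧ 0 < s ∧ ∀ n k : ℕ, |lam| ≤ (n:ℝ) + 1 → 1 ≤ k →
    D.cc n k ^ 2 ≤ B * ((n:ℝ) + 1) ^ (19/20:ℝ) * (k:ℝ) ^ (-s) ∧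
    (5 * ((n:ℝ) + 1) < k → D.A n k ≤ B * ((n:ℝ) + 1) ^ (19/20:ℝ) * (k:ℝ) ^ (-s)) ∧
    D.A n k ≤ B * ((n:ℝ) + 1) ^ 6 * (k:ℝ) ^ (-s) := by
  obtain ⟨B1, hB1, h1⟩ := D.t_decay
  obtain ⟨B2, hB2, h2⟩ := D.diag_sum
  have hs := D.sx_pos
  have hK0 := D.K0_pos
  have hK1 := D.K1_pos
  set B := B1 ^ 2 + B2 ^ 2 + 300 * D.K0 ^ 2 * D.K1 with hB
  have hB0 : 0 < B := by positivity
  have interp : ∀ x N k : ℝ, 0 ≤ x → 1 ≤ N → 1 ≤ k → x ≤ B * N ^ (4/5:ℝ) → x ≤ B * N ^ 6 * k ^ (-(2 * D.sx)) →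
      x ≤ B * N ^ (19/20:ℝ) * k ^ (-(D.sx / 20)) := by
    intro x N k hx hN hk ha hb
    have hN0 : 0 < N := by linarith
    have hk0 : 0 < k := by linarith
    have e : x = x ^ (39/40:ℝ) * x ^ (1/40:ℝ) := by
      rcases hx.eq_or_lt with rfl | hx
      · rw [Real.zero_rpow (by norm_num), zero_mul]
      · rw [← Real.rpow_add hx]; norm_num
    calc x = x ^ (39/40:ℝ) * x ^ (1/40:ℝ) := e
      _ ≤ (B * N ^ (4/5:ℝ)) ^ (39/40:ℝ) * (B * N ^ 6 * k ^ (-(2 * D.sx))) ^ (1/40:ℝ) := by gcongr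
      _ = (B ^ (39/40:ℝ) * B ^ (1/40:ℝ)) * (N ^ (4/5 * (39/40):ℝ) * N ^ (6 * (1/40):ℝ)) * k ^ (-(2 * D.sx) * (1/40)) := by
        rw [Real.mul_rpow hB0.le (by positivity), Real.mul_rpow (by positivity) (by positivity), Real.mul_rpow hB0.le (by positivity),
          ← Real.rpow_mul hN0.le, ← Real.rpow_mul hk0.le, ← Real.rpow_natCast N 6, ← Real.rpow_mul hN0.le]
        push_cast; ring
      _ = B * N ^ (93/100 : ℝ) * k ^ (-(D.sx / 20)) := by
        rw [← Real.rpow_add hB0, ← Real.rpow_add hN0]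
        norm_num
        left; congr 1; ring
      _ ≤ _ := by
        have := Real.rpow_le_rpow_of_exponent_le hN (by norm_num : (93/100:ℝ) ≤ 19/20)
        gcongr
  refine ⟨B, D.sx / 20, hB0, by positivity, fun n k hl hk => ?_⟩
  have hk1 : (1:ℝ) ≤ k := by exact_mod_cast hk
  have hk0 : (0:ℝ) < k := by linarith
  have hn0 : (0:ℝ) ≤ n := by positivity
  have eY : (k:ℝ) ^ (-(2 * D.sx)) = ((k:ℝ) ^ (-D.sx)) ^ 2 := by
    rw [← Real.rpow_natCast, ← Real.rpow_mul hk0.le]; congr 1; push_cast; ring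
  have hAd : D.A n k ≤ B * ((n:ℝ) + 1) ^ 6 * (k:ℝ) ^ (-(2 * D.sx)) := by
    calc D.A n k ≤ ∑ i ∈ range (n + 1), ∑ j ∈ range (n + 1), (B1 * ((n:ℝ) + 1) ^ 2 * (k:ℝ) ^ (-D.sx)) ^ 2 := by
          apply sum_le_sum; intro i hi
          apply sum_le_sum; intro j hj
          have := h1 n k i j hl hk (by have := mem_range.1 hi; omega) (by have := mem_range.1 hj; omega)
          rw [← sq_abs]
          gcongr
      _ = B1 ^ 2 * ((n:ℝ) + 1) ^ 6 * (k:ℝ) ^ (-(2 * D.sx)) := by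
          rw [sum_const, sum_const, card_range, nsmul_eq_mul, nsmul_eq_mul, eY]; push_cast; ring
      _ ≤ _ := by
          gcongr; rw [hB]
          have : 0 ≤ B2 ^ 2 + 300 * D.K0 ^ 2 * D.K1 := by positivity
          linarith
  refine ⟨?_, fun hk5 => ?_, ?_⟩
  · apply interp _ _ _ (sq_nonneg _) (by linarith) hk1
    · have h3 : |D.cc n k| ≤ B2 * ((n:ℝ) + 1) ^ (2/5:ℝ) := by
        refine (abs_sum_le_sum_abs _ _).trans ?_
        have := h2 (n + 1) k hk
        push_cast at this
        exact this
      calc D.cc n k ^ 2 = |D.cc n k| ^ 2 := (sq_abs _).symm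
        _ ≤ (B2 * ((n:ℝ) + 1) ^ (2/5:ℝ)) ^ 2 := by gcongr
        _ = B2 ^ 2 * ((n:ℝ) + 1) ^ (4/5:ℝ) := by
          rw [mul_pow, ← Real.rpow_natCast (((n:ℝ) + 1) ^ (2/5:ℝ)) 2, ← Real.rpow_mul (by linarith)]; norm_num
        _ ≤ _ := by
          gcongr; rw [hB]
          have : 0 ≤ B1 ^ 2 + 300 * D.K0 ^ 2 * D.K1 := by positivity
          linarith
    · have h3 : |D.cc n k| ≤ ((n:ℝ) + 1) * (B1 * ((n:ℝ) + 1) ^ 2 * (k:ℝ) ^ (-D.sx)) := by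
        refine (abs_sum_le_sum_abs _ _).trans ?_
        have : ∑ i ∈ range (n + 1), |D.t k i i| ≤ ∑ i ∈ range (n + 1), B1 * ((n:ℝ) + 1) ^ 2 * (k:ℝ) ^ (-D.sx) := by
          apply sum_le_sum; intro i hi
          exact h1 n k i i hl hk (by have := mem_range.1 hi; omega) (by have := mem_range.1 hi; omega)
        rw [sum_const, card_range, nsmul_eq_mul] at this
        push_cast at this
        exact this
      calc D.cc n k ^ 2 = |D.cc n k| ^ 2 := (sq_abs _).symm
        _ ≤ (((n:ℝ) + 1) * (B1 * ((n:ℝ) + 1) ^ 2 * (k:ℝ) ^ (-D.sx))) ^ 2 := by gcongr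
        _ = B1 ^ 2 * ((n:ℝ) + 1) ^ 6 * (k:ℝ) ^ (-(2 * D.sx)) := by rw [eY]; ring
        _ ≤ _ := by
          gcongr; rw [hB]
          have : 0 ≤ B2 ^ 2 + 300 * D.K0 ^ 2 * D.K1 := by positivity
          linarith
  · apply interp _ _ _ (D.A_nonneg n k) (by linarith) hk1 _ hAd
    refine (D.A_tail n k hl hk5).trans ?_
    gcongr; rw [hB]
    have : 0 ≤ B1 ^ 2 + B2 ^ 2 := by positivity
    linarith
  · refine hAd.trans ?_
    have := Real.rpow_le_rpow_of_exponent_le hk1 (by linarith : -(2 * D.sx) ≤ -(D.sx / 20))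
    gcongr

end GGData

noncomputable def ggP (r x y : ℝ) : ℝ := (1 + r^2)^2 - 4*r*(1 + r^2)*(x*y) + 4*r^2*(x^2 + y^2 - 1)

lemma ggP_lower {r x y : ℝ} (hr : 1/2 ≤ r) (hx : x ∈ Set.Icc (-1:ℝ) 1) (hy : y ∈ Set.Icc (-1:ℝ) 1) :
    (x - y)^2 ≤ ggP r x y := by
  have hxy : x * y ≤ 1 := by
    have : |x * y| ≤ 1 := by
      rw [abs_mul]; exact mul_le_one₀ (abs_le.2 hx) (abs_nonneg _) (abs_le.2 hy)
    exact (le_abs_self _).trans this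
  have e : ggP r x y = (1-r^2)^2 + 4*r^2*(x-y)^2 - 4*r*(1-r)^2*(x*y) := by unfold ggP; ring
  rw [e]
  have h1 : 4*r*(1-r)^2*(x*y) ≤ 4*r*(1-r)^2*1 := by gcongr
  have h2 : (1-r^2)^2 - 4*r*(1-r)^2 = ((1-r)^2)^2 := by ring
  have h3 : 0 ≤ ((1-r)^2)^2 := by positivity
  have h4 : (1:ℝ) * (x-y)^2 ≤ 4*r^2*(x-y)^2 := by gcongr; nlinarith
  linarith

lemma ggP_upper {r x y : ℝ} (hr : 1/2 ≤ r) (hr1 : r ≤ 1) (hx : x ∈ Set.Icc (-1:ℝ) 1) (hy : y ∈ Set.Icc (-1:ℝ) 1) :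
    ggP r x y ≤ 16 := by
  have hxy : -1 ≤ x * y := by
    have : |x * y| ≤ 1 := by
      rw [abs_mul]; exact mul_le_one₀ (abs_le.2 hx) (abs_nonneg _) (abs_le.2 hy)
    exact (abs_le.1 this).1
  have hx2 : x^2 ≤ 1 := by nlinarith [hx.1, hx.2]
  have hy2 : y^2 ≤ 1 := by nlinarith [hy.1, hy.2]
  unfold ggP
  have h1 : 4*r*(1+r^2)*(-1) ≤ 4*r*(1+r^2)*(x*y) := by gcongr
  have h2 : 4*r^2*(x^2+y^2-1) ≤ 4*r^2*1 := by gcongr; linarith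
  have h3 : (1+r^2)^2 + 4*r*(1+r^2) + 4*r^2 = ((1+r)^2)^2 := by ring
  have h4 : ((1+r)^2)^2 ≤ ((1+1)^2)^2 := by gcongr
  norm_num at h4
  linarith

lemma ggP_pos {r x y : ℝ} (hr : 1/2 ≤ r) (hr1 : r < 1) (hx : x ∈ Set.Icc (-1:ℝ) 1) (hy : y ∈ Set.Icc (-1:ℝ) 1) :
    0 < ggP r x y := by
  have h := ggP_lower hr hx hy
  rcases eq_or_ne x y with rfl | hne
  · have e : ggP r x x = (1-r^2)^2 - 4*r*(1-r)^2*(x*x) := by unfold ggP; ring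
    have hx2 : x*x ≤ 1 := by nlinarith [hx.1, hx.2]
    rw [e]
    have h1 : 4*r*(1-r)^2*(x*x) ≤ 4*r*(1-r)^2*1 := by gcongr
    have h2 : (1-r^2)^2 - 4*r*(1-r)^2 = ((1-r)^2)^2 := by ring
    have h3 : 0 < ((1-r)^2)^2 := by have : 0 < 1 - r := by linarith
                                    positivity
    linarith
  · have : 0 < (x-y)^2 := by have := sub_ne_zero.2 hne; positivity
    linarith

lemma gg_logcos (r a : ℝ) (h0 : 0 ≤ r) (h1 : r < 1) :
    HasSum (fun k : ℕ => r^k / k * cos (k * a)) (-(1/2) * log (1 + r^2 - 2*r*cos a)) := by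
  set z : ℂ := r * Complex.exp (a * Complex.I) with hz
  have hn : ‖z‖ = r := by rw [hz, norm_mul, Complex.norm_exp_ofReal_mul_I, mul_one, Complex.norm_real, Real.norm_of_nonneg h0]
  have h := (Complex.hasSum_taylorSeries_neg_log (z := z) (by rw [hn]; exact h1))
  have h2 := Complex.hasSum_re h
  have e1 : (-Complex.log (1 - z)).re = -(1/2) * log (1 + r^2 - 2*r*cos a) := by
    rw [Complex.neg_re, Complex.log_re]
    have e3 : ‖1 - z‖^2 = 1 + r^2 - 2*r*cos a := by
      rw [← Complex.normSq_eq_norm_sq, Complex.normSq_apply, hz, Complex.exp_mul_I]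
      simp [← Complex.ofReal_cos, ← Complex.ofReal_sin]
      nlinarith [sin_sq_add_cos_sq a]
    rw [← e3, Real.log_pow]; push_cast; ring
  rw [e1] at h2
  convert h2 using 2 with k
  have e4 : z^k = ((r^k : ℝ) : ℂ) * Complex.exp (((k * a : ℝ) : ℂ) * Complex.I) := by
    rw [hz, mul_pow, ← Complex.exp_nat_mul]; push_cast; congr 2; ring
  rw [e4, ← Complex.ofReal_natCast k, Complex.div_ofReal_re, Complex.re_ofReal_mul, Complex.exp_ofReal_mul_I_re]
  ring

lemma gg_logser (r x y : ℝ) (h0 : 1/2 ≤ r) (h1 : r < 1) (hx : x ∈ Set.Icc (-1:ℝ) 1) (hy : y ∈ Set.Icc (-1:ℝ) 1) :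
    HasSum (fun k : ℕ => 2 / (k:ℝ) * r^k * ((ggT k).eval x * (ggT k).eval y)) (-(1/2) * log (ggP r x y)) := by
  set θ := arccos x
  set φ := arccos y
  have ex : x = cos θ := (Real.cos_arccos hx.1 hx.2).symm
  have ey : y = cos φ := (Real.cos_arccos hy.1 hy.2).symm
  have ha := gg_logcos r (θ - φ) (by linarith) h1
  have hb := gg_logcos r (θ + φ) (by linarith) h1
  have h := ha.add hb
  have pos : ∀ c, 0 < 1 + r^2 - 2*r*cos c := by
    intro c
    have := Real.cos_le_one c
    have : 2*r*cos c ≤ 2*r*1 := by gcongr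
    nlinarith [sq_nonneg (1-r), mul_pos (sub_pos.2 h1) (sub_pos.2 h1)]
  convert h using 1
  · funext k
    rw [ex, ey]
    simp only [ggT]
    rw [Polynomial.Chebyshev.T_real_cos, Polynomial.Chebyshev.T_real_cos]
    push_cast
    rw [mul_sub, mul_add, cos_sub, cos_add]
    ring
  · rw [← mul_add, ← Real.log_mul (pos _).ne' (pos _).ne']
    congr 2
    rw [ex, ey, cos_sub, cos_add]
    unfold ggP
    have s1 := sin_sq θ
    have s2 := sin_sq φ
    linear_combination (4*r^2) * (sin φ)^2 * s1 + (4*r^2) * (1 - cos θ ^2) * s2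

/-- the truncated logarithmic kernel -/
noncomputable def ggg (r x y : ℝ) : ℝ := log 2 - 1/2 * log (ggP r x y)

lemma ggg_lower {r x y : ℝ} (hr : 1/2 ≤ r) (hr1 : r < 1) (hx : x ∈ Set.Icc (-1:ℝ) 1) (hy : y ∈ Set.Icc (-1:ℝ) 1) :
    0 ≤ ggg r x y + log 2 := by
  have h := Real.log_le_log (ggP_pos hr hr1 hx hy) (ggP_upper hr hr1.le hx hy)
  rw [show (16:ℝ) = 2^4 by norm_num, Real.log_pow] at h
  unfold ggg
  push_cast at h
  linarith

lemma ggg_upper {r x y : ℝ} (hr : 1/2 ≤ r) (hr1 : r < 1) (hx : x ∈ Set.Icc (-1:ℝ) 1) (hy : y ∈ Set.Icc (-1:ℝ) 1) (hne : x ≠ y) :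
    ggg r x y ≤ log 2 + log (1 / |x - y|) := by
  have hp : 0 < (x-y)^2 := by have := sub_ne_zero.2 hne; positivity
  have h := Real.log_le_log hp (ggP_lower hr hx hy)
  rw [← sq_abs, Real.log_pow] at h
  unfold ggg
  have e : log (1 / |x - y|) = -log |x - y| := by rw [one_div, Real.log_inv]
  rw [e]
  push_cast at h
  linarith

lemma ggg_tendsto (r : ℕ → ℝ) (hr : Filter.Tendsto r Filter.atTop (nhds 1)) {x y : ℝ} (hne : x ≠ y) :
    Filter.Tendsto (fun n => ggg (r n) x y) Filter.atTop (nhds (log (1 / |x - y|))) := by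
  have e : log (1 / |x - y|) = ggg 1 x y := by
    have : ggP 1 x y = 2^2 * |x-y|^2 := by rw [sq_abs]; unfold ggP; ring
    have hp : 0 < |x-y| := abs_pos.2 (sub_ne_zero.2 hne)
    unfold ggg
    rw [this, Real.log_mul (by norm_num) (by positivity), Real.log_pow, Real.log_pow, one_div |x - y|, Real.log_inv]
    push_cast; ring
  rw [e]
  have hc : Filter.Tendsto (fun n => ggP (r n) x y) Filter.atTop (nhds (ggP 1 x y)) := by
    have : Continuous (fun s => ggP s x y) := by unfold ggP; fun_prop
    exact (this.tendsto 1).comp hr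
  unfold ggg
  have h1 : ggP 1 x y ≠ 0 := by
    have : ggP 1 x y = 4 * (x-y)^2 := by unfold ggP; ring
    rw [this]; have := sub_ne_zero.2 hne; positivity
  exact tendsto_const_nhds.sub ((hc.log h1).const_mul _)

/-- Lebesgue measure on the square. -/
noncomputable abbrev ggMu : Measure (ℝ × ℝ) :=
  (volume.restrict (Set.Icc (-1:ℝ) 1)).prod (volume.restrict (Set.Icc (-1:ℝ) 1))

lemma gg_ae_mem : ∀ᵐ z ∂ggMu, z.1 ∈ Set.Icc (-1:ℝ) 1 ∧ z.2 ∈ Set.Icc (-1:ℝ) 1 := by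
  rw [ggMu, Measure.prod_restrict]
  filter_upwards [ae_restrict_mem (measurableSet_Icc.prod measurableSet_Icc)] with z hz
  exact hz

lemma gg_ae_ne : ∀ᵐ z ∂ggMu, z.1 ≠ z.2 := by
  have hm : MeasurableSet {z : ℝ × ℝ | z.1 ≠ z.2} :=
    (measurableSet_eq_fun measurable_fst measurable_snd).compl
  rw [ggMu, Measure.ae_prod_iff_ae_ae hm]
  refine Filter.Eventually.of_forall (fun x => ?_)
  have : ∀ᵐ y ∂(volume : Measure ℝ), y ≠ x := by simp [ae_iff]
  exact ae_restrict_of_ae (this.mono (fun y hy => Ne.symm hy))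

lemma gg_mul_prod (lam : ℝ) (hlam : -(1 / 2) < lam) {f g : ℝ → ℝ} (hf : Continuous f) (hg : Continuous g) :
    Integrable (fun z : ℝ × ℝ => f z.1 * g z.2 * (wG lam z.1 * wG lam z.2)) ggMu := by
  have := Integrable.mul_prod (gg_int_mul lam hlam hf) (gg_int_mul lam hlam hg)
  refine this.congr (Filter.Eventually.of_forall (fun z => ?_))
  simp only; ring

lemma gg_ggg_meas (r : ℝ) : Measurable (fun z : ℝ × ℝ => ggg r z.1 z.2) := by
  unfold ggg ggP
  exact (measurable_const).sub ((Measurable.log (by fun_prop)).const_mul _)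

lemma gg_series (lam : ℝ) (hlam : -(1 / 2) < lam) (u : Polynomial ℝ) (r : ℝ) (h0 : 1/2 ≤ r) (h1 : r < 1) :
    Integrable (fun z : ℝ × ℝ => ggg r z.1 z.2 * (u.eval z.1 * u.eval z.2 * (wG lam z.1 * wG lam z.2))) ggMu ∧
    HasSum (fun k : ℕ => 2 / (k:ℝ) * r^k * ggJ lam hlam (ggT k * u) ^ 2)
      (∫ z, ggg r z.1 z.2 * (u.eval z.1 * u.eval z.2 * (wG lam z.1 * wG lam z.2)) ∂ggMu
        - log 2 * ggJ lam hlam u ^ 2) := by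
  set G : ℝ × ℝ → ℝ := fun z => u.eval z.1 * u.eval z.2 * (wG lam z.1 * wG lam z.2) with hG
  have iG : Integrable G ggMu := gg_mul_prod lam hlam u.continuous u.continuous
  have intG : ∫ z, G z ∂ggMu = ggJ lam hlam u ^ 2 := by
    have e : G = fun z : ℝ × ℝ => (u.eval z.1 * wG lam z.1) * (u.eval z.2 * wG lam z.2) := by
      funext z; simp only [hG]; ring
    rw [e, integral_prod_mul (fun x => u.eval x * wG lam x) (fun x => u.eval x * wG lam x), sq]
    rfl
  set F : ℕ → ℝ × ℝ → ℝ := fun k z => 2 / (k:ℝ) * r^k * ((ggT k).eval z.1 * (ggT k).eval z.2) * G z with hF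
  have iF : ∀ k, ∫ z, F k z ∂ggMu = 2 / (k:ℝ) * r^k * ggJ lam hlam (ggT k * u) ^ 2 := by
    intro k
    have e : F k = fun z : ℝ × ℝ => 2 / (k:ℝ) * r^k * (((ggT k * u).eval z.1 * wG lam z.1) * ((ggT k * u).eval z.2 * wG lam z.2)) := by
      funext z; simp only [hF, hG, Polynomial.eval_mul]; ring
    rw [e, integral_const_mul, integral_prod_mul (fun x => (ggT k * u).eval x * wG lam x) (fun x => (ggT k * u).eval x * wG lam x), sq]
    rfl
  have hr0 : 0 ≤ r := by linarith
  have hsum : Summable (fun k : ℕ => 2 * r^k) := (summable_geometric_of_lt_one hr0 h1).mul_left 2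
  have hbd : ∀ k, ∀ᵐ z ∂ggMu, ‖F k z‖ ≤ 2 * r^k * ‖G z‖ := by
    intro k
    filter_upwards [gg_ae_mem] with z hz
    simp only [hF]
    rw [norm_mul]
    gcongr
    rw [Real.norm_eq_abs, abs_mul, abs_mul, abs_mul]
    have a1 := ggT_abs k hz.1
    have a2 := ggT_abs k hz.2
    have a3 : |2 / (k:ℝ)| ≤ 2 := by
      rw [abs_of_nonneg (by positivity)]
      rcases Nat.eq_zero_or_pos k with rfl | hk
      · simp
      · have : (1:ℝ) ≤ k := by exact_mod_cast hk
        exact div_le_self (by norm_num) this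
    have a4 : |r^k| = r^k := abs_of_nonneg (by positivity)
    rw [a4]
    calc _ ≤ 2 * r^k * (1 * 1) := by gcongr
      _ = _ := by ring
  have hlim : ∀ᵐ z ∂ggMu, HasSum (fun k => F k z) (-(1/2) * log (ggP r z.1 z.2) * G z) := by
    filter_upwards [gg_ae_mem] with z hz
    exact (gg_logser r z.1 z.2 h0 h1 hz.1 hz.2).mul_right _
  have hmain := hasSum_integral_of_dominated_convergence (μ := ggMu) (F := F)
    (f := fun z => -(1/2) * log (ggP r z.1 z.2) * G z) (fun k z => 2 * r^k * ‖G z‖)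
    (fun k => by
      have : Continuous (fun z : ℝ × ℝ => 2 / (k:ℝ) * r^k * ((ggT k).eval z.1 * (ggT k).eval z.2)) := by
        have := (ggT k).continuous
        fun_prop
      exact this.aestronglyMeasurable.mul iG.1) hbd
    (Filter.Eventually.of_forall (fun z => hsum.mul_right _))
    (by simp_rw [tsum_mul_right]; exact iG.norm.const_mul _) hlim
  have hIntg : Integrable (fun z => -(1/2) * log (ggP r z.1 z.2) * G z) ggMu := by
    refine Integrable.mono' (g := fun z => (∑' k : ℕ, 2 * r^k) * ‖G z‖) (iG.norm.const_mul _) ?_ ?_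
    · refine AEStronglyMeasurable.mul ?_ iG.1
      refine Measurable.aestronglyMeasurable ?_
      unfold ggP
      exact (Measurable.log (by fun_prop)).const_mul _
    · filter_upwards [hlim, ae_all_iff.2 hbd] with z hz hb
      exact hz.norm_le_of_bounded (hsum.hasSum.mul_right _) hb
  have e : ∀ z : ℝ × ℝ, ggg r z.1 z.2 * G z = log 2 * G z + -(1/2) * log (ggP r z.1 z.2) * G z := by
    intro z; unfold ggg; ring
  have e2 : (fun z : ℝ × ℝ => ggg r z.1 z.2 * G z) = fun z => log 2 * G z + -(1/2) * log (ggP r z.1 z.2) * G z := funext e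
  constructor
  · rw [e2]; exact (iG.const_mul _).add hIntg
  · rw [e2, integral_add (iG.const_mul _) hIntg, integral_const_mul, intG, add_sub_cancel_left]
    simp_rw [iF] at hmain
    exact hmain

lemma gg_fatou {α : Type*} [MeasurableSpace α] {μ : Measure α} (f : ℕ → α → ℝ) (g : α → ℝ) (C : ℝ)
    (hf : ∀ n, Integrable (f n) μ) (h0 : ∀ n, ∀ᵐ x ∂μ, 0 ≤ f n x) (hC : ∀ n, ∫ x, f n x ∂μ ≤ C)
    (hl : ∀ᵐ x ∂μ, Filter.Tendsto (fun n => f n x) Filter.atTop (nhds (g x))) : Integrable g μ := by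
  rw [← memLp_one_iff_integrable]
  refine ⟨aestronglyMeasurable_of_tendsto_ae Filter.atTop (fun n => (hf n).1) hl, ?_⟩
  refine lt_of_le_of_lt (Lp.eLpNorm_lim_le_liminf_eLpNorm (fun n => (hf n).1) g hl) ?_
  refine lt_of_le_of_lt (b := ENNReal.ofReal C) ?_ ENNReal.ofReal_lt_top
  refine Filter.liminf_le_of_frequently_le' (Filter.Eventually.frequently (Filter.Eventually.of_forall (fun n => ?_)))
  rw [eLpNorm_one_eq_lintegral_enorm, ← ofReal_integral_norm_eq_lintegral_enorm (hf n)]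
  apply ENNReal.ofReal_le_ofReal
  refine le_trans (le_of_eq ?_) (hC n)
  refine integral_congr_ae ?_
  filter_upwards [h0 n] with x hx
  exact Real.norm_of_nonneg hx

noncomputable def ggr (n : ℕ) : ℝ := 1 - 1 / ((n:ℝ) + 2)

lemma ggr_bd (n : ℕ) : 1/2 ≤ ggr n ∧ ggr n < 1 := by
  unfold ggr
  have h : (0:ℝ) < (n:ℝ) + 2 := by positivity
  have h2 : 1 / ((n:ℝ)+2) ≤ 1/2 := by
    apply one_div_le_one_div_of_le (by norm_num); linarith [(Nat.cast_nonneg n : (0:ℝ) ≤ n)]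
  have h3 : 0 < 1 / ((n:ℝ)+2) := by positivity
  constructor <;> linarith

lemma ggr_tendsto : Filter.Tendsto ggr Filter.atTop (nhds 1) := by
  unfold ggr
  have : Filter.Tendsto (fun n : ℕ => 1 / ((n:ℝ) + 2)) Filter.atTop (nhds 0) := by
    have := (tendsto_one_div_add_atTop_nhds_zero_nat (𝕜 := ℝ)).comp (Filter.tendsto_add_atTop_nat 1)
    refine this.congr (fun n => ?_)
    simp only [Function.comp]; push_cast; ring
  simpa using tendsto_const_nhds (x := (1:ℝ)).sub this

lemma gg_term_le (lam : ℝ) (hlam : -(1 / 2) < lam) (u : Polynomial ℝ) (n k : ℕ) :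
    ‖2 / (k:ℝ) * (ggr n)^k * ggJ lam hlam (ggT k * u) ^ 2‖ ≤ 2 / (k:ℝ) * ggJ lam hlam (ggT k * u) ^ 2 := by
  have hr := ggr_bd n
  have h0 : 0 ≤ ggr n := by linarith [hr.1]
  rw [Real.norm_of_nonneg (by positivity)]
  have : ggr n ^ k ≤ 1 := pow_le_one₀ h0 hr.2.le
  calc _ ≤ 2 / (k:ℝ) * 1 * ggJ lam hlam (ggT k * u) ^ 2 := by gcongr
    _ = _ := by ring

lemma gg_log_int (lam : ℝ) (hlam : -(1 / 2) < lam)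
    (hs : Summable (fun k : ℕ => 2 / (k:ℝ) * ggJ lam hlam (ggT k * 1) ^ 2)) :
    Integrable (fun z : ℝ × ℝ => (log (1 / |z.1 - z.2|) + log 2) * (wG lam z.1 * wG lam z.2)) ggMu := by
  have iW : Integrable (fun z : ℝ × ℝ => wG lam z.1 * wG lam z.2) ggMu := by
    have := gg_mul_prod lam hlam (f := fun _ => 1) (g := fun _ => 1) continuous_const continuous_const
    simpa using this
  have hser := fun n => gg_series lam hlam 1 (ggr n) (ggr_bd n).1 (ggr_bd n).2
  simp only [Polynomial.eval_one, one_mul] at hser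
  refine gg_fatou (fun n z => (ggg (ggr n) z.1 z.2 + log 2) * (wG lam z.1 * wG lam z.2)) _
    ((log 2 * ggJ lam hlam 1 ^ 2 + ∑' k : ℕ, 2 / (k:ℝ) * ggJ lam hlam (ggT k * 1) ^ 2)
     + log 2 * ∫ z, wG lam z.1 * wG lam z.2 ∂ggMu) ?_ ?_ ?_ ?_
  · intro n
    simp only [add_mul]
    exact (hser n).1.add (iW.const_mul _)
  · intro n
    filter_upwards [gg_ae_mem] with z hz
    exact mul_nonneg (ggg_lower (ggr_bd n).1 (ggr_bd n).2 hz.1 hz.2)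
      (mul_nonneg (gg_wG_nonneg lam hlam hz.1) (gg_wG_nonneg lam hlam hz.2))
  · intro n
    simp only [add_mul]
    rw [integral_add (hser n).1 (iW.const_mul _), integral_const_mul]
    have h1 := (hser n).2
    have h2 := hasSum_le (fun k => (le_abs_self _).trans (gg_term_le lam hlam 1 n k)) (by simpa only [mul_one] using h1)
      hs.hasSum
    linarith
  · filter_upwards [gg_ae_ne] with z hz
    exact ((ggg_tendsto ggr ggr_tendsto hz).add_const _).mul_const _

lemma gg_log_energy (lam : ℝ) (hlam : -(1 / 2) < lam)
    (hs1 : Summable (fun k : ℕ => 2 / (k:ℝ) * ggJ lam hlam (ggT k * 1) ^ 2)) (u : Polynomial ℝ)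
    (hs : Summable (fun k : ℕ => 2 / (k:ℝ) * ggJ lam hlam (ggT k * u) ^ 2)) :
    Integrable (fun z : ℝ × ℝ => log (1 / |z.1 - z.2|) * (u.eval z.1 * u.eval z.2 * (wG lam z.1 * wG lam z.2))) ggMu ∧
    ∫ z, log (1 / |z.1 - z.2|) * (u.eval z.1 * u.eval z.2 * (wG lam z.1 * wG lam z.2)) ∂ggMu
      = log 2 * ggJ lam hlam u ^ 2 + ∑' k : ℕ, 2 / (k:ℝ) * ggJ lam hlam (ggT k * u) ^ 2 := by
  have iL := gg_log_int lam hlam hs1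
  have iW : Integrable (fun z : ℝ × ℝ => wG lam z.1 * wG lam z.2) ggMu := by
    have := gg_mul_prod lam hlam (f := fun _ => 1) (g := fun _ => 1) continuous_const continuous_const
    simpa using this
  have hser := fun n => gg_series lam hlam u (ggr n) (ggr_bd n).1 (ggr_bd n).2
  obtain ⟨B, hB⟩ : ∃ B, ∀ x ∈ Set.Icc (-1:ℝ) 1, ‖u.eval x‖ ≤ B :=
    isCompact_Icc.exists_bound_of_continuousOn u.continuous.continuousOn
  have hB0 : 0 ≤ B := (norm_nonneg _).trans (hB 0 (by norm_num))
  set bd : ℝ × ℝ → ℝ := fun z => B * B * (log 2 * (wG lam z.1 * wG lam z.2) + (log (1 / |z.1 - z.2|) + log 2) * (wG lam z.1 * wG lam z.2)) with hbd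
  have ibd : Integrable bd ggMu := ((iW.const_mul _).add iL).const_mul _
  have hdom : ∀ n, ∀ᵐ z ∂ggMu, ‖ggg (ggr n) z.1 z.2 * (u.eval z.1 * u.eval z.2 * (wG lam z.1 * wG lam z.2))‖ ≤ bd z := by
    intro n
    filter_upwards [gg_ae_mem, gg_ae_ne] with z hz hne
    have hl := ggg_lower (ggr_bd n).1 (ggr_bd n).2 hz.1 hz.2
    have hu := ggg_upper (ggr_bd n).1 (ggr_bd n).2 hz.1 hz.2 hne
    have hw : 0 ≤ wG lam z.1 * wG lam z.2 := (mul_nonneg (gg_wG_nonneg lam hlam hz.1) (gg_wG_nonneg lam hlam hz.2))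
    have h2 := Real.log_nonneg (show (1:ℝ) ≤ 2 by norm_num)
    have h3 : 0 ≤ log (1 / |z.1 - z.2|) + log 2 := by
      have hp : 0 < |z.1 - z.2| := abs_pos.2 (sub_ne_zero.2 hne)
      have hle : |z.1 - z.2| ≤ 2 := by
        rw [abs_le]; constructor <;> linarith [hz.1.1, hz.1.2, hz.2.1, hz.2.2]
      have := Real.log_le_log hp hle
      rw [one_div, Real.log_inv]; linarith
    have habs : ‖ggg (ggr n) z.1 z.2‖ ≤ log 2 + (log (1 / |z.1 - z.2|) + log 2) := by
      rw [Real.norm_eq_abs, abs_le]; constructor <;> linarith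
    rw [norm_mul, norm_mul, norm_mul, Real.norm_of_nonneg hw, hbd]
    have b1 := hB _ hz.1
    have b2 := hB _ hz.2
    calc _ ≤ (log 2 + (log (1 / |z.1 - z.2|) + log 2)) * (B * B * (wG lam z.1 * wG lam z.2)) := by gcongr
      _ = _ := by ring
  have hptl : ∀ᵐ z ∂ggMu, Filter.Tendsto (fun n => ggg (ggr n) z.1 z.2 * (u.eval z.1 * u.eval z.2 * (wG lam z.1 * wG lam z.2)))
      Filter.atTop (nhds (log (1 / |z.1 - z.2|) * (u.eval z.1 * u.eval z.2 * (wG lam z.1 * wG lam z.2)))) := by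
    filter_upwards [gg_ae_ne] with z hz
    exact (ggg_tendsto ggr ggr_tendsto hz).mul_const _
  have hlim := tendsto_integral_of_dominated_convergence bd (fun n => (hser n).1.1) ibd hdom hptl
  have hlim2 : Filter.Tendsto (fun n => ∑' k : ℕ, 2 / (k:ℝ) * (ggr n)^k * ggJ lam hlam (ggT k * u) ^ 2) Filter.atTop
      (nhds (∑' k : ℕ, 2 / (k:ℝ) * ggJ lam hlam (ggT k * u) ^ 2)) := by
    refine tendsto_tsum_of_dominated_convergence hs (fun k => ?_) (Filter.Eventually.of_forall (fun n k => gg_term_le lam hlam u n k))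
    have := (((ggr_tendsto.pow k).const_mul (2 / (k:ℝ))).mul_const (ggJ lam hlam (ggT k * u) ^ 2))
    simpa using this
  constructor
  · refine Integrable.mono' ibd (aestronglyMeasurable_of_tendsto_ae Filter.atTop (fun n => (hser n).1.1) hptl) ?_
    filter_upwards [hptl, ae_all_iff.2 hdom] with z hz hb
    exact le_of_tendsto hz.norm (Filter.Eventually.of_forall hb)
  · refine tendsto_nhds_unique hlim ?_
    have e : ∀ n, ∫ z, ggg (ggr n) z.1 z.2 * (u.eval z.1 * u.eval z.2 * (wG lam z.1 * wG lam z.2)) ∂ggMu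
       = log 2 * ggJ lam hlam u ^ 2 + ∑' k : ℕ, 2 / (k:ℝ) * (ggr n)^k * ggJ lam hlam (ggT k * u) ^ 2 := by
      intro n; rw [(hser n).2.tsum_eq]; ring
    simp_rw [e]
    exact hlim2.const_add _

lemma gg_summ_pow (s : ℝ) (hs : 0 < s) : Summable (fun k : ℕ => 2 / (k:ℝ) * (k:ℝ)^(-s)) := by
  have h : Summable (fun k : ℕ => 2 * (k:ℝ)^(-(1+s))) := (Real.summable_nat_rpow.2 (by linarith)).mul_left 2
  refine h.congr (fun k => ?_)
  rcases Nat.eq_zero_or_pos k with rfl | hk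
  · rw [Nat.cast_zero, Real.zero_rpow (by linarith)]; simp
  · have : (0:ℝ) < k := by exact_mod_cast hk
    rw [neg_add, Real.rpow_add this, Real.rpow_neg_one]; ring

lemma gg_summ_of (f : ℕ → ℝ) (C s : ℝ) (hs : 0 < s) (h0 : ∀ k, 0 ≤ f k)
    (hf : ∀ k, 1 ≤ k → f k ≤ C * (k:ℝ)^(-s)) : Summable (fun k : ℕ => 2 / (k:ℝ) * f k) := by
  refine Summable.of_nonneg_of_le (fun k => mul_nonneg (by positivity) (h0 k)) (fun k => ?_) ((gg_summ_pow s hs).mul_left C)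
  rcases Nat.eq_zero_or_pos k with rfl | hk
  · simp
  · calc _ ≤ 2 / (k:ℝ) * (C * (k:ℝ)^(-s)) := by gcongr; exact hf k hk
      _ = _ := by ring

lemma GGData.t_sq_le_A {lam : ℝ} (D : GGData lam) (n k i j : ℕ) (hi : i ≤ n) (hj : j ≤ n) :
    D.t k i j ^ 2 ≤ D.A n k := by
  have h1 : D.t k i j ^ 2 ≤ ∑ j ∈ range (n+1), D.t k i j ^ 2 :=
    single_le_sum (f := fun j => D.t k i j ^ 2) (fun _ _ => sq_nonneg _) (mem_range.2 (by omega))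
  have h2 := single_le_sum (s := range (n+1)) (f := fun i => ∑ j ∈ range (n+1), D.t k i j ^ 2)
    (fun _ _ => sum_nonneg (fun _ _ => sq_nonneg _)) (mem_range.2 (show i < n+1 by omega))
  exact h1.trans h2

lemma GGData.summ_t {lam : ℝ} (D : GGData lam) (i j : ℕ) :
    Summable (fun k : ℕ => 2 / (k:ℝ) * D.t k i j ^ 2) := by
  obtain ⟨B, s, hB, hs, h⟩ := D.decay
  obtain ⟨m, hm⟩ := exists_nat_ge |lam|
  set n := max (max i j) m
  have hn : |lam| ≤ (n:ℝ) + 1 := by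
    have : (m:ℝ) ≤ n := by exact_mod_cast le_max_right _ _
    linarith
  refine gg_summ_of _ (B*((n:ℝ)+1)^6) s hs (fun k => sq_nonneg _) (fun k hk => ?_)
  exact (D.t_sq_le_A n k i j (by omega) (by omega)).trans (h n k hn hk).2.2

lemma ggH_zero (lam : ℝ) (hlam0 : lam ≠ 0) : ggH lam 0 = 1 := by
  apply Polynomial.funext
  intro x
  rw [ggH_eval]
  simp [GegHat, gamG, Geg, hlam0]

lemma gg_t_eq (lam : ℝ) (hlam : -(1 / 2) < lam) (hlam0 : lam ≠ 0) (k i j : ℕ) :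
    ggJ lam hlam (ggT k * (ggH lam i * ggH lam j)) = (ggD lam hlam hlam0).t k i j := by
  rw [← mul_assoc]; rfl

lemma gg_summ_one (lam : ℝ) (hlam : -(1 / 2) < lam) (hlam0 : lam ≠ 0) :
    Summable (fun k : ℕ => 2 / (k:ℝ) * ggJ lam hlam (ggT k * 1) ^ 2) := by
  have h := (ggD lam hlam hlam0).summ_t 0 0
  simp_rw [← gg_t_eq, ggH_zero lam hlam0, mul_one] at h
  simpa using h

lemma gg_KG (lam : ℝ) (n : ℕ) (x y : ℝ) :
    KG lam n x y = ∑ j ∈ range (n+1), (ggH lam j).eval x * (ggH lam j).eval y := by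
  simp only [KG, ggH_eval]

lemma gg_L1_eq (lam : ℝ) (hlam : -(1 / 2) < lam) (hlam0 : lam ≠ 0) (n : ℕ) (hn : |lam| ≤ (n:ℝ) + 1) :
    Summable (fun k : ℕ => 2 / (k:ℝ) * (ggD lam hlam hlam0).cc n k ^ 2) ∧
    L1 lam n = ((n:ℝ)+1)^2 * log 2 + ∑' k : ℕ, 2 / (k:ℝ) * (ggD lam hlam hlam0).cc n k ^ 2 := by
  set D := ggD lam hlam hlam0 with hD
  obtain ⟨B, s, hB, hs, h⟩ := D.decay
  have hsum : Summable (fun k : ℕ => 2 / (k:ℝ) * D.cc n k ^ 2) :=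
    gg_summ_of _ (B*((n:ℝ)+1)^(19/20:ℝ)) s hs (fun k => sq_nonneg _) (fun k hk => (h n k hn hk).1)
  refine ⟨hsum, ?_⟩
  set u : Polynomial ℝ := ∑ j ∈ range (n+1), ggH lam j * ggH lam j with hu
  have eT : ∀ k, ggJ lam hlam (ggT k * u) = D.cc n k := by
    intro k
    rw [hu, mul_sum, map_sum]
    exact sum_congr rfl (fun j _ => gg_t_eq lam hlam hlam0 k j j)
  have e1 : ggJ lam hlam u = (n:ℝ) + 1 := by
    rw [hu, map_sum]
    have : ∀ j, ggJ lam hlam (ggH lam j * ggH lam j) = 1 := by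
      intro j; have := D.orth j j; rw [if_pos rfl] at this; exact this
    simp [this]
  have key := gg_log_energy lam hlam (gg_summ_one lam hlam hlam0) u (by simpa only [eT] using hsum)
  simp only [eT, e1] at key
  rw [mul_comm, ← key.2, integral_prod _ key.1]
  unfold L1
  congr 1; funext x; congr 1; funext y
  simp only [gg_KG, hu, Polynomial.eval_finsetSum, Polynomial.eval_mul]
  ring

lemma gg_L2_eq (lam : ℝ) (hlam : -(1 / 2) < lam) (hlam0 : lam ≠ 0) (n : ℕ) :
    Summable (fun k : ℕ => 2 / (k:ℝ) * (ggD lam hlam hlam0).A n k) ∧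
    L2 lam n = ((n:ℝ)+1) * log 2 + ∑' k : ℕ, 2 / (k:ℝ) * (ggD lam hlam hlam0).A n k := by
  set D := ggD lam hlam hlam0 with hD
  have eA : ∀ k : ℕ, 2 / (k:ℝ) * D.A n k = ∑ i ∈ range (n+1), ∑ j ∈ range (n+1), 2 / (k:ℝ) * D.t k i j ^ 2 := by
    intro k; simp only [GGData.A, mul_sum]
  have hs1 : ∀ i, Summable (fun k : ℕ => ∑ j ∈ range (n+1), 2 / (k:ℝ) * D.t k i j ^ 2) :=
    fun i => summable_sum (fun j _ => D.summ_t i j)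
  have key := fun i j => gg_log_energy lam hlam (gg_summ_one lam hlam hlam0) (ggH lam i * ggH lam j)
    (by simpa only [gg_t_eq lam hlam hlam0] using D.summ_t i j)
  have orth : ∀ i j, ggJ lam hlam (ggH lam i * ggH lam j) = if i = j then 1 else 0 := fun i j => D.orth i j
  simp only [gg_t_eq lam hlam hlam0, orth] at key
  refine ⟨by simp_rw [eA]; exact summable_sum (fun i _ => hs1 i), ?_⟩
  simp_rw [eA]
  rw [Summable.tsum_finsetSum (fun i _ => hs1 i)]
  simp_rw [fun i => Summable.tsum_finsetSum (fun j (_ : j ∈ range (n+1)) => D.summ_t i j)]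
  have eN : ((n:ℝ)+1) * log 2 = ∑ i ∈ range (n+1), ∑ j ∈ range (n+1), log 2 * (if i = j then (1:ℝ) else 0)^2 := by
    have : ∀ i ∈ range (n+1), ∑ j ∈ range (n+1), log 2 * (if i = j then (1:ℝ) else 0)^2 = log 2 := by
      intro i hi
      rw [sum_eq_single i (fun j _ hj => by simp [hj.symm]) (fun h => absurd hi h)]
      simp
    rw [sum_congr rfl this]
    simp
  rw [eN, ← sum_add_distrib]
  simp_rw [← sum_add_distrib]
  have e2 : ∀ i j, log 2 * (if i = j then (1:ℝ) else 0)^2 + ∑' k : ℕ, 2 / (k:ℝ) * D.t k i j ^ 2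
    = ∫ z, log (1 / |z.1 - z.2|) * ((ggH lam i * ggH lam j).eval z.1 * (ggH lam i * ggH lam j).eval z.2 * (wG lam z.1 * wG lam z.2)) ∂ggMu :=
    fun i j => (key i j).2.symm
  simp_rw [e2]
  have i1 : ∀ i, Integrable (fun z : ℝ × ℝ => ∑ j ∈ range (n+1), log (1 / |z.1 - z.2|) * ((ggH lam i * ggH lam j).eval z.1 * (ggH lam i * ggH lam j).eval z.2 * (wG lam z.1 * wG lam z.2))) ggMu :=
    fun i => integrable_finsetSum _ (fun j _ => (key i j).1)
  simp_rw [← fun i => integral_finsetSum (range (n+1)) (fun j _ => (key i j).1)]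
  rw [← integral_finsetSum _ (fun i _ => i1 i), integral_prod _ (integrable_finsetSum _ (fun i _ => i1 i))]
  unfold L2
  congr 1; funext x; congr 1; funext y
  simp only [gg_KG, Polynomial.eval_mul]
  rw [sq, sum_mul_sum]
  simp only [sum_mul]
  refine sum_congr rfl (fun i _ => sum_congr rfl (fun j _ => ?_))
  ring

lemma gg_main_sum (N : ℕ) :
    ∑ k ∈ range (2*N+1), 2 / (k:ℝ) * (max (2*(N:ℝ) - k) 0 / 4) = N * (harmonic (2*N) : ℝ) - N := by
  rw [sum_range_succ']
  have h : ∀ i ∈ range (2*N), 2 / ((i+1 : ℕ):ℝ) * (max (2*(N:ℝ) - (i+1:ℕ)) 0 / 4) = N * ((i+1:ℕ):ℝ)⁻¹ - 1/2 := by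
    intro i hi
    have hi' : ((i+1:ℕ):ℝ) ≤ 2*N := by exact_mod_cast (mem_range.1 hi)
    rw [max_eq_left (by linarith)]
    have : ((i+1:ℕ):ℝ) ≠ 0 := by positivity
    field_simp
    ring
  rw [sum_congr rfl h, sum_sub_distrib, ← mul_sum, harmonic]
  push_cast
  simp
  ring

lemma gg_harm_sum (M : ℕ) : ∑ k ∈ range (M+1), 2 / (k:ℝ) = 2 * (harmonic M : ℝ) := by
  rw [sum_range_succ', harmonic, Rat.cast_sum, mul_sum]
  simp [div_eq_mul_inv]

lemma GGData.A_sum {lam : ℝ} (D : GGData lam) : ∃ C : ℝ, 0 < C ∧ ∀ n : ℕ, 1 ≤ n → |lam| ≤ (n:ℝ) + 1 →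
    Summable (fun k : ℕ => 2 / (k:ℝ) * D.A n k) →
    |∑' k : ℕ, 2 / (k:ℝ) * D.A n k - (((n:ℝ)+1) * (harmonic (2*(n+1)) : ℝ) - ((n:ℝ)+1))| ≤ C * ((n:ℝ)+1)^(19/20:ℝ) := by
  obtain ⟨B, hB, hA⟩ := D.A_main
  obtain ⟨B', s, hB', hs, hd⟩ := D.decay
  have hZ := gg_summ_pow s hs
  set Z := ∑' k : ℕ, 2 / (k:ℝ) * (k:ℝ)^(-s) with hZd
  have hZ0 : 0 ≤ Z := tsum_nonneg (fun k => by positivity)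
  refine ⟨B * (2 * ((1 + 1/(1/20)) * 5^(1/20:ℝ))) + B' * Z, by positivity, ?_⟩
  intro n hn hl hsum
  set N : ℝ := (n:ℝ) + 1 with hN
  have hN0 : 0 < N := by positivity
  set m : ℕ → ℝ := fun k => 2 / (k:ℝ) * (max (2*N - k) 0 / 4) with hm
  have hms : HasSum m (N * (harmonic (2*(n+1)) : ℝ) - N) := by
    have h := gg_main_sum (n+1)
    push_cast at h
    rw [← hN] at h
    rw [← h]
    refine hasSum_sum_of_ne_finset_zero (fun k hk => ?_)
    have hk' : 2*(n+1) + 1 ≤ k := by simpa using hk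
    have : 2*N ≤ k := by
      have : ((2*(n+1)+1 : ℕ):ℝ) ≤ k := by exact_mod_cast hk'
      push_cast at this; linarith
    simp only [hm]
    rw [max_eq_right (by linarith)]; simp
  have hdiff := hsum.hasSum.sub hms
  set M := 5*(n+1)
  have hMN : ((M:ℕ):ℝ) = 5*N := by simp [M, hN]
  have hg1 : HasSum (fun k => if k ∈ range (M+1) then 2 / (k:ℝ) * (B * N^(9/10:ℝ)) else 0) (∑ k ∈ range (M+1), 2 / (k:ℝ) * (B * N^(9/10:ℝ))) := by
    have := hasSum_sum_of_ne_finset_zero (L := SummationFilter.unconditional ℕ) (s := range (M+1)) (f := fun k : ℕ => if k ∈ range (M+1) then 2 / (k:ℝ) * (B * N^(9/10:ℝ)) else 0) (fun k hk => if_neg hk)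
    convert this using 1
    exact sum_congr rfl (fun k hk => (if_pos hk).symm)
  have hg2 := hZ.hasSum.mul_left (B' * N^(19/20:ℝ))
  have hb := hdiff.norm_le_of_bounded (hg1.add hg2) (fun k => by
    rcases Nat.eq_zero_or_pos k with rfl | hk
    · simp [hm]
    have hk0 : (0:ℝ) < k := by exact_mod_cast hk
    have hpos2 : 0 ≤ B' * N^(19/20:ℝ) * (2 / (k:ℝ) * (k:ℝ)^(-s)) := by positivity
    simp only [hm]
    rw [← mul_sub, norm_mul, Real.norm_of_nonneg (by positivity : 0 ≤ 2 / (k:ℝ)), Real.norm_eq_abs]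
    by_cases h5 : (k:ℝ) ≤ 5 * N
    · rw [if_pos (by
        have : k ≤ M := by rw [← hMN] at h5; exact_mod_cast h5
        exact mem_range.2 (by omega))]
      have := hA n k hn hk h5
      have : 2 / (k:ℝ) * |D.A n k - max (2 * N - k) 0 / 4| ≤ 2 / (k:ℝ) * (B * N^(9/10:ℝ)) := by gcongr
      linarith
    · push Not at h5
      rw [if_neg (by
        have : M < k := by rw [← hMN] at h5; exact_mod_cast h5
        rw [mem_range]; omega), max_eq_right (by linarith), zero_div, sub_zero, abs_of_nonneg (D.A_nonneg n k), zero_add]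
      have := (hd n k hl hk).2.1 h5
      calc _ ≤ 2 / (k:ℝ) * (B' * N^(19/20:ℝ) * (k:ℝ)^(-s)) := by gcongr
        _ = _ := by ring)
  rw [Real.norm_eq_abs] at hb
  refine hb.trans ?_
  rw [← sum_mul, gg_harm_sum]
  have hH := gg_harm_le M (by omega) (1/20) (by norm_num)
  rw [hMN, Real.mul_rpow (by norm_num) hN0.le] at hH
  have hp : N^(1/20:ℝ) * N^(9/10:ℝ) = N^(19/20:ℝ) := by
    rw [← Real.rpow_add hN0]; norm_num
  have : 2 * (harmonic M : ℝ) * (B * N^(9/10:ℝ)) ≤ 2 * ((1 + 1/(1/20)) * (5^(1/20:ℝ) * N^(1/20:ℝ))) * (B * N^(9/10:ℝ)) := by gcongr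
  calc _ ≤ 2 * ((1 + 1/(1/20)) * (5^(1/20:ℝ) * N^(1/20:ℝ))) * (B * N^(9/10:ℝ)) + B' * N^(19/20:ℝ) * Z := by linarith
    _ = B * (2 * ((1 + 1/(1/20)) * 5^(1/20:ℝ))) * (N^(1/20:ℝ) * N^(9/10:ℝ)) + B' * Z * N^(19/20:ℝ) := by ring
    _ = _ := by rw [hp]; ring

lemma gg_energy (lam : ℝ) (hlam : -(1 / 2) < lam) (hlam0 : lam ≠ 0) :
    ∃ C : ℝ, 0 < C ∧ ∀ n : ℕ, 1 ≤ n → |lam| ≤ (n:ℝ) + 1 →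
    |L1 lam n - L2 lam n - (((n:ℝ)+1)^2 * log 2 - ((n:ℝ)+1) * log 2 - (((n:ℝ)+1) * (harmonic (2*(n+1)) : ℝ) - ((n:ℝ)+1)))|
      ≤ C * ((n:ℝ)+1)^(19/20:ℝ) := by
  set D := ggD lam hlam hlam0 with hD
  obtain ⟨C, hC, h2⟩ := D.A_sum
  obtain ⟨B, s, hB, hs, hd⟩ := D.decay
  have hZ := gg_summ_pow s hs
  set Z := ∑' k : ℕ, 2 / (k:ℝ) * (k:ℝ)^(-s) with hZd
  have hZ0 : 0 ≤ Z := tsum_nonneg (fun k => by positivity)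
  refine ⟨C + B * Z, by positivity, fun n hn hl => ?_⟩
  obtain ⟨s1, e1⟩ := gg_L1_eq lam hlam hlam0 n hl
  obtain ⟨s2, e2⟩ := gg_L2_eq lam hlam hlam0 n
  have hA := abs_le.1 (h2 n hn hl s2)
  have p0 : 0 ≤ ∑' k : ℕ, 2 / (k:ℝ) * D.cc n k ^ 2 := tsum_nonneg (fun k => by positivity)
  have p1 : ∑' k : ℕ, 2 / (k:ℝ) * D.cc n k ^ 2 ≤ B * ((n:ℝ)+1)^(19/20:ℝ) * Z := by
    rw [hZd, ← tsum_mul_left]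
    refine s1.tsum_le_tsum (fun k => ?_) (hZ.mul_left _)
    rcases Nat.eq_zero_or_pos k with rfl | hk
    · simp
    calc _ ≤ 2 / (k:ℝ) * (B * ((n:ℝ)+1)^(19/20:ℝ) * (k:ℝ)^(-s)) := by gcongr; exact (hd n k hl hk).1
      _ = _ := by ring
  rw [e1, e2, abs_le]
  have hBZ : 0 ≤ B * ((n:ℝ)+1)^(19/20:ℝ) * Z := by positivity
  constructor <;> linarith [hA.1, hA.2]

theorem gegenbauer_dpp_expected_energy_asymptotics
    (lam : ℝ) (hlam : -(1 / 2) < lam) (hlam0 : lam ≠ 0) :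
    Filter.Tendsto
      (fun n : ℕ =>
        ((L1 lam n - L2 lam n) - ((n : ℝ) + 1) ^ 2 * Real.log 2
          + ((n : ℝ) + 1) * Real.log ((n : ℝ) + 1)
          - (1 - Real.eulerMascheroniConstant - 2 * Real.log 2) * (n : ℝ)) / (n : ℝ))
      Filter.atTop (nhds 0) := by
  obtain ⟨C, hC, hE⟩ := gg_energy lam hlam hlam0
  obtain ⟨m, hm⟩ := exists_nat_ge |lam|
  set c : ℝ := |1 - Real.eulerMascheroniConstant - 2 * Real.log 2| with hc
  set δ : ℕ → ℝ := fun n => (harmonic (2*(n+1)) : ℝ) - log (2*((n:ℝ)+1)) - Real.eulerMascheroniConstant with hδ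
  have hsub : Filter.Tendsto (fun n : ℕ => 2*(n+1)) Filter.atTop Filter.atTop :=
    Filter.tendsto_atTop_mono (fun n => by simp only [id]; omega) Filter.tendsto_id
  have hδ0 : Filter.Tendsto δ Filter.atTop (nhds 0) := by
    have h := (Real.tendsto_harmonic_sub_log.comp hsub).sub_const Real.eulerMascheroniConstant
    rw [sub_self] at h
    refine h.congr (fun n => ?_)
    simp [hδ]
  have hNt : Filter.Tendsto (fun n : ℕ => (n:ℝ) + 1) Filter.atTop Filter.atTop :=
    Filter.tendsto_atTop_add_const_right _ _ tendsto_natCast_atTop_atTop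
  have hpow : Filter.Tendsto (fun n : ℕ => ((n:ℝ)+1)^(-(1/20):ℝ)) Filter.atTop (nhds 0) :=
    (tendsto_rpow_neg_atTop (by norm_num : (0:ℝ) < 1/20)).comp hNt
  have hinv : Filter.Tendsto (fun n : ℕ => ((n:ℝ)+1)⁻¹) Filter.atTop (nhds 0) :=
    tendsto_inv_atTop_zero.comp hNt
  have hR : Filter.Tendsto (fun n : ℕ => 2 * (C * ((n:ℝ)+1)^(-(1/20):ℝ) + |δ n| + c * ((n:ℝ)+1)⁻¹)) Filter.atTop (nhds 0) := by
    have h := (((hpow.const_mul C).add hδ0.abs).add (hinv.const_mul c)).const_mul 2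
    simpa using h
  refine squeeze_zero_norm' ?_ hR
  filter_upwards [Filter.eventually_ge_atTop (m+1)] with n hn
  have hn1 : 1 ≤ n := by omega
  have hnr : (1:ℝ) ≤ n := by exact_mod_cast hn1
  have hnm : (m:ℝ) + 1 ≤ n := by exact_mod_cast hn
  have hE' := hE n hn1 (by linarith)
  set N : ℝ := (n:ℝ) + 1 with hN
  have hN0 : 0 < N := by positivity
  set err := L1 lam n - L2 lam n - (N^2 * log 2 - N * log 2 - (N * (harmonic (2*(n+1)) : ℝ) - N)) with herr
  have elog : log (2*N) = log 2 + log N := Real.log_mul (by norm_num) hN0.ne'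
  have e : (L1 lam n - L2 lam n) - N ^ 2 * Real.log 2 + N * Real.log N
          - (1 - Real.eulerMascheroniConstant - 2 * Real.log 2) * (n : ℝ)
      = err - N * δ n + (1 - Real.eulerMascheroniConstant - 2 * Real.log 2) := by
    have hnN : (n:ℝ) = N - 1 := by rw [hN]; ring
    simp only [hδ, herr]
    rw [← hN, elog, hnN]; ring
  rw [e, norm_div, Real.norm_eq_abs, Real.norm_eq_abs, abs_of_pos (by linarith : (0:ℝ) < n), div_le_iff₀ (by linarith)]
  have hp : N^(-(1/20):ℝ) * N = N^(19/20:ℝ) := by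
    rw [← Real.rpow_add_one hN0.ne']; norm_num
  have h1 : |err - N * δ n + (1 - Real.eulerMascheroniConstant - 2 * Real.log 2)| ≤ C * N^(19/20:ℝ) + N * |δ n| + c := by
    refine (abs_add_le _ _).trans ?_
    have h2 := abs_sub err (N * δ n)
    rw [abs_mul N, abs_of_pos hN0] at h2
    linarith
  have h3 : C * N^(19/20:ℝ) + N * |δ n| + c = (C * N^(-(1/20):ℝ) + |δ n| + c * N⁻¹) * N := by
    rw [← hp]; field_simp
  have h4 : 0 ≤ C * N^(-(1/20):ℝ) + |δ n| + c * N⁻¹ := by positivity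
  have h5 : N ≤ 2 * n := by rw [hN]; linarith
  calc _ ≤ (C * N^(-(1/20):ℝ) + |δ n| + c * N⁻¹) * N := by rw [← h3]; exact h1
    _ ≤ (C * N^(-(1/20):ℝ) + |δ n| + c * N⁻¹) * (2 * n) := by gcongr
    _ = _ := by ring
end

section
/- Let n ≥ 1 and let L1 = ∬_{[-1,1]²} K_n(x,x) K_n(y,y) log(1/|x-y|) w(x) w(y) dx dy, where K_n is the Chebyshev kernel and w(x) = 1/(π√(1-x²)). Then L1 = (n+1)²·log 2 + H_n/4. -/
open Real MeasureTheory Finset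

/-- Normalized Chebyshev polynomials of the first kind:
`Ĉ_0 = 1`, `Ĉ_j = √2 · T_j` for `j ≥ 1`. -/
noncomputable def Chat (j : ℕ) (x : ℝ) : ℝ :=
  if j = 0 then 1 else Real.sqrt 2 * (Polynomial.Chebyshev.T ℝ (j : ℤ)).eval x

/-- The Chebyshev weight `w(x) = 1/(π√(1-x²))`. -/
noncomputable def w0 (x : ℝ) : ℝ := 1 / (Real.pi * Real.sqrt (1 - x ^ 2))

/-- The Chebyshev (projection) kernel `K_n(x,y) = ∑_{j=0}^n Ĉ_j(x)Ĉ_j(y)`. -/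
noncomputable def K (n : ℕ) (x y : ℝ) : ℝ :=
  ∑ j ∈ Finset.range (n + 1), Chat j x * Chat j y

/-- The `n`-th harmonic number. -/
noncomputable def H (n : ℕ) : ℝ := ∑ k ∈ Finset.Icc 1 n, 1 / (k : ℝ)


/-- Antiderivative bookkeeping: `sin t * E m t = sin (2 m t)`. -/
noncomputable def auxE (m : ℕ) (t : ℝ) : ℝ := ∑ k ∈ Finset.range m, 2 * cos ((2 * k + 1) * t)

lemma auxE_spec (m : ℕ) (t : ℝ) : sin t * auxE m t = sin (2 * m * t) := by
  induction m with
  | zero => simp [auxE]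
  | succ m ih =>
    have h : auxE (m + 1) t = auxE m t + 2 * cos ((2 * m + 1) * t) := by
      simp [auxE, Finset.sum_range_succ]
    rw [h, mul_add, ih]
    have h1 : (2 * (m : ℝ)) * t = (2 * m + 1) * t - t := by ring
    have h2 : (2 * ((m + 1 : ℕ) : ℝ)) * t = (2 * m + 1) * t + t := by push_cast; ring
    rw [h1, h2, sin_sub, sin_add]; ring

noncomputable def auxD (m : ℕ) (t : ℝ) : ℝ :=
  ∑ k ∈ Finset.range m, (cos (2 * k * t) + cos (2 * (k + 1) * t))

lemma auxD_spec (m : ℕ) (t : ℝ) : sin t * auxD m t = sin (2 * m * t) * cos t := by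
  induction m with
  | zero => simp [auxD]
  | succ m ih =>
    have h : auxD (m + 1) t = auxD m t + (cos (2 * m * t) + cos (2 * (m + 1) * t)) := by
      simp [auxD, Finset.sum_range_succ]
    rw [h, mul_add, ih]
    have h1 : (2 * (m : ℝ)) * t = (2 * m + 1) * t - t := by ring
    have h2 : (2 * ((m : ℝ) + 1)) * t = (2 * m + 1) * t + t := by ring
    push_cast
    rw [h1, h2, sin_sub, sin_add, cos_sub, cos_add]
    ring

lemma integral_cos_two_mul (k : ℕ) (hk : k ≠ 0) : ∫ t in (0:ℝ)..π, cos (2 * k * t) = 0 := by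
  have hk' : (2 * k : ℝ) ≠ 0 := by positivity
  rw [intervalIntegral.integral_comp_mul_left (fun x => cos x) hk']
  have : sin (2 * (k : ℝ) * π) = 0 := by
    have := sin_nat_mul_pi (2 * k)
    push_cast at this; exact this
  simp [this]

lemma auxD_cont (m : ℕ) : Continuous (auxD m) := by unfold auxD; fun_prop

lemma auxE_cont (m : ℕ) : Continuous (auxE m) := by unfold auxE; fun_prop

lemma auxD_integral (m : ℕ) (hm : 1 ≤ m) : ∫ t in (0:ℝ)..π, auxD m t = π := by
  induction m, hm using Nat.le_induction with
  | base =>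
    have h := integral_cos_two_mul 1 one_ne_zero
    have h2 : ∀ t, auxD 1 t = 1 + cos (2 * (1:ℕ) * t) := by intro t; simp [auxD]
    simp_rw [h2]
    rw [intervalIntegral.integral_add (by simp) (Continuous.intervalIntegrable (by fun_prop) _ _), h]
    simp
  | succ m hm ih =>
    have h : ∀ t, auxD (m + 1) t = auxD m t + (cos (2 * m * t) + cos (2 * (m + 1 : ℕ) * t)) := by
      intro t; simp [auxD, Finset.sum_range_succ]
    simp_rw [h]
    rw [intervalIntegral.integral_add ((auxD_cont m).intervalIntegrable _ _)
        (Continuous.intervalIntegrable (by fun_prop) _ _),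
      intervalIntegral.integral_add (Continuous.intervalIntegrable (by fun_prop) _ _)
        (Continuous.intervalIntegrable (by fun_prop) _ _), ih,
      integral_cos_two_mul m (by omega), integral_cos_two_mul (m+1) (by omega)]
    simp

lemma ii_log_sin (f : ℝ → ℝ) (hf : Continuous f) (a b : ℝ) :
    IntervalIntegrable (fun t => f t * log (sin t)) volume a b :=
  (intervalIntegrable_log_sin (a := a) (b := b)).continuousOn_mul hf.continuousOn

lemma integral_cos_log_sin (m : ℕ) (hm : 1 ≤ m) :
    ∫ t in (0:ℝ)..π, cos (2 * m * t) * log (sin t) = - π / (2 * m) := by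
  have hm' : (2 * m : ℝ) ≠ 0 := by positivity
  have key := intervalIntegral.integral_eq_sub_of_hasDerivAt_of_le (a := 0) (b := π)
    (f := fun t => auxE m t * (sin t * log (sin t)))
    (f' := fun t => 2 * m * cos (2 * m * t) * log (sin t) + auxD m t) pi_pos.le
    (by
      apply Continuous.continuousOn
      exact (auxE_cont m).mul (Real.continuous_mul_log.comp continuous_sin))
    (by
      intro t ht
      have hs : 0 < sin t := sin_pos_of_mem_Ioo ht
      have e : (fun t => auxE m t * (sin t * log (sin t)))
          = fun t => sin (2 * m * t) * log (sin t) := by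
        funext t; rw [← auxE_spec]; ring
      rw [e]
      have h1 : HasDerivAt (fun t => sin (2 * m * t)) (cos (2 * m * t) * (2 * m * 1)) t :=
        ((hasDerivAt_id t).const_mul (2 * m : ℝ)).sin
      have h2 : HasDerivAt (fun t => log (sin t)) (cos t / sin t) t :=
        (hasDerivAt_sin t).log hs.ne'
      refine (h1.mul h2).congr_deriv ?_
      have := auxD_spec m t
      have : auxD m t = sin (2 * m * t) * (cos t / sin t) := by
        field_simp; linarith
      rw [this]; ring)
    ((ii_log_sin _ (by fun_prop) _ _).add ((auxD_cont m).intervalIntegrable _ _))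
  rw [intervalIntegral.integral_add (ii_log_sin _ (by fun_prop) _ _)
    ((auxD_cont m).intervalIntegrable _ _), auxD_integral m hm] at key
  simp only [mul_assoc, intervalIntegral.integral_const_mul] at key
  simp at key
  simp only [mul_assoc]
  rw [eq_div_iff (by simpa [mul_assoc] using hm')]
  linarith

noncomputable def ell (u : ℝ) : ℝ := log (sin (u / 2))

lemma ell_neg (u : ℝ) : ell (-u) = ell u := by
  unfold ell; rw [neg_div, sin_neg, log_neg_eq_log]

lemma ell_periodic (u : ℝ) : ell (u + 2 * π) = ell u := by
  unfold ell
  rw [show (u + 2 * π) / 2 = u / 2 + π by ring, sin_add_pi, log_neg_eq_log]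

lemma ii_ell (c a b : ℝ) : IntervalIntegrable (fun u => ell (u + c)) volume a b := by
  unfold ell
  apply MeromorphicOn.intervalIntegrable_log (f := fun u => sin ((u + c) / 2))
  intro x _
  apply AnalyticAt.meromorphicAt
  fun_prop

lemma ii_ell_mul (f : ℝ → ℝ) (hf : Continuous f) (c a b : ℝ) :
    IntervalIntegrable (fun u => f u * ell (u + c)) volume a b :=
  (ii_ell c a b).continuousOn_mul hf.continuousOn

lemma ii_ell_mul' (f : ℝ → ℝ) (hf : Continuous f) (a b : ℝ) :
    IntervalIntegrable (fun u => f u * ell u) volume a b := by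
  simpa using ii_ell_mul f hf 0 a b

/-- the Fourier coefficient -/
noncomputable def cf (m : ℕ) : ℝ := if m = 0 then -2 * π * log 2 else - π / m

lemma integral_cos_ell (m : ℕ) : ∫ u in (0:ℝ)..(2 * π), cos (m * u) * ell u = cf m := by
  have h := intervalIntegral.integral_comp_mul_left (a := 0) (b := π)
    (fun u => cos (m * u) * ell u) (two_ne_zero (α := ℝ))
  have e : ∀ t : ℝ, cos (m * (2 * t)) * ell (2 * t) = cos (2 * m * t) * log (sin t) := by
    intro t; unfold ell; congr 2
    · ring
    · congr 1; ring
  simp only [e, mul_zero] at h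
  have h' : ∫ u in (0:ℝ)..(2 * π), cos (m * u) * ell u
      = 2 * ∫ t in (0:ℝ)..π, cos (2 * m * t) * log (sin t) := by
    rw [h]; simp
  rw [h']
  unfold cf
  split_ifs with hm
  · subst hm
    simp [integral_log_sin_zero_pi]; ring
  · rw [integral_cos_log_sin m (by omega)]
    have : (m : ℝ) ≠ 0 := by exact_mod_cast hm
    field_simp

lemma integral_sin_ell (m : ℕ) : ∫ u in (0:ℝ)..(2 * π), sin (m * u) * ell u = 0 := by
  have h := intervalIntegral.integral_comp_sub_left (a := 0) (b := 2 * π)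
    (fun u => sin (m * u) * ell u) (2 * π)
  have e : ∀ u : ℝ, sin (m * (2 * π - u)) * ell (2 * π - u) = - (sin (m * u) * ell u) := by
    intro u
    rw [show 2 * π - u = -u + 2 * π by ring, ell_periodic, ell_neg,
      show (m : ℝ) * (-u + 2 * π) = -(m * u) + m * (2 * π) by ring, sin_add_nat_mul_two_pi, sin_neg]
    ring
  simp only [e, intervalIntegral.integral_neg, sub_self, sub_zero] at h
  linarith

lemma integral_shift (m : ℕ) (θ : ℝ) :
    ∫ φ in (0:ℝ)..π, cos (m * φ) * (ell (φ + θ) + ell (φ + -θ)) = cos (m * θ) * cf m := by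
  have hc : Continuous fun φ : ℝ => cos (m * φ) := by fun_prop
  simp only [mul_add]
  rw [intervalIntegral.integral_add (ii_ell_mul _ hc _ _ _) (ii_ell_mul _ hc _ _ _)]
  have h := intervalIntegral.integral_comp_neg (a := 0) (b := π)
    (fun φ => cos (m * φ) * ell (φ + θ))
  have e : ∀ φ : ℝ, cos (m * -φ) * ell (-φ + θ) = cos (m * φ) * ell (φ + -θ) := by
    intro φ
    rw [← ell_neg (-φ + θ), mul_neg, cos_neg]; congr 2; ring
  simp only [e, neg_zero] at h
  rw [h, add_comm, intervalIntegral.integral_add_adjacent_intervals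
    (ii_ell_mul _ hc _ _ _) (ii_ell_mul _ hc _ _ _)]
  have h2 := intervalIntegral.integral_comp_add_right (a := -π) (b := π)
    (fun u => cos (m * (u - θ)) * ell u) θ
  simp only [add_sub_cancel_right] at h2
  rw [h2]
  have hp : Function.Periodic (fun u => cos (m * (u - θ)) * ell u) (2 * π) := by
    intro u
    simp only
    rw [ell_periodic, show (m : ℝ) * (u + 2 * π - θ) = m * (u - θ) + m * (2 * π) by ring,
      cos_add_nat_mul_two_pi]
  have h3 := hp.intervalIntegral_add_eq (-π + θ) 0
  rw [show -π + θ + 2 * π = π + θ by ring, zero_add] at h3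
  rw [h3]
  have e2 : ∀ u : ℝ, cos (m * (u - θ)) * ell u
      = cos (m * θ) * (cos (m * u) * ell u) + sin (m * θ) * (sin (m * u) * ell u) := by
    intro u; rw [mul_sub, cos_sub]; ring
  simp only [e2]
  rw [intervalIntegral.integral_add ((ii_ell_mul' _ hc _ _).const_mul _)
    ((ii_ell_mul' _ (by fun_prop) _ _).const_mul _), intervalIntegral.integral_const_mul,
    intervalIntegral.integral_const_mul, integral_cos_ell, integral_sin_ell]
  ring

lemma log_split (θ φ : ℝ) (hθ : θ ∈ Set.Ioo 0 π) (hφ : φ ∈ Set.Ioc 0 π) (hne : φ ≠ θ) :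
    log (1 / |cos θ - cos φ|) = - log 2 - (ell (φ + θ) + ell (φ + -θ)) := by
  obtain ⟨h1, h2⟩ := hθ
  obtain ⟨h3, h4⟩ := hφ
  have hs1 : sin ((φ + θ) / 2) ≠ 0 :=
    (sin_pos_of_pos_of_lt_pi (by linarith) (by linarith)).ne'
  have hs2 : sin ((φ + -θ) / 2) ≠ 0 := by
    intro h
    have := (sin_eq_zero_iff_of_lt_of_lt (by linarith) (by linarith)).1 h
    apply hne; linarith
  have e : cos θ - cos φ = 2 * sin ((φ + θ) / 2) * sin ((φ + -θ) / 2) := by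
    rw [cos_sub_cos, add_comm θ φ, show (θ - φ) / 2 = -((φ + -θ) / 2) by ring, sin_neg]; ring
  rw [one_div, log_inv, log_abs, e, log_mul (by positivity) hs2, log_mul two_ne_zero hs1]
  unfold ell; ring

lemma integral_w0 (F : ℝ → ℝ) :
    ∫ x in Set.Icc (-1 : ℝ) 1, F x * w0 x = 1 / π * ∫ θ in (0:ℝ)..π, F (cos θ) := by
  rw [← Polynomial.Chebyshev.integral_measureT_eq_integral_cos,
    Polynomial.Chebyshev.integral_measureT, ← intervalIntegral.integral_const_mul,
    integral_Icc_eq_integral_Ioc, intervalIntegral.integral_of_le (by norm_num)]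
  congr 1; funext x
  simp only [w0, sqrt_inv]
  rw [one_div, mul_inv]; ring

lemma K_cos (n : ℕ) (θ : ℝ) :
    K n (cos θ) (cos θ) = (n + 1) + ∑ j ∈ Finset.range n, cos ((2 * (j + 1) : ℕ) * θ) := by
  unfold K
  rw [Finset.sum_range_succ']
  have : ∀ j : ℕ, Chat (j + 1) (cos θ) * Chat (j + 1) (cos θ)
      = 1 + cos ((2 * (j + 1) : ℕ) * θ) := by
    intro j
    unfold Chat
    rw [if_neg (by omega), Polynomial.Chebyshev.T_real_cos]
    have h2 := Real.mul_self_sqrt (show (0:ℝ) ≤ 2 by norm_num)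
    push_cast
    rw [mul_assoc 2, cos_two_mul]
    linear_combination (cos ((j + 1) * θ)) ^ 2 * h2
  simp only [this, Finset.sum_add_distrib]
  simp [Chat]; ring

lemma inner_base (m : ℕ) (θ : ℝ) (hθ : θ ∈ Set.Ioo 0 π) :
    IntervalIntegrable (fun φ => cos (m * φ) * log (1 / |cos θ - cos φ|)) volume 0 π ∧
    ∫ φ in (0:ℝ)..π, cos (m * φ) * log (1 / |cos θ - cos φ|) =
      if m = 0 then π * log 2 else π / m * cos (m * θ) := by
  have hae : ∀ᵐ φ : ℝ, φ ∈ Set.uIoc 0 π →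
      cos (m * φ) * (- log 2) - cos (m * φ) * (ell (φ + θ) + ell (φ + -θ)) =
      cos (m * φ) * log (1 / |cos θ - cos φ|) := by
    filter_upwards [Measure.ae_ne volume θ] with φ hφ hm
    rw [Set.uIoc_of_le pi_pos.le] at hm
    rw [log_split θ φ hθ hm hφ]; ring
  have hc : Continuous fun φ : ℝ => cos (m * φ) := by fun_prop
  have i1 : IntervalIntegrable (fun φ : ℝ => cos (m * φ) * (- log 2)) volume 0 π :=
    Continuous.intervalIntegrable (by fun_prop) _ _
  have i2 : IntervalIntegrable (fun φ => cos (m * φ) * (ell (φ + θ) + ell (φ + -θ))) volume 0 π := by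
    simp only [mul_add]
    exact (ii_ell_mul _ hc _ _ _).add (ii_ell_mul _ hc _ _ _)
  constructor
  · refine (i1.sub i2).congr_ae ?_
    exact (ae_restrict_iff' measurableSet_uIoc).2 hae
  · rw [← intervalIntegral.integral_congr_ae hae, intervalIntegral.integral_sub i1 i2,
      integral_shift, intervalIntegral.integral_mul_const]
    unfold cf
    split_ifs with hm
    · subst hm; simp; ring
    · have hm' : (m : ℝ) ≠ 0 := by exact_mod_cast hm
      rw [intervalIntegral.integral_comp_mul_left (fun x => cos x) hm']
      simp [sin_nat_mul_pi]; ring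

lemma inner_K (n : ℕ) (θ : ℝ) (hθ : θ ∈ Set.Ioo 0 π) :
    ∫ φ in (0:ℝ)..π, K n (cos φ) (cos φ) * log (1 / |cos θ - cos φ|) =
      π * ((n + 1) * log 2 +
        ∑ j ∈ Finset.range n, 1 / (2 * (j + 1) : ℕ) * cos ((2 * (j + 1) : ℕ) * θ)) := by
  have e : ∀ φ, K n (cos φ) (cos φ) * log (1 / |cos θ - cos φ|) =
      (n + 1) * (cos ((0:ℕ) * φ) * log (1 / |cos θ - cos φ|)) +
      ∑ j ∈ Finset.range n, cos ((2 * (j + 1) : ℕ) * φ) * log (1 / |cos θ - cos φ|) := by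
    intro φ; rw [K_cos, add_mul, Finset.sum_mul]; simp
  simp_rw [e]
  rw [intervalIntegral.integral_add ((inner_base 0 θ hθ).1.const_mul _)
    (by
      have := IntervalIntegrable.sum (Finset.range n)
        (fun j _ => (inner_base (2 * (j + 1)) θ hθ).1)
      simpa only [Finset.sum_fn] using this),
    intervalIntegral.integral_finsetSum fun j _ => (inner_base _ θ hθ).1,
    intervalIntegral.integral_const_mul, (inner_base 0 θ hθ).2]
  rw [mul_add, Finset.mul_sum, if_pos rfl]
  congr 1
  · ring
  · refine Finset.sum_congr rfl fun j _ => ?_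
    rw [(inner_base _ θ hθ).2, if_neg (by omega)]; ring

lemma integral_cos_sq_aux (i j : ℕ) :
    ∫ θ in (0:ℝ)..π, cos ((2 * (i + 1) : ℕ) * θ) * cos ((2 * (j + 1) : ℕ) * θ) =
      if i = j then π / 2 else 0 := by
  have h := Polynomial.Chebyshev.integral_measureT_eq_integral_cos
    (f := fun x => (Polynomial.Chebyshev.T ℝ ((2 * (i + 1) : ℕ) : ℤ)).eval x *
      (Polynomial.Chebyshev.T ℝ ((2 * (j + 1) : ℕ) : ℤ)).eval x)
  simp only [Polynomial.Chebyshev.T_real_cos, Int.cast_natCast] at h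
  rw [← h]
  split_ifs with hij
  · subst hij
    exact Polynomial.Chebyshev.integral_T_real_mul_self_measureT_of_ne_zero (by omega)
  · exact Polynomial.Chebyshev.integral_eval_T_real_mul_eval_T_real_measureT_of_ne (by omega)

lemma integral_cos_even (j : ℕ) : ∫ θ in (0:ℝ)..π, cos ((2 * (j + 1) : ℕ) * θ) = 0 := by
  have := integral_cos_two_mul (j + 1) (by omega)
  simpa using this

lemma outer_term (n j : ℕ) (hj : j ∈ Finset.range n) :
    ∫ θ in (0:ℝ)..π, K n (cos θ) (cos θ) * cos ((2 * (j + 1) : ℕ) * θ) = π / 2 := by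
  have e : ∀ θ, K n (cos θ) (cos θ) * cos ((2 * (j + 1) : ℕ) * θ) =
      ((n : ℝ) + 1) * cos ((2 * (j + 1) : ℕ) * θ) + ∑ i ∈ Finset.range n,
        cos ((2 * (i + 1) : ℕ) * θ) * cos ((2 * (j + 1) : ℕ) * θ) := by
    intro θ; rw [K_cos, add_mul, Finset.sum_mul]
  simp only [e]
  rw [intervalIntegral.integral_add (Continuous.intervalIntegrable (by fun_prop) _ _)
    (Continuous.intervalIntegrable (by fun_prop) _ _), intervalIntegral.integral_const_mul,
    integral_cos_even, intervalIntegral.integral_finsetSum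
      fun j _ => Continuous.intervalIntegrable (by fun_prop) _ _]
  simp only [integral_cos_sq_aux]
  rw [Finset.sum_ite_eq' , if_pos hj]
  ring

lemma integral_K (n : ℕ) : ∫ θ in (0:ℝ)..π, K n (cos θ) (cos θ) = π * (n + 1) := by
  simp only [K_cos]
  rw [intervalIntegral.integral_add (Continuous.intervalIntegrable (by fun_prop) _ _)
    (Continuous.intervalIntegrable (by fun_prop) _ _), intervalIntegral.integral_finsetSum
      fun j _ => Continuous.intervalIntegrable (by fun_prop) _ _]
  simp only [integral_cos_even]
  simp
  ring

lemma K_cont (n : ℕ) : Continuous fun θ => K n (cos θ) (cos θ) := by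
  simp only [K_cos]; fun_prop

theorem chebyshev_L1 (n : ℕ) (hn : 1 ≤ n) :
    (∫ x in Set.Icc (-1 : ℝ) 1, ∫ y in Set.Icc (-1 : ℝ) 1,
        K n x x * K n y y * Real.log (1 / |x - y|) * w0 x * w0 y) =
      ((n : ℝ) + 1) ^ 2 * Real.log 2 + H n / 4 := by
  have e1 : ∀ x, ∫ y in Set.Icc (-1 : ℝ) 1,
        K n x x * K n y y * Real.log (1 / |x - y|) * w0 x * w0 y =
      (K n x x * (1 / π * ∫ φ in (0:ℝ)..π, K n (cos φ) (cos φ) * log (1 / |x - cos φ|))) * w0 x := by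
    intro x
    rw [← integral_w0 (fun y => K n y y * log (1 / |x - y|)), mul_right_comm,
      ← integral_const_mul]
    congr 1; funext y; ring
  simp_rw [e1]
  rw [integral_w0 (fun x => K n x x *
    (1 / π * ∫ φ in (0:ℝ)..π, K n (cos φ) (cos φ) * log (1 / |x - cos φ|)))]
  have e2 : ∫ θ in (0:ℝ)..π, K n (cos θ) (cos θ) *
      (1 / π * ∫ φ in (0:ℝ)..π, K n (cos φ) (cos φ) * log (1 / |cos θ - cos φ|)) =
      ∫ θ in (0:ℝ)..π, (K n (cos θ) (cos θ) * ((n + 1) * log 2) +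
        ∑ j ∈ Finset.range n, 1 / (2 * (j + 1) : ℕ) *
          (K n (cos θ) (cos θ) * cos ((2 * (j + 1) : ℕ) * θ))) := by
    apply intervalIntegral.integral_congr_ae
    filter_upwards [Measure.ae_ne volume π] with θ hθ hm
    rw [Set.uIoc_of_le pi_pos.le] at hm
    rw [inner_K n θ ⟨hm.1, lt_of_le_of_ne hm.2 hθ⟩, ← mul_assoc (1 / π), one_div,
      inv_mul_cancel₀ pi_ne_zero, one_mul, mul_add, Finset.mul_sum]
    congr 1
    refine Finset.sum_congr rfl fun j _ => ?_
    ring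
  have hK := K_cont n
  rw [e2, intervalIntegral.integral_add (Continuous.intervalIntegrable (by fun_prop) _ _)
    (Continuous.intervalIntegrable (by fun_prop) _ _), intervalIntegral.integral_finsetSum
      fun j _ => Continuous.intervalIntegrable (by fun_prop) _ _,
    intervalIntegral.integral_mul_const, integral_K]
  have e3 : ∑ j ∈ Finset.range n, ∫ θ in (0:ℝ)..π, 1 / ((2 * (j + 1) : ℕ) : ℝ) *
          (K n (cos θ) (cos θ) * cos ((2 * (j + 1) : ℕ) * θ)) = π * (H n / 4) := by
    have hH : H n = ∑ j ∈ Finset.range n, 1 / ((j : ℝ) + 1) := by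
      unfold H
      have h := Finset.sum_Ico_add' (fun k : ℕ => 1 / (k : ℝ)) 0 n 1
      rw [Finset.range_eq_Ico]
      push_cast at h
      rw [h]
      rfl
    rw [hH, Finset.sum_div, Finset.mul_sum]
    refine Finset.sum_congr rfl fun j hj => ?_
    rw [intervalIntegral.integral_const_mul, outer_term n j hj]
    have : (j : ℝ) + 1 ≠ 0 := by positivity
    push_cast
    field_simp
    norm_num
  rw [e3]
  have := pi_ne_zero
  field_simp
end
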